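/- Fix 1 < p < 2 and let E*(p) = inf{∑_{x∼y}|φ_x − φ_y|^p : φ : ℤ² → ℝ finitely supported, φ_0 = 1}. There exists β₀ = β₀(p) such that for every β ≥ β₀ the following holds for the p-SOS model on Λ_L = {1,…,L}² with zero boundary conditions: there is a sequence of positive integers M = M(L) satisfying M(L)^p · (E*(p)·β)/(2·log L) → 1 as L → ∞, such that the maximum X_L = max_{x∈Λ_L} η_x satisfies π^{(p)}_{Λ_L}(X_L ∈ {M(L), M(L)+1}) → 1 as L → ∞. -/

import Mathlib

open Filter Topology Classical

noncomputable section

abbrev Site : Type := ℤ × ℤ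

/-- Nearest-neighbor adjacency in `ℤ²`. -/
def adjP (x y : Site) : Prop := |x.1 - y.1| + |x.2 - y.2| = 1

/-- The `p`-SOS Hamiltonian `∑_{x∼y} |η_x − η_y|^p` (each ordered pair counted once,
whence the factor 1/2). -/
def pH (p : ℝ) (η : Site → ℤ) : ℝ :=
  (1 / 2) * ∑' pr : Site × Site,
    if adjP pr.1 pr.2 then ((|η pr.1 - η pr.2| : ℤ) : ℝ) ^ p else 0

/-- Unnormalized weight of the event `A` for the `p`-SOS model on `Λ` with zero
boundary conditions. -/
def pW (p β : ℝ) (Λ : Finset Site) (A : (Site → ℤ) → Prop) : ℝ :=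
  ∑' η : Site → ℤ, if (∀ x ∉ Λ, η x = 0) ∧ A η then Real.exp (-β * pH p η) else 0

/-- `π^{(p)}_Λ(A)`: probability of the event `A` under the `p`-SOS measure on `Λ`. -/
def pProb (p β : ℝ) (Λ : Finset Site) (A : (Site → ℤ) → Prop) : ℝ :=
  pW p β Λ A / pW p β Λ (fun _ => True)

/-- The lattice ball `B_r = {x ∈ ℤ² : |x| ≤ r}`. -/
def ball (r : ℝ) : Finset Site :=
  ((Finset.Icc (-⌈r⌉) ⌈r⌉) ×ˢ (Finset.Icc (-⌈r⌉) ⌈r⌉)).filter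
    fun x => ((x.1 : ℝ) ^ 2 + (x.2 : ℝ) ^ 2 ≤ r ^ 2)

/-- The `p`-Dirichlet energy of a real-valued configuration. -/
def pDir (p : ℝ) (φ : Site → ℝ) : ℝ :=
  (1 / 2) * ∑' pr : Site × Site, if adjP pr.1 pr.2 then |φ pr.1 - φ pr.2| ^ p else 0

/-- `E*(p)`: the infimum of the `p`-Dirichlet energy over finitely supported real-valued
`φ` with `φ_0 = 1`. -/
def Estar (p : ℝ) : ℝ :=
  sInf {E | ∃ φ : Site → ℝ, (Function.support φ).Finite ∧ φ (0, 0) = 1 ∧ E = pDir p φ}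

/-- The box `Λ_L = {1,…,L}²`. -/
def box (L : ℕ) : Finset Site := Finset.Icc (1 : ℤ) (L : ℤ) ×ˢ Finset.Icc (1 : ℤ) (L : ℤ)

namespace PS
open scoped ENNReal

abbrev Edge : Type := Site × Bool
def tgt (e : Edge) : Site := if e.2 then (e.1.1, e.1.2 + 1) else (e.1.1 + 1, e.1.2)
def dd {G : Type*} [AddCommGroup G] (f : Site → G) (e : Edge) : G := f (tgt e) - f e.1

@[simp] lemma tgt_false (u : Site) : tgt (u, false) = (u.1 + 1, u.2) := by simp [tgt]
@[simp] lemma tgt_true (u : Site) : tgt (u, true) = (u.1, u.2 + 1) := by simp [tgt]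

def FS {G : Type*} [AddCommGroup G] (f : Site → G) : Prop :=
  ∃ N : ℤ, ∀ z : Site, f z ≠ 0 → (-N ≤ z.1 ∧ z.1 ≤ N) ∧ (-N ≤ z.2 ∧ z.2 ≤ N)

section
variable {G : Type*} [AddCommGroup G]

lemma FS_iff (f : Site → G) : FS f ↔ (Function.support f).Finite := by
  constructor
  · rintro ⟨N, hN⟩
    refine Set.Finite.subset ((Set.finite_Icc (-N) N).prod (Set.finite_Icc (-N) N)) ?_
    intro z hz
    exact ⟨(hN z hz).1, (hN z hz).2⟩
  · intro h
    obtain ⟨N, hN⟩ := (h.image (fun z : Site => |z.1| + |z.2|)).bddAbove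
    refine ⟨N, fun z hz => ?_⟩
    have := hN ⟨z, hz, rfl⟩
    simp only at this
    have h1 := abs_nonneg z.1
    have h2 := abs_nonneg z.2
    exact ⟨abs_le.1 (by omega), abs_le.1 (by omega)⟩

lemma dd_sub (f g : Site → G) (e : Edge) : dd (f - g) e = dd f e - dd g e := by
  simp only [dd, Pi.sub_apply]; abel

lemma dd_closed (f : Site → G) (q : Site) :
    dd f (q, false) + dd f ((q.1 + 1, q.2), true) = dd f (q, true) + dd f ((q.1, q.2 + 1), false) := by
  simp only [dd, tgt_false, tgt_true]; abel

lemma FS.sub {f g : Site → G} (hf : FS f) (hg : FS g) : FS (f - g) := by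
  rw [FS_iff] at *
  exact (hf.union hg).subset (Function.support_sub f g)

/-- finitely supported functions with zero gradient along a ray -/
lemma ray_right {f : Site → G} (hf : FS f) (a b : ℤ)
    (h : ∀ k, a ≤ k → dd f ((k, b), false) = 0) : f (a, b) = 0 := by
  obtain ⟨N, hN⟩ := hf
  have far : ∀ k, N < k → f (k, b) = 0 := by
    intro k hk; by_contra h0; have := (hN _ h0).1.2; simp at this; omega
  have key : ∀ n : ℕ, f (a + n, b) = f (a, b) := by
    intro n
    induction n with
    | zero => simp
    | succ n ih =>
      have := h (a + n) (by omega)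
      simp only [dd, tgt_false] at this
      push_cast
      rw [← add_assoc, sub_eq_zero.1 this, ih]
  rw [← key (N - a + 1).toNat]
  apply far; omega

lemma ray_left {f : Site → G} (hf : FS f) (a b : ℤ)
    (h : ∀ k, k < a → dd f ((k, b), false) = 0) : f (a, b) = 0 := by
  obtain ⟨N, hN⟩ := hf
  have far : ∀ k, k < -N → f (k, b) = 0 := by
    intro k hk; by_contra h0; have := (hN _ h0).1.1; simp at this; omega
  have key : ∀ n : ℕ, f (a - n, b) = f (a, b) := by
    intro n
    induction n with
    | zero => simp
    | succ n ih =>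
      have := h (a - (n + 1)) (by omega)
      simp only [dd, tgt_false] at this
      push_cast
      rw [← sub_eq_zero.1 this, ← ih]; congr 2; ring
  rw [← key (N + a + 1).toNat]
  apply far; omega

lemma ray_up {f : Site → G} (hf : FS f) (a b : ℤ)
    (h : ∀ k, b ≤ k → dd f ((a, k), true) = 0) : f (a, b) = 0 := by
  obtain ⟨N, hN⟩ := hf
  have far : ∀ k, N < k → f (a, k) = 0 := by
    intro k hk; by_contra h0; have := (hN _ h0).2.2; simp at this; omega
  have key : ∀ n : ℕ, f (a, b + n) = f (a, b) := by
    intro n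
    induction n with
    | zero => simp
    | succ n ih =>
      have := h (b + n) (by omega)
      simp only [dd, tgt_true] at this
      push_cast
      rw [← add_assoc, sub_eq_zero.1 this, ih]
  rw [← key (N - b + 1).toNat]
  apply far; omega

lemma dd_inj {f g : Site → G} (hf : FS f) (hg : FS g) (h : ∀ e, dd f e = dd g e) : f = g := by
  have : ∀ z, (f - g) z = 0 := by
    rintro ⟨a, b⟩
    apply ray_right (hf.sub hg)
    intro k _
    rw [dd_sub, h, sub_self]
  funext z
  exact sub_eq_zero.1 (this z)

/-- rectangles -/
def rect (a b c d : ℤ) : Finset Site := Finset.Icc a b ×ˢ Finset.Icc c d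

lemma supp_rect {f : Site → G} (hf : FS f) (a b c d : ℤ)
    (h : ∀ e : Edge, e.1 ∉ rect a b c d → tgt e ∉ rect a b c d → dd f e = 0) :
    ∀ z ∉ rect a b c d, f z = 0 := by
  rintro ⟨x, y⟩ hz
  simp only [rect, Finset.mem_product, Finset.mem_Icc, not_and_or, not_le] at h hz
  rcases hz with (hz | hz) | hz
  · apply ray_left hf; intro k hk; apply h <;> simp <;> omega
  · apply ray_right hf; intro k hk; apply h <;> simp <;> omega
  · apply ray_right hf; intro k hk; apply h <;> simp <;> omega

lemma ray_sum {f : Site → G} (hf : FS f) (a b : ℤ) :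
    ∃ N : ℤ, ∀ n, N ≤ n → f (a, b) = - ∑ k ∈ Finset.Ico a n, dd f ((k, b), false) := by
  obtain ⟨N, hN⟩ := hf
  have far : ∀ k, N < k → f (k, b) = 0 := by
    intro k hk; by_contra h0; have := (hN _ h0).1.2; simp at this; omega
  have key : ∀ n : ℕ, f (a + n, b) - f (a, b) = ∑ k ∈ Finset.Ico a (a + n), dd f ((k, b), false) := by
    intro n
    induction n with
    | zero => simp
    | succ n ih =>
      have : Finset.Ico a (a + (n + 1 : ℕ)) = insert (a + n : ℤ) (Finset.Ico a (a + n)) := by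
        ext k; simp only [Finset.mem_insert, Finset.mem_Ico]; omega
      rw [this, Finset.sum_insert (by simp), ← ih]
      simp only [dd, tgt_false]; push_cast; rw [add_assoc]; abel
  refine ⟨max (N + 1) a, fun n hn => ?_⟩
  obtain ⟨m, rfl⟩ : ∃ m : ℕ, n = a + m := ⟨(n - a).toNat, by have := le_max_right (N+1) a; omega⟩
  have h1 := le_max_left (N + 1) a
  rw [← key, far (a + m) (by omega)]; simp

lemma integrate {w : Edge → G} (hw : (Function.support w).Finite)
    (hc : ∀ q : Site, w (q, false) + w ((q.1 + 1, q.2), true) = w (q, true) + w ((q.1, q.2 + 1), false)) :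
    ∃ f : Site → G, FS f ∧ ∀ e, dd f e = w e := by
  obtain ⟨N, hN⟩ := (hw.image (fun e : Edge => |e.1.1| + |e.1.2|)).bddAbove
  have hN' : ∀ a b : ℤ, ∀ s, (N < a ∨ a < -N ∨ N < b ∨ b < -N) → w ((a, b), s) = 0 := by
    intro a b s h
    by_contra h0
    have := hN ⟨_, h0, rfl⟩
    simp only at this
    have h1 := abs_nonneg a
    have h2 := abs_nonneg b
    have h3 := abs_le.1 (show |a| ≤ N by omega)
    have h4 := abs_le.1 (show |b| ≤ N by omega)
    omega
  let f : Site → G := fun z => - ∑ k ∈ Finset.Ico z.1 (N + 1), w ((k, z.2), false)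
  have fH : ∀ a b, f (a + 1, b) - f (a, b) = w ((a, b), false) := by
    intro a b
    simp only [f]
    by_cases ha : a ≤ N
    · have : Finset.Ico a (N + 1) = insert a (Finset.Ico (a + 1) (N + 1)) := by
        ext k; simp only [Finset.mem_insert, Finset.mem_Ico]; omega
      rw [this, Finset.sum_insert (by simp)]; abel
    · rw [Finset.Ico_eq_empty (by omega), Finset.Ico_eq_empty (by omega), hN' a b _ (by omega)]; simp
  have fR : ∀ a b, N < a → f (a, b) = 0 := by
    intro a b h; simp only [f]; rw [Finset.Ico_eq_empty (by omega)]; simp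
  have fV : ∀ a b, f (a, b + 1) - f (a, b) = w ((a, b), true) := by
    intro a b
    have key : ∀ n : ℕ, ∀ a, N - a < n → f (a, b + 1) - f (a, b) = w ((a, b), true) := by
      intro n
      induction n with
      | zero => intro a ha; rw [fR _ _ (by omega), fR _ _ (by omega), hN' a b _ (by omega)]; simp
      | succ n ih =>
        intro a ha
        have h1 := ih (a + 1) (by push_cast at ha; omega)
        have h2 := hc (a, b)
        simp only at h2
        rw [← fH, ← fH, ← h1] at h2
        have : w ((a, b), true) = f (a + 1, b) - f (a, b) + (f (a + 1, b + 1) - f (a + 1, b)) -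
          (f (a + 1, b + 1) - f (a, b + 1)) := by rw [h2]; abel
        rw [this]; abel
    exact key (N - a + 1).toNat a (by omega)
  have fU : ∀ a b, (N < b ∨ b < -N) → f (a, b) = 0 := by
    intro a b h; simp only [f]; rw [Finset.sum_eq_zero]; · simp
    intro k _; apply hN'; omega
  have fL : ∀ a b, a < -N → f (a, b) = 0 := by
    intro a b ha
    have key : ∀ n : ℕ, ∀ b, N - b < n → f (a, b) = 0 := by
      intro n
      induction n with
      | zero => intro b hb; apply fU; left; push_cast at hb; omega
      | succ n ih =>
        intro b hb
        have h1 := ih (b + 1) (by push_cast at hb; omega)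
        have h2 := fV a b
        rw [h1, hN' a b _ (by omega)] at h2
        simpa using h2
    exact key (N - b + 1).toNat b (by omega)
  refine ⟨f, ⟨N, ?_⟩, ?_⟩
  · rintro ⟨a, b⟩ h0
    by_contra hcon
    apply h0
    by_cases h1 : N < a
    · exact fR _ _ h1
    by_cases h2 : a < -N
    · exact fL _ _ h2
    apply fU
    simp only at hcon
    omega
  · rintro ⟨⟨a, b⟩, s⟩
    cases s
    · simpa [dd] using fH a b
    · simpa [dd] using fV a b

lemma dd_support_finite {f : Site → G} (hf : FS f) : (Function.support (dd f)).Finite := by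
  rw [FS_iff] at hf
  have : Function.support (dd f) ⊆ (hf.toFinset.biUnion (fun z =>
      {(z, false), (z, true), ((z.1 - 1, z.2), false), ((z.1, z.2 - 1), true)} : Site → Finset Edge) : Set Edge) := by
    rintro ⟨⟨a, b⟩, s⟩ he
    have : f (a, b) ≠ 0 ∨ f (tgt ((a, b), s)) ≠ 0 := by
      by_contra! hcon
      apply he
      simp [dd, hcon]
    simp only [Finset.coe_biUnion, Set.mem_iUnion]
    rcases this with h | h
    · refine ⟨(a, b), by simpa using h, ?_⟩
      cases s <;> simp
    · refine ⟨_, by simpa using h, ?_⟩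
      cases s <;> simp
  exact (Finset.finite_toSet _).subset this
end

/-- plaquette -/
def pl (q : Site) : Finset Edge :=
  {(q, false), (q, true), ((q.1, q.2 + 1), false), ((q.1 + 1, q.2), true)}
def adjE (a b : Edge) : Prop := ∃ q, a ∈ pl q ∧ b ∈ pl q
def nb (e : Edge) : Finset Edge := pl e.1 ∪ pl (if e.2 then (e.1.1 - 1, e.1.2) else (e.1.1, e.1.2 - 1))

lemma adjE.symm {a b : Edge} (h : adjE a b) : adjE b a := by
  obtain ⟨q, h1, h2⟩ := h; exact ⟨q, h2, h1⟩

lemma card_nb (e : Edge) : (nb e).card ≤ 8 := by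
  have h : ∀ q, (pl q).card ≤ 4 := fun q => Finset.card_le_four
  refine (Finset.card_union_le _ _).trans ?_
  have := h e.1
  have := h (if e.2 then (e.1.1 - 1, e.1.2) else (e.1.1, e.1.2 - 1))
  omega

lemma adjE_mem_nb {a b : Edge} (h : adjE a b) : b ∈ nb a := by
  obtain ⟨⟨x, y⟩, h1, h2⟩ := h
  simp only [pl, Finset.mem_insert, Finset.mem_singleton] at h1
  rw [nb, Finset.mem_union]
  rcases h1 with rfl | rfl | rfl | rfl
  · left; exact h2
  · left; exact h2
  · right; simpa using h2
  · right; simpa using h2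

/-- component of `e0` in `X` -/
def comp (X : Set Edge) (e0 : Edge) : Set Edge :=
  {e | Relation.ReflTransGen (fun a b => adjE a b ∧ b ∈ X) e0 e}

lemma comp_self (X : Set Edge) (e : Edge) : e ∈ comp X e := Relation.ReflTransGen.refl

lemma comp_subset {X : Set Edge} {e0 : Edge} (h : e0 ∈ X) : comp X e0 ⊆ X := by
  intro e he
  induction he with
  | refl => exact h
  | tail _ h _ => exact h.2

lemma comp_mono {X Y : Set Edge} (h : X ⊆ Y) (e0 : Edge) : comp X e0 ⊆ comp Y e0 := by
  intro e he
  induction he with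
  | refl => exact comp_self _ _
  | tail _ h2 ih => exact Relation.ReflTransGen.tail ih ⟨h2.1, h h2.2⟩

lemma comp_symm {X : Set Edge} {e0 e : Edge} (h : e0 ∈ X) (he : e ∈ comp X e0) : e0 ∈ comp X e := by
  induction he with
  | refl => exact comp_self _ _
  | tail h1 h2 ih =>
    rename_i b c
    have hb : b ∈ X := comp_subset h h1
    exact Relation.ReflTransGen.head ⟨h2.1.symm, hb⟩ ih

lemma comp_eq {X : Set Edge} {e0 e : Edge} (h : e0 ∈ X) (he : e ∈ comp X e0) : comp X e = comp X e0 := by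
  have h' := comp_symm h he
  ext z
  exact ⟨fun hz => Relation.ReflTransGen.trans he hz, fun hz => Relation.ReflTransGen.trans h' hz⟩

lemma comp_step {X : Set Edge} {e0 a b : Edge} (ha : a ∈ comp X e0) (hab : adjE a b) (hb : b ∈ X) :
    b ∈ comp X e0 := Relation.ReflTransGen.tail ha ⟨hab, hb⟩

/-- rooted connectivity of a finset -/
def RC (e0 : Edge) (Γ : Finset Edge) : Prop :=
  e0 ∈ Γ ∧ ∀ S ⊆ Γ, e0 ∈ S → S ≠ Γ → ∃ u ∈ S, ∃ v ∈ Γ, v ∉ S ∧ adjE u v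

lemma RC_comp {X : Set Edge} {e0 : Edge} (Γ : Finset Edge) (hΓ : (Γ : Set Edge) = comp X e0) :
    RC e0 Γ := by
  have hm : ∀ e, e ∈ Γ ↔ e ∈ comp X e0 := by intro e; rw [← hΓ]; simp
  refine ⟨by rw [hm]; exact comp_self _ _, ?_⟩
  intro S hS h0 hne
  by_contra! hcon
  apply hne
  refine Finset.Subset.antisymm hS ?_
  intro e he
  rw [hm] at he
  have : e ∈ S := by
    induction he with
    | refl => exact h0
    | tail h1 h2 ih =>
      rename_i b c
      by_contra hc
      exact hcon b ih c ((hm c).2 (comp_step h1 h2.1 h2.2)) hc h2.1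
  exact this

lemma polymer {G : Type*} [AddCommGroup G] {F : Site → G} (hF : FS F) (e0 : Edge) (_h0 : dd F e0 ≠ 0) :
    ∃ f : Site → G, FS f ∧ ∀ e, dd f e = if e ∈ comp (Function.support (dd F)) e0 then dd F e else 0 := by
  apply integrate
  · apply (dd_support_finite hF).subset
    intro e he
    simp only [Function.mem_support, ne_eq, ite_eq_right_iff, not_forall] at he
    exact he.2
  · intro q
    set X := Function.support (dd F) with hX
    by_cases hq : ∃ e ∈ pl q, e ∈ comp X e0
    · obtain ⟨e, heq, hec⟩ := hq
      have : ∀ e' ∈ pl q, (if e' ∈ comp X e0 then dd F e' else 0) = dd F e' := by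
        intro e' he'
        split_ifs with h
        · rfl
        · by_contra hne
          exact h (comp_step hec ⟨q, heq, he'⟩ (fun h => hne h.symm))
      rw [this _ (by simp [pl]), this _ (by simp [pl]), this _ (by simp [pl]), this _ (by simp [pl])]
      exact dd_closed F q
    · push Not at hq
      rw [if_neg (hq _ (by simp [pl])), if_neg (hq _ (by simp [pl])), if_neg (hq _ (by simp [pl])),
        if_neg (hq _ (by simp [pl]))]

/-- site cluster -/
def CC (A : Set Site) (x : Site) : Set Site :=
  {z | Relation.ReflTransGen (fun u v => adjP u v ∧ v ∈ A) x z}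

end PS

namespace PS
open scoped ENNReal

abbrev ind (A : Set Site) : Site → ℤ := A.indicator (fun _ => 1)

lemma ind_FS {A : Set Site} (hA : A.Finite) : FS (ind A) := by
  rw [FS_iff]; exact hA.subset (by simp [ind])

lemma dd_zero_adj {G : Type*} [AddCommGroup G] {g : Site → G} {A : Set Site}
    (h : ∀ e : Edge, e.1 ∈ A → tgt e ∈ A → dd g e = 0) {u v : Site} (hu : u ∈ A) (hv : v ∈ A)
    (huv : adjP u v) : g u = g v := by
  obtain ⟨a, b⟩ := u
  obtain ⟨c, d⟩ := v
  simp only [adjP] at huv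
  have : (c = a + 1 ∧ d = b) ∨ (a = c + 1 ∧ d = b) ∨ (c = a ∧ d = b + 1) ∨ (c = a ∧ b = d + 1) := by
    rcases abs_cases (a - c) with h1 | h1 <;> rcases abs_cases (b - d) with h2 | h2 <;> omega
  rcases this with ⟨rfl, rfl⟩ | ⟨rfl, rfl⟩ | ⟨rfl, rfl⟩ | ⟨rfl, rfl⟩
  · have := h ((a, d), false) hu (by simpa using hv)
    simp only [dd, tgt_false] at this; exact (sub_eq_zero.1 this).symm
  · have := h ((c, d), false) hv (by simpa using hu)
    simp only [dd, tgt_false] at this; exact (sub_eq_zero.1 this)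
  · have := h ((c, b), true) hu (by simpa using hv)
    simp only [dd, tgt_true] at this; exact (sub_eq_zero.1 this).symm
  · have := h ((c, d), true) hv (by simpa using hu)
    simp only [dd, tgt_true] at this; exact (sub_eq_zero.1 this)

lemma CC_sub {A : Set Site} {x : Site} (hx : x ∈ A) : CC A x ⊆ A := by
  intro e he
  induction he with
  | refl => exact hx
  | tail _ h _ => exact h.2

lemma CC_mono {A B : Set Site} (h : A ⊆ B) (x : Site) : CC A x ⊆ CC B x := by
  intro e he
  induction he with
  | refl => exact Relation.ReflTransGen.refl
  | tail _ h2 ih => exact Relation.ReflTransGen.tail ih ⟨h2.1, h h2.2⟩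

lemma exists_polymer {F : Site → ℤ} (hF : FS F) (x : Site) (hx : F x ≠ 0) :
    ∃ e0, dd F e0 ≠ 0 ∧ ∃ ψ : Site → ℤ, FS ψ ∧ ψ x ≠ 0 ∧
      ∀ e, dd ψ e = if e ∈ comp (Function.support (dd F)) e0 then dd F e else 0 := by
  obtain ⟨a, b⟩ := x
  set X := Function.support (dd F)
  obtain ⟨N, hN⟩ := ray_sum hF a b
  by_contra! hcon
  apply hx
  have key : ∀ n, N ≤ n → ∑ k ∈ Finset.Ico a n, dd F ((k, b), false) = 0 → F (a, b) = 0 := by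
    intro n hn h; rw [hN n hn, h]; simp
  have hpol : ∀ e0, dd F e0 ≠ 0 → ∃ N0, ∀ n, N0 ≤ n →
      ∑ k ∈ Finset.Ico a n, (if ((k, b), false) ∈ comp X e0 then dd F ((k, b), false) else 0) = 0 := by
    intro e0 h0
    obtain ⟨ψ, hψ, hd⟩ := polymer hF e0 h0
    have hz : ψ (a, b) = 0 := by
      by_contra hne
      obtain ⟨e, he⟩ := hcon e0 h0 ψ hψ hne
      exact he (hd e)
    obtain ⟨N1, hN1⟩ := ray_sum hψ a b
    refine ⟨N1, fun n hn => ?_⟩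
    have := hN1 n hn
    rw [hz] at this
    simp_rw [hd] at this
    linarith
  choose! N0 hN0 using hpol
  have hfin := dd_support_finite hF
  obtain ⟨B, hB⟩ := (hfin.image N0).bddAbove
  set n := max N B
  apply key n (le_max_left _ _)
  have hfib := Finset.sum_fiberwise_of_maps_to (s := Finset.Ico a n)
    (t := (Finset.Ico a n).image (fun k => comp X ((k, b), false)))
    (g := fun k => comp X ((k, b), false)) (fun k hk => Finset.mem_image_of_mem _ hk)
    (fun k => dd F ((k, b), false))
  rw [← hfib]
  apply Finset.sum_eq_zero
  intro S hS
  by_contra hne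
  obtain ⟨k0, hk0, hk0'⟩ := Finset.exists_ne_zero_of_sum_ne_zero hne
  rw [Finset.mem_filter] at hk0
  apply hne
  have h1 := hN0 _ hk0' n ((hB ⟨_, hk0', rfl⟩).trans (le_max_right _ _))
  rw [← h1, Finset.sum_filter]
  apply Finset.sum_congr rfl
  intro k hk
  by_cases hz : dd F ((k, b), false) = 0
  · simp [hz]
  · have : comp X ((k, b), false) = S ↔ ((k, b), false) ∈ comp X ((k0, b), false) := by
      rw [← hk0.2]
      constructor
      · intro h; rw [← h]; exact comp_self _ _
      · intro h; exact comp_eq hk0' h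
    simp only [this]

lemma TOP {A : Set Site} (hA : A.Finite) {x : Site} (hx : x ∈ A) :
    ∃ (e0 : Edge) (Γ : Finset Edge) (ψ : Site → ℤ), dd (ind A) e0 ≠ 0 ∧
      (Γ : Set Edge) = comp (Function.support (dd (ind A))) e0 ∧ FS ψ ∧
      (∀ e, dd ψ e = if e ∈ Γ then dd (ind A) e else 0) ∧ ψ x ≤ 1 ∧
      (∀ z ∈ CC A x, ψ z = ψ x) ∧ ∀ C : Finset Site, (C : Set Site) ⊆ CC A x → C.card ≤ Γ.card ^ 2 := by
  have hF := ind_FS hA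
  obtain ⟨e0, h0, ψ, hψ, hψx, hd⟩ := exists_polymer hF x (by simp [ind, hx])
  set X := Function.support (dd (ind A)) with hX
  have hcf : (comp X e0).Finite := (dd_support_finite hF).subset (comp_subset h0)
  set Γ := hcf.toFinset with hΓ
  have hm : ∀ e, e ∈ Γ ↔ e ∈ comp X e0 := by intro e; simp [hΓ]
  have hd' : ∀ e, dd ψ e = if e ∈ Γ then dd (ind A) e else 0 := by
    intro e; rw [hd e]; simp only [hm]
  have hdX : ∀ e, dd ψ e ≠ 0 → e ∈ Γ := by
    intro e he; by_contra h; rw [hd', if_neg h] at he; exact he rfl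
  have hconst : ∀ z ∈ CC A x, ψ z = ψ x := by
    intro z hz
    have : ψ z = ψ x ∧ z ∈ A := by
      induction hz with
      | refl => exact ⟨rfl, hx⟩
      | tail h1 h2 ih =>
        refine ⟨?_, h2.2⟩
        rw [← ih.1]
        apply (dd_zero_adj (g := ψ) (A := A) _ ih.2 h2.2 h2.1).symm
        intro e he1 he2
        rw [hd']; split_ifs
        · simp [dd, ind, he1, he2]
        · rfl
    exact this.1
  refine ⟨e0, Γ, ψ, h0, by simp [hΓ], hψ, hd', ?_, hconst, ?_⟩
  · -- bound by one
    set g : Site → ℤ := ind A - ψ with hg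
    have hgpl : ∀ q : Site, (∃ e ∈ pl q, e ∈ Γ) → ∀ e' ∈ pl q, dd g e' = 0 := by
      rintro q ⟨e, he, heΓ⟩ e' he'
      rw [hg, dd_sub, hd']
      split_ifs with h
      · simp
      · rw [sub_zero]; by_contra hne
        exact h ((hm _).2 (comp_step ((hm e).1 heΓ) ⟨q, he, he'⟩ hne))
    have hends : ∀ q : Site, (∃ e ∈ pl q, e ∈ Γ) → ∀ e' ∈ pl q, g e'.1 = g q ∧ g (tgt e') = g q := by
      intro q hq e' he'
      have H := hgpl q hq
      have h1 := H (q, false) (by simp [pl])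
      have h2 := H (q, true) (by simp [pl])
      have h3 := H ((q.1, q.2 + 1), false) (by simp [pl])
      have h4 := H ((q.1 + 1, q.2), true) (by simp [pl])
      simp only [dd, tgt_false, tgt_true] at h1 h2 h3 h4
      simp only [pl, Finset.mem_insert, Finset.mem_singleton] at he'
      rcases he' with rfl | rfl | rfl | rfl <;> constructor <;> simp <;> linarith
    have hc : ∀ e ∈ Γ, g e.1 = g e0.1 ∧ g (tgt e) = g e0.1 := by
      intro e he
      rw [hm] at he
      have h00 : g (tgt e0) = g e0.1 := by
        have : e0 ∈ pl e0.1 := by rcases e0 with ⟨a, _ | _⟩ <;> simp [pl]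
        have h := hgpl e0.1 ⟨e0, this, (hm _).2 (comp_self _ _)⟩ e0 this
        simp only [dd] at h; linarith
      induction he with
      | refl => exact ⟨rfl, h00⟩
      | tail h1 h2 ih =>
        rename_i b c
        obtain ⟨q, hb, hcq⟩ := h2.1
        have hq : ∃ e ∈ pl q, e ∈ Γ := ⟨b, hb, (hm _).2 h1⟩
        have := hends q hq b hb
        have h3 := hends q hq c hcq
        exact ⟨by rw [h3.1, ← this.1, ih.1], by rw [h3.2, ← this.1, ih.1]⟩
    set c := g e0.1
    obtain ⟨N, hN⟩ := hψ
    have key : ∀ n : ℕ, ∀ a b, N - a < n → ψ (a, b) = 0 ∨ (0 ≤ c ∧ ψ (a, b) ≤ 1) := by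
      intro n
      induction n with
      | zero =>
        intro a b h; left; by_contra h0
        have := (hN _ h0).1.2; simp at this h; omega
      | succ n ih =>
        intro a b h
        have ih' := ih (a + 1) b (by push_cast at h; omega)
        by_cases hz : dd ψ ((a, b), false) = 0
        · have : ψ (a + 1, b) = ψ (a, b) := by simpa [dd, sub_eq_zero] using hz
          rwa [this] at ih'
        · have h1 := hc _ (hdX _ hz)
          simp only [tgt_false, hg, Pi.sub_apply] at h1
          have h2 : 0 ≤ ind A (a + 1, b) := by
            simp only [ind, Set.indicator]; split_ifs <;> norm_num
          have h3 : ind A (a, b) ≤ 1 := by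
            simp only [ind, Set.indicator]; split_ifs <;> norm_num
          right
          have : 0 ≤ c := by
            rcases ih' with h' | h'
            · linarith [h1.2]
            · exact h'.1
          exact ⟨this, by linarith [h1.1]⟩
    rcases key (N - x.1 + 1).toNat x.1 x.2 (by omega) with h | h
    · rw [show ψ x = 0 from h]; norm_num
    · exact h.2
  · intro C hC
    have hH : ∀ z ∈ C, ∃ k, ((k, z.2), false) ∈ Γ := by
      intro z hz
      by_contra! hcon
      apply hψx
      rw [← hconst z (hC hz)]
      apply ray_right hψ z.1 z.2
      intro k _; rw [hd', if_neg (hcon k)]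
    have hV : ∀ z ∈ C, ∃ k, ((z.1, k), true) ∈ Γ := by
      intro z hz
      by_contra! hcon
      apply hψx
      rw [← hconst z (hC hz)]
      apply ray_up hψ z.1 z.2
      intro k _; rw [hd', if_neg (hcon k)]
    choose! kh hkh using hH
    choose! kv hkv using hV
    have := Finset.card_le_card_of_injOn (s := C) (t := Γ ×ˢ Γ)
      (fun z => (((kh z, z.2), false), ((z.1, kv z), true)))
      (by intro z hz; simp only [Finset.coe_product, Set.mem_prod, Finset.mem_coe]; exact ⟨hkh z hz, hkv z hz⟩)
      (by
        intro z _ z' _ h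
        simp only [Prod.mk.injEq] at h
        exact Prod.ext h.2.1.1 h.1.1.2)
    rwa [Finset.card_product, ← sq] at this
end PS

namespace PS
open scoped ENNReal

def walks : ℕ → Edge → Finset (List Edge)
  | 0, e => {[e]}
  | n + 1, e => (nb e).biUnion (fun e' => (walks n e').image (fun l => e :: l))

lemma card_walks (n : ℕ) : ∀ e, (walks n e).card ≤ 8 ^ n := by
  induction n with
  | zero => intro e; simp [walks]
  | succ n ih =>
    intro e
    rw [walks]
    refine (Finset.card_biUnion_le_card_mul _ _ (8 ^ n) ?_).trans ?_
    · intro e' _; exact Finset.card_image_le.trans (ih e')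
    · rw [pow_succ, mul_comm]; exact Nat.mul_le_mul_left _ (card_nb e)

lemma mem_walks (n : ℕ) : ∀ e (l : List Edge), l.length = n → List.IsChain adjE (e :: l) →
    e :: l ∈ walks n e := by
  induction n with
  | zero => intro e l h _; rw [List.length_eq_zero_iff.1 h]; simp [walks]
  | succ n ih =>
    intro e l h hc
    cases l with
    | nil => simp at h
    | cons a l =>
      rw [List.isChain_cons_cons] at hc
      simp only [walks, Finset.mem_biUnion, Finset.mem_image]
      exact ⟨a, adjE_mem_nb hc.1, a :: l, ih a l (by simpa using h) hc.2, rfl⟩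

lemma grow {e0 : Edge} {Γ : Finset Edge} (h : RC e0 Γ) : ∀ j < Γ.card, ∃ l : List Edge,
    l.length = 2 * j ∧ List.IsChain adjE (e0 :: l) ∧ (e0 :: l).toFinset ⊆ Γ ∧
      (e0 :: l).toFinset.card = j + 1 := by
  intro j
  induction j with
  | zero => intro _; exact ⟨[], by simp, by simp, by simpa using h.1, by simp⟩
  | succ j ih =>
    intro hj
    obtain ⟨l, hl, hc, hs, hcard⟩ := ih (by omega)
    obtain ⟨u, hu, v, hv, hvn, huv⟩ := h.2 _ hs (by simp) (by intro h'; rw [h'] at hcard; omega)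
    have hu' : u ∈ e0 :: l := List.mem_toFinset.1 hu
    obtain ⟨l1, l2, hl12⟩ := List.append_of_mem hu'
    have hc2 : List.IsChain adjE (l1 ++ u :: v :: u :: l2) := by
      rw [hl12] at hc
      rw [List.isChain_split] at hc ⊢
      refine ⟨hc.1, ?_⟩
      rw [List.isChain_cons_cons, List.isChain_cons_cons]
      exact ⟨huv, huv.symm, hc.2⟩
    have hfs : (l1 ++ u :: v :: u :: l2).toFinset = insert v (e0 :: l).toFinset := by
      rw [hl12]; ext z; simp
    have hlen : (l1 ++ u :: v :: u :: l2).length = 2 * (j + 1) + 1 := by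
      have := congrArg List.length hl12
      simp at this ⊢; try omega
    obtain ⟨l', hl'⟩ : ∃ l', l1 ++ u :: v :: u :: l2 = e0 :: l' := by
      cases l1 with
      | nil => simp at hl12; exact ⟨v :: u :: l2, by simp [hl12.1]⟩
      | cons a l1 => simp at hl12; exact ⟨l1 ++ u :: v :: u :: l2, by simp [hl12.1]⟩
    refine ⟨l', ?_, ?_, ?_, ?_⟩
    · rw [hl'] at hlen; simpa using hlen
    · rwa [hl'] at hc2
    · rw [← hl', hfs]; exact Finset.insert_subset hv hs
    · rw [← hl', hfs, Finset.card_insert_of_notMem hvn, hcard]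

def polys (e0 : Edge) (k : ℕ) : Finset (Finset Edge) :=
  ((walks (2 * (k - 1)) e0).image List.toFinset).filter (fun Γ => Γ.card = k)

lemma card_polys (e0 : Edge) (k : ℕ) : (polys e0 k).card ≤ 64 ^ k := by
  refine (Finset.card_filter_le _ _).trans (Finset.card_image_le.trans ((card_walks _ _).trans ?_))
  rw [pow_mul]; norm_num
  exact Nat.pow_le_pow_right (by norm_num) (by omega)

lemma mem_polys {e0 : Edge} {Γ : Finset Edge} (h : RC e0 Γ) : Γ ∈ polys e0 Γ.card := by
  have hpos : 0 < Γ.card := Finset.card_pos.2 ⟨_, h.1⟩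
  obtain ⟨l, hl, hc, hs, hcard⟩ := grow h (Γ.card - 1) (by omega)
  rw [polys, Finset.mem_filter, Finset.mem_image]
  exact ⟨⟨e0 :: l, mem_walks _ _ _ hl hc, Finset.eq_of_subset_of_card_le hs (by omega)⟩, rfl⟩

lemma tsum_inj {α γ : Type*} (S : Set α) (f : α → ℝ≥0∞) (g : γ → ℝ≥0∞) (i : α → γ)
    (hi : Set.InjOn i S) (h : ∀ a ∈ S, f a ≤ g (i a)) : ∑' a, S.indicator f a ≤ ∑' c, g c := by
  rw [← tsum_subtype]
  calc ∑' a : S, f a ≤ ∑' a : S, g (i a) := ENNReal.tsum_le_tsum (fun a => h a a.2)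
    _ ≤ ∑' c, g c := ENNReal.tsum_comp_le_tsum_of_injective (f := fun a : S => i a)
        (fun a b hab => Subtype.ext (hi a.2 b.2 hab)) g

lemma tsum_pi_le {ι G : Type*} [Fintype ι] (v : G → ℝ≥0∞) :
    ∑' k : ι → G, ∏ i, v (k i) ≤ (∑' g, v g) ^ (Fintype.card ι) := by
  rw [ENNReal.tsum_eq_iSup_sum]
  apply iSup_le
  intro s
  calc ∑ k ∈ s, ∏ i, v (k i) ≤ ∑ k ∈ Fintype.piFinset (fun i => s.image (fun k => k i)), ∏ i, v (k i) := by
        apply Finset.sum_le_sum_of_subset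
        intro k hk
        rw [Fintype.mem_piFinset]
        intro i; exact Finset.mem_image_of_mem _ hk
    _ = ∏ i, ∑ g ∈ s.image (fun k => k i), v g := by rw [Finset.prod_univ_sum]
    _ ≤ ∏ i : ι, ∑' g, v g := Finset.prod_le_prod' (fun i _ => ENNReal.sum_le_tsum _)
    _ = _ := by simp

lemma PEI {G : Type*} [AddCommGroup G] (w : (Site → G) → ℝ≥0∞) (S S' : Set (Site → G))
    (v : G → ℝ≥0∞) (EB : Finset Edge) (m : ℕ) (hV : 64 * ∑' g, v g ≤ 1 / 2)
    (h : ∀ F ∈ S, ∃ e0 ∈ EB, ∃ Γ, RC e0 Γ ∧ m ≤ Γ.card ∧ ∃ ψ : Site → G, FS ψ ∧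
      (∀ e ∉ Γ, dd ψ e = 0) ∧ F - ψ ∈ S' ∧ w F ≤ (∏ e ∈ Γ, v (dd ψ e)) * w (F - ψ)) :
    ∑' F, S.indicator w F ≤ EB.card * ((1 / 2) ^ m * 2) * ∑' F, S'.indicator w F := by
  choose! E hE Γ hRC hm ψ hFS hz hS' hw using h
  set V := ∑' g, v g
  have key : ∀ e0 : Edge, ∀ Γ0 : Finset Edge,
      ∑' F, {F | F ∈ S ∧ E F = e0 ∧ Γ F = Γ0}.indicator w F ≤ V ^ Γ0.card * ∑' F, S'.indicator w F := by
    intro e0 Γ0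
    have h1 := tsum_inj {F | F ∈ S ∧ E F = e0 ∧ Γ F = Γ0} w
      (fun c : (Γ0 → G) × (Site → G) => (∏ i, v (c.1 i)) * S'.indicator w c.2)
      (fun F => (fun i => dd (ψ F) i, F - ψ F)) ?_ ?_
    · refine h1.trans ?_
      rw [ENNReal.tsum_prod (f := fun (a : Γ0 → G) b => (∏ i, v (a i)) * S'.indicator w b)]
      simp_rw [ENNReal.tsum_mul_left, ENNReal.tsum_mul_right]
      gcongr
      simpa using tsum_pi_le (ι := Γ0) v
    · rintro F ⟨hF, _, hΓ⟩ F' ⟨hF', _, hΓ'⟩ heq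
      simp only [Prod.mk.injEq] at heq
      have : ψ F = ψ F' := by
        apply dd_inj (hFS F hF) (hFS F' hF')
        intro e
        by_cases he : e ∈ Γ0
        · exact congrFun heq.1 ⟨e, he⟩
        · rw [hz F hF e (by rwa [hΓ]), hz F' hF' e (by rwa [hΓ'])]
      have h2 := heq.2
      rw [this] at h2
      exact sub_left_injective h2
    · rintro F ⟨hF, _, hΓ⟩
      simp only [Set.indicator_of_mem (hS' F hF)]
      refine (hw F hF).trans (le_of_eq ?_)
      rw [hΓ, ← Finset.prod_coe_sort]
  have hle : ∀ F, S.indicator w F ≤ ∑ e0 ∈ EB, ∑' j, ∑ Γ0 ∈ polys e0 (m + j),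
      {F | F ∈ S ∧ E F = e0 ∧ Γ F = Γ0}.indicator w F := by
    intro F
    by_cases hF : F ∈ S
    · rw [Set.indicator_of_mem hF]
      obtain ⟨j, hj⟩ := Nat.exists_eq_add_of_le (hm F hF)
      refine le_trans ?_ (Finset.single_le_sum (fun _ _ => zero_le) (hE F hF))
      refine le_trans ?_ (ENNReal.le_tsum j)
      have h3 : Γ F ∈ polys (E F) (m + j) := by rw [← hj]; exact mem_polys (hRC F hF)
      refine le_trans ?_ (Finset.single_le_sum (fun _ _ => zero_le) h3)
      rw [Set.indicator_of_mem]
      exact ⟨hF, rfl, rfl⟩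
    · rw [Set.indicator_of_notMem hF]; exact zero_le
  refine (ENNReal.tsum_le_tsum hle).trans ?_
  rw [Summable.tsum_finsetSum (fun _ _ => ENNReal.summable)]
  have hj : ∀ e0 ∈ EB, ∑' F, ∑' j, ∑ Γ0 ∈ polys e0 (m + j),
      {F | F ∈ S ∧ E F = e0 ∧ Γ F = Γ0}.indicator w F ≤ ((1 / 2) ^ m * 2) * ∑' F, S'.indicator w F := by
    intro e0 _
    rw [ENNReal.tsum_comm]
    have : ∀ j, ∑' F, ∑ Γ0 ∈ polys e0 (m + j), {F | F ∈ S ∧ E F = e0 ∧ Γ F = Γ0}.indicator w F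
        ≤ ((1 / 2) ^ m * ∑' F, S'.indicator w F) * (1 / 2) ^ j := by
      intro j
      rw [Summable.tsum_finsetSum (fun _ _ => ENNReal.summable)]
      calc ∑ Γ0 ∈ polys e0 (m + j), ∑' F, {F | F ∈ S ∧ E F = e0 ∧ Γ F = Γ0}.indicator w F
          ≤ ∑ Γ0 ∈ polys e0 (m + j), V ^ (m + j) * ∑' F, S'.indicator w F := by
            apply Finset.sum_le_sum
            intro Γ0 h0
            rw [← (Finset.mem_filter.1 h0).2]
            exact key e0 Γ0
        _ ≤ (64 ^ (m + j) : ℕ) * (V ^ (m + j) * ∑' F, S'.indicator w F) := by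
            rw [Finset.sum_const, nsmul_eq_mul]
            gcongr
            exact card_polys e0 (m + j)
        _ = (64 * V) ^ (m + j) * ∑' F, S'.indicator w F := by
            rw [mul_pow, mul_assoc]; push_cast; rfl
        _ ≤ (1 / 2) ^ (m + j) * ∑' F, S'.indicator w F := by gcongr
        _ = _ := by rw [pow_add]; ring
    refine (ENNReal.tsum_le_tsum this).trans ?_
    rw [ENNReal.tsum_mul_left, ENNReal.tsum_geometric, one_div, ENNReal.one_sub_inv_two, inv_inv]
    exact le_of_eq (by ring)
  refine (Finset.sum_le_sum hj).trans ?_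
  rw [Finset.sum_const, nsmul_eq_mul]
  exact le_of_eq (by ring)
end PS

namespace PS
open scoped ENNReal

def HR (p : ℝ) (φ : Site → ℝ) : ℝ := ∑' e : Edge, |dd φ e| ^ p
def ic (η : Site → ℤ) : Site → ℝ := fun z => (η z : ℝ)
def HH (p : ℝ) (η : Site → ℤ) : ℝ := HR p (ic η)

lemma dd_ic (η : Site → ℤ) (e : Edge) : dd (ic η) e = ((dd η e : ℤ) : ℝ) := by simp [dd, ic]

lemma FS_ic {η : Site → ℤ} (h : FS η) : FS (ic η) := by
  obtain ⟨N, hN⟩ := h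
  exact ⟨N, fun z hz => hN z (fun h => hz (by simp [ic, h]))⟩

lemma FS_of_zero {G : Type*} [AddCommGroup G] {R : Finset Site} {η : Site → G}
    (h : ∀ x ∉ R, η x = 0) : FS η := by
  rw [FS_iff]
  refine R.finite_toSet.subset ?_
  intro x hx
  by_contra h'
  exact hx (h x h')

lemma adjP_iff (u v : Site) : adjP u v ↔ (∃ e : Edge, (e.1 = u ∧ tgt e = v) ∨ (e.1 = v ∧ tgt e = u)) := by
  obtain ⟨a, b⟩ := u
  obtain ⟨c, d⟩ := v
  constructor
  · intro huv
    simp only [adjP] at huv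
    have : (c = a + 1 ∧ d = b) ∨ (a = c + 1 ∧ d = b) ∨ (c = a ∧ d = b + 1) ∨ (c = a ∧ b = d + 1) := by
      rcases abs_cases (a - c) with h1 | h1 <;> rcases abs_cases (b - d) with h2 | h2 <;> omega
    rcases this with ⟨rfl, rfl⟩ | ⟨rfl, rfl⟩ | ⟨rfl, rfl⟩ | ⟨rfl, rfl⟩
    · exact ⟨((a, d), false), by simp⟩
    · exact ⟨((c, d), false), by simp⟩
    · exact ⟨((c, b), true), by simp⟩
    · exact ⟨((c, d), true), by simp⟩
  · rintro ⟨⟨⟨x, y⟩, s⟩, h⟩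
    simp only [adjP]
    cases s <;> simp at h <;> rcases h with ⟨⟨rfl, rfl⟩, rfl, rfl⟩ | ⟨⟨rfl, rfl⟩, rfl, rfl⟩ <;> simp

lemma adjP_tgt (e : Edge) : adjP e.1 (tgt e) := (adjP_iff _ _).2 ⟨e, Or.inl ⟨rfl, rfl⟩⟩
lemma adjP_symm {u v : Site} (h : adjP u v) : adjP v u := by
  rw [adjP_iff] at *; obtain ⟨e, h⟩ := h; exact ⟨e, h.symm⟩

lemma HR_supp {p : ℝ} (hp : 0 < p) {φ : Site → ℝ} (hφ : FS φ) :
    (Function.support (fun e => |dd φ e| ^ p)).Finite := by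
  apply (dd_support_finite hφ).subset
  intro e he h0
  exact he (by simp only [h0, abs_zero]; exact Real.zero_rpow hp.ne')

lemma HR_summable {p : ℝ} (hp : 0 < p) {φ : Site → ℝ} (hφ : FS φ) :
    Summable (fun e => |dd φ e| ^ p) := summable_of_hasFiniteSupport (HR_supp hp hφ)

lemma HR_nonneg (p : ℝ) (φ : Site → ℝ) : 0 ≤ HR p φ :=
  tsum_nonneg (fun _ => Real.rpow_nonneg (abs_nonneg _) _)

lemma pDir_eq {p : ℝ} (hp : 0 < p) {φ : Site → ℝ} (hφ : FS φ) : pDir p φ = HR p φ := by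
  let i : Edge × Bool → Site × Site := fun c => if c.2 then (c.1.1, tgt c.1) else (tgt c.1, c.1.1)
  have hi : Function.Injective i := by
    rintro ⟨⟨⟨a, b⟩, s⟩, t⟩ ⟨⟨⟨a', b'⟩, s'⟩, t'⟩ h
    cases s <;> cases s' <;> cases t <;> cases t' <;> simp [i] at h ⊢ <;> omega
  unfold pDir HR
  rw [← Function.Injective.tsum_eq hi]
  · have : ∀ c : Edge × Bool, (if adjP (i c).1 (i c).2 then |φ (i c).1 - φ (i c).2| ^ p else 0) =
        |dd φ c.1| ^ p := by
      rintro ⟨e, t⟩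
      cases t
      · simp only [i, dd]; simp [adjP_symm (adjP_tgt e)]
      · simp only [i, dd]; simp [adjP_tgt e, abs_sub_comm]
    simp_rw [this]
    have hs : Summable (fun c : Edge × Bool => |dd φ c.1| ^ p) := by
      apply summable_of_hasFiniteSupport
      refine ((HR_supp hp hφ).prod (Set.finite_univ (α := Bool))).subset ?_
      rintro ⟨e, t⟩ h; exact ⟨h, trivial⟩
    rw [hs.tsum_prod]
    simp only [tsum_fintype, Fintype.sum_bool]
    rw [← tsum_mul_left]
    congr 1; funext e; ring
  · rintro ⟨u, v⟩ h
    have hadj : adjP u v := by by_contra h'; simp [h'] at h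
    rw [adjP_iff] at hadj
    obtain ⟨e, ⟨rfl, rfl⟩ | ⟨rfl, rfl⟩⟩ := hadj
    · exact ⟨(e, true), by simp [i]⟩
    · exact ⟨(e, false), by simp [i]⟩

lemma pH_eq {p : ℝ} (hp : 0 < p) {η : Site → ℤ} (h : FS η) : pH p η = HH p η := by
  rw [HH, ← pDir_eq hp (FS_ic h)]
  simp [pH, pDir, ic]

lemma HR_split {p : ℝ} (hp : 0 < p) {φ φ' : Site → ℝ} (h : FS φ) (h' : FS φ') (Γ : Finset Edge)
    (c : Edge → ℝ) (hoff : ∀ e ∉ Γ, |dd φ' e| ≤ |dd φ e|)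
    (hon : ∀ e ∈ Γ, |dd φ' e| ^ p + c e ≤ |dd φ e| ^ p) : HR p φ' + ∑ e ∈ Γ, c e ≤ HR p φ := by
  have hs : Summable (fun e => if e ∈ Γ then c e else 0) := by
    apply summable_of_hasFiniteSupport
    refine Γ.finite_toSet.subset ?_
    intro e he; by_contra h; simp at he h; exact h he.1
  have : ∑ e ∈ Γ, c e = ∑' e, if e ∈ Γ then c e else 0 := by
    rw [tsum_eq_sum (s := Γ) (by intro e he; simp [he])]
    exact Finset.sum_congr rfl (fun e he => by simp [he])
  rw [this, HR, HR, ← (HR_summable hp h').tsum_add hs]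
  refine ((HR_summable hp h').add hs).tsum_le_tsum ?_ (HR_summable hp h)
  intro e
  by_cases he : e ∈ Γ
  · simp only [he, if_true]; exact hon e he
  · simp only [he, if_false, add_zero]
    exact Real.rpow_le_rpow (abs_nonneg _) (hoff e he) hp.le

def wt (p β : ℝ) (R : Finset Site) (η : Site → ℤ) : ℝ≥0∞ :=
  if ∀ x ∉ R, η x = 0 then ENNReal.ofReal (Real.exp (-β * HH p η)) else 0
def W (p β : ℝ) (R : Finset Site) (A : Set (Site → ℤ)) : ℝ≥0∞ := ∑' η, A.indicator (wt p β R) η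

lemma wt_pos {p β : ℝ} {R : Finset Site} {η : Site → ℤ} (h : ∀ x ∉ R, η x = 0) :
    wt p β R η = ENNReal.ofReal (Real.exp (-β * HH p η)) := if_pos h
lemma wt_zero {p β : ℝ} {R : Finset Site} {η : Site → ℤ} (h : ¬ ∀ x ∉ R, η x = 0) :
    wt p β R η = 0 := if_neg h

lemma W_mono {p β : ℝ} {R : Finset Site} {A B : Set (Site → ℤ)} (h : A ⊆ B) : W p β R A ≤ W p β R B :=
  ENNReal.tsum_le_tsum (fun _ => Set.indicator_le_indicator_of_subset h (fun _ => zero_le) _)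

lemma W_union {p β : ℝ} {R : Finset Site} {A B C : Set (Site → ℤ)} (h : A ⊆ B ∪ C) :
    W p β R A ≤ W p β R B + W p β R C := by
  rw [W, W, W, ← ENNReal.tsum_add]
  refine ENNReal.tsum_le_tsum (fun η => ?_)
  by_cases hA : η ∈ A
  · rcases h hA with hB | hC
    · rw [Set.indicator_of_mem hA, Set.indicator_of_mem hB]; exact le_self_add
    · rw [Set.indicator_of_mem hA, Set.indicator_of_mem hC]; exact le_add_self
  · rw [Set.indicator_of_notMem hA]; exact zero_le

lemma W_biUnion {p β : ℝ} {R : Finset Site} {ι : Type*} (s : Finset ι) {A : Set (Site → ℤ)}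
    {B : ι → Set (Site → ℤ)} (h : ∀ η ∈ A, ∃ i ∈ s, η ∈ B i) :
    W p β R A ≤ ∑ i ∈ s, W p β R (B i) := by
  simp only [W]
  rw [← Summable.tsum_finsetSum (fun _ _ => ENNReal.summable)]
  refine ENNReal.tsum_le_tsum (fun η => ?_)
  by_cases hA : η ∈ A
  · obtain ⟨i, hi, hB⟩ := h η hA
    refine le_trans ?_ (Finset.single_le_sum (fun _ _ => zero_le) hi)
    rw [Set.indicator_of_mem hA, Set.indicator_of_mem hB]
  · rw [Set.indicator_of_notMem hA]; exact zero_le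

def KK (t : ℝ) : ℝ≥0∞ := ∑' k : ℤ, ENNReal.ofReal (Real.exp (-t * |(k : ℝ)|))

lemma KK_lt {t : ℝ} (ht : 0 < t) : KK t < ∞ := by
  have hs : Summable (fun k : ℤ => Real.exp (-t * |(k : ℝ)|)) := by
    have hg : Summable (fun n : ℕ => Real.exp (-t) ^ n) :=
      summable_geometric_of_lt_one (Real.exp_pos _).le (by rw [Real.exp_lt_one_iff]; linarith)
    rw [summable_int_iff_summable_nat_and_neg]
    constructor
    · refine hg.congr (fun n => ?_)
      rw [← Real.exp_nat_mul]; congr 1; simp; ring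
    · refine hg.congr (fun n => ?_)
      rw [← Real.exp_nat_mul]; congr 1; simp; ring
  rw [KK, ← ENNReal.ofReal_tsum_of_nonneg (fun _ => (Real.exp_pos _).le) hs]
  exact ENNReal.ofReal_lt_top

lemma abs_le_rpow {p : ℝ} (hp : 1 ≤ p) (k : ℤ) : |(k : ℝ)| ≤ |(k : ℝ)| ^ p := by
  rcases eq_or_ne k 0 with rfl | hk
  · simp; positivity
  · have h1 : (1 : ℝ) ≤ |(k : ℝ)| := by
      rw [← Int.cast_abs]; exact_mod_cast Int.one_le_abs hk
    nth_rewrite 1 [← Real.rpow_one |(k : ℝ)|]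
    exact Real.rpow_le_rpow_of_exponent_le h1 hp

lemma KB {p t : ℝ} (hp : 1 ≤ p) (ht : 0 ≤ t) (C : Finset Site) : W p t C Set.univ ≤ KK t ^ C.card := by
  have h := tsum_inj {τ : Site → ℤ | ∀ x ∉ C, τ x = 0} (wt p t C)
    (fun k : C → ℤ => ∏ i, ENNReal.ofReal (Real.exp (-t * |(k i : ℝ)|)))
    (fun τ i => dd τ ((i.1.1 - 1, i.1.2), false)) ?_ ?_
  · have h2 : W p t C Set.univ = ∑' a, {τ : Site → ℤ | ∀ x ∉ C, τ x = 0}.indicator (wt p t C) a := by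
      unfold W
      congr 1; funext η
      by_cases hη : ∀ x ∉ C, η x = 0
      · rw [Set.indicator_of_mem (Set.mem_univ _), Set.indicator_of_mem (by exact hη)]
      · rw [Set.indicator_of_mem (Set.mem_univ _), wt_zero hη, Set.indicator_of_notMem (by exact hη)]
    rw [h2]
    refine h.trans ((tsum_pi_le (ι := C) (fun k : ℤ => ENNReal.ofReal (Real.exp (-t * |(k : ℝ)|)))).trans ?_)
    simp [KK]
  · intro τ hτ τ' hτ' heq
    have hfs : FS (τ - τ') := (FS_of_zero hτ).sub (FS_of_zero hτ')
    obtain ⟨N, hN⟩ := hfs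
    have key : ∀ n : ℕ, ∀ a b, a + N < n → (τ - τ') (a, b) = 0 := by
      intro n
      induction n with
      | zero => intro a b h; by_contra h0; have := (hN _ h0).1.1; simp at this h; omega
      | succ n ih =>
        intro a b h
        by_cases hC : (a, b) ∈ C
        · have h1 := congrFun heq ⟨(a, b), hC⟩
          have h2 := ih (a - 1) b (by push_cast at h; omega)
          simp only [dd, tgt_false, sub_add_cancel, Pi.sub_apply] at h1 h2 ⊢
          linarith
        · simp [hτ _ hC, hτ' _ hC]
    funext z
    have := key (z.1 + N + 1).toNat z.1 z.2 (by omega)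
    simpa [sub_eq_zero] using this
  · intro τ hτ
    have hτ2 : ∀ x ∉ C, τ x = 0 := hτ
    rw [wt, if_pos hτ2, ← ENNReal.ofReal_prod_of_nonneg (fun _ _ => (Real.exp_pos _).le), ← Real.exp_sum]
    apply ENNReal.ofReal_le_ofReal
    apply Real.exp_le_exp.2
    rw [← Finset.mul_sum]
    have : ∑ i : C, |((dd τ ((i.1.1 - 1, i.1.2), false) : ℤ) : ℝ)| ≤ HH p τ := by
      let E : C → Edge := fun i => ((i.1.1 - 1, i.1.2), false)
      have hE : Function.Injective E := by
        rintro ⟨⟨a, b⟩, _⟩ ⟨⟨a', b'⟩, _⟩ h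
        simpa [E] using h
      have hsum := HR_summable (by linarith) (FS_ic (FS_of_zero hτ2)) (p := p)
      calc ∑ i : C, |((dd τ (E i) : ℤ) : ℝ)| ≤ ∑ i : C, |dd (ic τ) (E i)| ^ p := by
            apply Finset.sum_le_sum; intro i _; rw [dd_ic]; exact abs_le_rpow hp _
        _ = ∑ e ∈ Finset.univ.image E, |dd (ic τ) e| ^ p := by
            rw [Finset.sum_image (fun a _ b _ h => hE h)]
        _ ≤ _ := hsum.sum_le_tsum _ (fun _ _ => Real.rpow_nonneg (abs_nonneg _) _)
    nlinarith

lemma W_lt {p β : ℝ} (hp : 1 ≤ p) (hβ : 0 < β) (R : Finset Site) (A : Set (Site → ℤ)) : W p β R A < ∞ :=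
  (W_mono (Set.subset_univ A)).trans_lt ((KB hp hβ.le R).trans_lt (ENNReal.pow_lt_top (KK_lt hβ)))

lemma W_pos (p β : ℝ) (R : Finset Site) : 0 < W p β R Set.univ := by
  refine lt_of_lt_of_le ?_ (ENNReal.le_tsum (0 : Site → ℤ))
  simp [wt, Real.exp_pos]

lemma pW_eq {p : ℝ} (hp : 0 < p) (β : ℝ) (R : Finset Site) (A : (Site → ℤ) → Prop) :
    pW p β R A = (W p β R {η | A η}).toReal := by
  rw [W, ENNReal.tsum_toReal_eq, pW]
  · congr 1; funext η
    by_cases h : ∀ x ∉ R, η x = 0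
    · by_cases hA : A η
      · rw [if_pos ⟨h, hA⟩, Set.indicator_of_mem (by exact hA), wt, if_pos h,
          ENNReal.toReal_ofReal (Real.exp_pos _).le, pH_eq hp (FS_of_zero h)]
      · simp [hA]
    · rw [if_neg (fun h' => h h'.1)]
      by_cases hA : A η
      · rw [Set.indicator_of_mem (by exact hA), wt_zero h]; simp
      · rw [Set.indicator_of_notMem (by exact hA)]; simp
  · intro η
    simp only [Set.indicator, wt]
    split_ifs <;> simp

lemma W_neg (p β : ℝ) (R : Finset Site) (A : Set (Site → ℤ)) :
    W p β R {η | -η ∈ A} = W p β R A := by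
  unfold W
  rw [← (Equiv.neg (Site → ℤ)).tsum_eq]
  congr 1; funext η
  have h1 : wt p β R (-η) = wt p β R η := by
    have : HH p (-η) = HH p η := by
      unfold HH HR; congr 1; funext e
      rw [dd_ic, dd_ic, ← abs_neg]; congr 1; simp [dd]; ring_nf
    simp [wt, this]
  simp only [Equiv.neg_apply, Set.indicator, h1, Set.mem_ofPred_eq, neg_neg]
end PS

namespace PS
open scoped ENNReal

def EB (R : Finset Site) : Finset Edge := R.biUnion (fun z =>
  {(z, false), (z, true), ((z.1 - 1, z.2), false), ((z.1, z.2 - 1), true)})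

lemma card_EB (R : Finset Site) : (EB R).card ≤ 4 * R.card := by
  rw [mul_comm]
  exact Finset.card_biUnion_le_card_mul _ _ _ (fun z _ => Finset.card_le_four)

lemma mem_EB {R : Finset Site} {e : Edge} (h : e.1 ∈ R ∨ tgt e ∈ R) : e ∈ EB R := by
  rw [EB, Finset.mem_biUnion]
  rcases h with h | h
  · refine ⟨_, h, ?_⟩
    rcases e with ⟨a, _ | _⟩ <;> simp
  · refine ⟨_, h, ?_⟩
    rcases e with ⟨a, _ | _⟩ <;> simp

lemma CC_into {A B : Set Site} {x : Site} (h : CC A x ⊆ B) : CC A x ⊆ CC B x := by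
  intro z hz
  induction hz with
  | refl => exact Relation.ReflTransGen.refl
  | tail h1 h2 ih => exact Relation.ReflTransGen.tail ih ⟨h2.1, h (Relation.ReflTransGen.tail h1 h2)⟩

lemma W_supp (p β : ℝ) (R : Finset Site) (A : Set (Site → ℤ)) :
    W p β R A = W p β R {η | η ∈ A ∧ ∀ x ∉ R, η x = 0} := by
  unfold W; congr 1; funext η
  by_cases hη : ∀ x ∉ R, η x = 0
  · by_cases hA : η ∈ A
    · rw [Set.indicator_of_mem hA, Set.indicator_of_mem (by exact ⟨hA, hη⟩)]
    · rw [Set.indicator_of_notMem hA, Set.indicator_of_notMem (by exact fun h => hA h.1)]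
  · simp only [Set.indicator, wt_zero hη, ite_self]

def DD (n : ℕ) (x : Site) (j : ℤ) : Set (Site → ℤ) :=
  {η | j ≤ η x ∧ ∃ C : Finset Site, n ≤ C.card ∧ (C : Set Site) ⊆ CC {z | j ≤ η z} x}

lemma rpow_sub_one {p : ℝ} (hp : 1 ≤ p) {k : ℝ} (hk : 1 ≤ k) : (k - 1) ^ p + 1 ≤ k ^ p := by
  have := Real.add_rpow_le_rpow_add (a := k - 1) (b := 1) (by linarith) (by norm_num) hp
  simpa using this

lemma P1 {p β : ℝ} (hp : 1 ≤ p) (hβ : 0 ≤ β)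
    (hV : 64 * (ENNReal.ofReal (Real.exp (-β)) * 2) ≤ 1 / 2) (a b c d : ℤ) (m : ℕ) (x : Site) (j : ℤ)
    (hj : 1 ≤ j) :
    W p β (rect a b c d) (DD (m ^ 2) x j) ≤
      ((4 * (rect a b c d).card : ℕ) : ℝ≥0∞) * ((1 / 2) ^ m * 2) * W p β (rect a b c d) (DD (m ^ 2) x (j - 1)) := by
  set R := rect a b c d with hR
  rw [W_supp]
  let v : ℤ → ℝ≥0∞ := fun g => if g ∈ ({1, -1} : Finset ℤ) then ENNReal.ofReal (Real.exp (-β)) else 0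
  have hv : ∑' g, v g = ENNReal.ofReal (Real.exp (-β)) * 2 := by
    rw [tsum_eq_sum (s := ({1, -1} : Finset ℤ)) (by intro g hg; simp only [v, if_neg hg])]
    rw [Finset.sum_pair (by norm_num)]
    simp only [v]; simp [mul_two]
  have h := PEI (wt p β R) {η | η ∈ DD (m ^ 2) x j ∧ ∀ x ∉ R, η x = 0} (DD (m ^ 2) x (j - 1)) v (EB R) m
    (by rw [hv]; exact hV) ?_
  · refine h.trans ?_
    have := card_EB R
    unfold W
    gcongr
  · rintro η ⟨⟨hηx, C, hC, hCC⟩, h0⟩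
    have hsub : {z | j ≤ η z} ⊆ (R : Set Site) := by
      intro z hz
      by_contra hzR
      have : j ≤ η z := hz
      rw [h0 z hzR] at this; omega
    obtain ⟨e0, Γ, ψ, he0, hΓ, hψ, hdψ, hψx, hψc, hcard⟩ := TOP (R.finite_toSet.subset hsub) (x := x) hηx
    set A : Set Site := {z | j ≤ η z} with hA
    have hind : ∀ z ∉ R, ind A z = 0 := by
      intro z hz; exact Set.indicator_of_notMem (fun h => hz (hsub h)) _
    have hψ0 : ∀ z ∉ R, ψ z = 0 := by
      apply supp_rect hψ
      intro e h1 h2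
      rw [hdψ]; split_ifs
      · simp only [dd]; rw [hind _ h1, hind _ h2]; rfl
      · rfl
    have hη' : ∀ z ∉ R, (η - ψ) z = 0 := by
      intro z hz; simp [h0 z hz, hψ0 z hz]
    have hΓX : ∀ e ∈ Γ, dd (ind A) e ≠ 0 := by
      intro e he
      have : e ∈ (Γ : Set Edge) := he
      rw [hΓ] at this
      exact comp_subset he0 this
    have hcases : ∀ e ∈ Γ, (dd (ind A) e = 1 ∧ 1 ≤ dd η e) ∨ (dd (ind A) e = -1 ∧ dd η e ≤ -1) := by
      intro e he
      have h1 := hΓX e he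
      simp only [dd, ind, Set.indicator, hA, Set.mem_ofPred_eq] at h1 ⊢
      split_ifs at h1 ⊢ with h2 h3 h3 <;> simp at h1 ⊢ <;> omega
    refine ⟨e0, ?_, Γ, RC_comp Γ hΓ, ?_, ψ, hψ, ?_, ?_, ?_⟩
    · apply mem_EB
      by_contra! hcon
      apply he0
      simp only [dd]; rw [hind _ hcon.1, hind _ hcon.2]; rfl
    · have := hC.trans (hcard C hCC)
      exact le_of_sq_le_sq this
    · intro e he; rw [hdψ, if_neg he]
    · refine ⟨by simp; omega, C, hC, hCC.trans (CC_into ?_)⟩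
      intro z hz
      have h1 : j ≤ η z := CC_sub (A := A) hηx hz
      have h2 := hψc z hz
      simp; omega
    · have hprod : ∏ e ∈ Γ, v (dd ψ e) = ENNReal.ofReal (Real.exp (-β * Γ.card)) := by
        rw [Finset.prod_congr rfl (g := fun _ => ENNReal.ofReal (Real.exp (-β)))]
        · rw [Finset.prod_const, ← ENNReal.ofReal_pow (Real.exp_pos _).le, ← Real.exp_nat_mul]
          congr 2; ring
        · intro e he
          simp only [v]
          rw [if_pos]
          rw [hdψ, if_pos he]
          rcases hcases e he with h | h <;> simp [h.1]
      rw [hprod, wt_pos h0, wt_pos hη', ← ENNReal.ofReal_mul (Real.exp_pos _).le, ← Real.exp_add]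
      apply ENNReal.ofReal_le_ofReal
      apply Real.exp_le_exp.2
      have hs := HR_split (p := p) (by linarith) (FS_ic (FS_of_zero h0)) (FS_ic (FS_of_zero hη')) Γ
        (fun _ => 1) ?_ ?_
      · simp only [Finset.sum_const, nsmul_eq_mul, mul_one] at hs
        simp only [HH]; nlinarith
      · intro e he
        rw [dd_ic, dd_ic, dd_sub, hdψ, if_neg he, sub_zero]
      · intro e he
        rw [dd_ic, dd_ic, dd_sub, hdψ, if_pos he]
        rcases hcases e he with h | h
        · have h1 : (1 : ℝ) ≤ (dd η e : ℤ) := by exact_mod_cast h.2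
          rw [h.1]; push_cast
          rw [abs_of_nonneg (by linarith), abs_of_nonneg (by linarith)]
          exact rpow_sub_one hp h1
        · have h1 : ((dd η e : ℤ) : ℝ) ≤ -1 := by exact_mod_cast h.2
          rw [h.1]; push_cast
          rw [abs_of_nonpos (by linarith), abs_of_nonpos (by linarith)]
          have := rpow_sub_one hp (k := -((dd η e : ℤ) : ℝ)) (by linarith)
          convert this using 3; ring
where
  le_of_sq_le_sq {m n : ℕ} (h : m ^ 2 ≤ n ^ 2) : m ≤ n := by
    exact (Nat.pow_le_pow_iff_left (by norm_num)).1 h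

lemma P1_iter {p β : ℝ} (hp : 1 ≤ p) (hβ : 0 ≤ β)
    (hV : 64 * (ENNReal.ofReal (Real.exp (-β)) * 2) ≤ 1 / 2) (a b c d : ℤ) (m : ℕ) (x : Site) (j : ℕ) :
    W p β (rect a b c d) (DD (m ^ 2) x j) ≤
      (((4 * (rect a b c d).card : ℕ) : ℝ≥0∞) * ((1 / 2) ^ m * 2)) ^ j * W p β (rect a b c d) Set.univ := by
  induction j with
  | zero => rw [pow_zero, one_mul]; exact W_mono (Set.subset_univ _)
  | succ j ih =>
    refine (P1 hp hβ hV a b c d m x _ (by push_cast; omega)).trans ?_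
    rw [pow_succ' _ j, mul_assoc (((4 * (rect a b c d).card : ℕ) : ℝ≥0∞) * ((1 / 2) ^ m * 2))]
    gcongr
    rw [Nat.cast_succ, add_sub_cancel_right]
    exact ih

def w2 (p β : ℝ) (R1 R2 : Finset Site) (F : Site → ℤ × ℤ) : ℝ≥0∞ :=
  wt p β R1 (fun z => (F z).1) * wt p β R2 (fun z => (F z).2)

def BAD (n : ℕ) : Set (Site → ℤ × ℤ) :=
  {F | ∃ y, F y ≠ 0 ∧ ∃ C : Finset Site, n ≤ C.card ∧ (C : Set Site) ⊆ CC {z | F z ≠ 0} y}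

lemma tsum_w2 (f : (Site → ℤ) → (Site → ℤ) → ℝ≥0∞) :
    ∑' F : Site → ℤ × ℤ, f (fun z => (F z).1) (fun z => (F z).2) = ∑' η, ∑' η', f η η' := by
  rw [← ENNReal.tsum_prod (f := f)]
  exact (Equiv.arrowProdEquivProdArrow Site (fun _ => ℤ) (fun _ => ℤ)).tsum_eq
    (fun c : (Site → ℤ) × (Site → ℤ) => f c.1 c.2)

lemma P2 {p β : ℝ} (hp : 1 ≤ p) (hβ : 1 ≤ β)
    (hV : 64 * (ENNReal.ofReal (Real.exp (-(β - 1))) * (KK 1 * KK 1)) ≤ 1 / 2)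
    (a b c d a' b' c' d' : ℤ) (m : ℕ) :
    ∑' F, (BAD (m ^ 2)).indicator (w2 p β (rect a b c d) (rect a' b' c' d')) F ≤
      ((4 * (rect a b c d ∪ rect a' b' c' d').card : ℕ) : ℝ≥0∞) * ((1 / 2) ^ m * 2) *
        (W p β (rect a b c d) Set.univ * W p β (rect a' b' c' d') Set.univ) := by
  set R1 := rect a b c d with hR1
  set R2 := rect a' b' c' d' with hR2
  have hp0 : 0 < p := by linarith
  have hsup : ∑' F, (BAD (m ^ 2)).indicator (w2 p β R1 R2) F =
      ∑' F, {F | F ∈ BAD (m ^ 2) ∧ (∀ x ∉ R1, (F x).1 = 0) ∧ (∀ x ∉ R2, (F x).2 = 0)}.indicator (w2 p β R1 R2) F := by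
    congr 1; funext F
    by_cases hη : (∀ x ∉ R1, (F x).1 = 0) ∧ (∀ x ∉ R2, (F x).2 = 0)
    · by_cases hA : F ∈ BAD (m ^ 2)
      · rw [Set.indicator_of_mem hA, Set.indicator_of_mem (by exact ⟨hA, hη⟩)]
      · rw [Set.indicator_of_notMem hA, Set.indicator_of_notMem (by exact fun h => hA h.1)]
    · have : w2 p β R1 R2 F = 0 := by
        rw [not_and_or] at hη
        rcases hη with h | h
        · rw [w2, wt_zero h, zero_mul]
        · rw [w2, wt_zero h, mul_zero]
      simp only [Set.indicator, this, ite_self]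
  rw [hsup]
  let v : ℤ × ℤ → ℝ≥0∞ := fun g => if g = 0 then 0 else
    ENNReal.ofReal (Real.exp (-β * (|(g.1 : ℝ)| ^ p + |(g.2 : ℝ)| ^ p)))
  have hv : ∑' g, v g ≤ ENNReal.ofReal (Real.exp (-(β - 1))) * (KK 1 * KK 1) := by
    have h1 : ∀ g : ℤ × ℤ, v g ≤ ENNReal.ofReal (Real.exp (-(β - 1))) *
        (ENNReal.ofReal (Real.exp (-1 * |(g.1 : ℝ)|)) * ENNReal.ofReal (Real.exp (-1 * |(g.2 : ℝ)|))) := by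
      intro g
      simp only [v]
      split_ifs with hg
      · exact zero_le
      · rw [← ENNReal.ofReal_mul (Real.exp_pos _).le, ← ENNReal.ofReal_mul (Real.exp_pos _).le,
          ← Real.exp_add, ← Real.exp_add]
        apply ENNReal.ofReal_le_ofReal
        apply Real.exp_le_exp.2
        have h1 := abs_le_rpow hp g.1
        have h2 := abs_le_rpow hp g.2
        have h3 : (1 : ℝ) ≤ |(g.1 : ℝ)| + |(g.2 : ℝ)| := by
          have : 1 ≤ |g.1| + |g.2| := by
            have h4 := abs_nonneg g.1
            have h5 := abs_nonneg g.2
            by_contra hcon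
            exact hg (Prod.ext (abs_eq_zero.1 (by omega)) (abs_eq_zero.1 (by omega)))
          rw [← Int.cast_abs, ← Int.cast_abs]; exact_mod_cast this
        nlinarith
    refine (ENNReal.tsum_le_tsum h1).trans ?_
    rw [ENNReal.tsum_mul_left, ENNReal.tsum_prod (f := fun a b : ℤ =>
      ENNReal.ofReal (Real.exp (-1 * |(a : ℝ)|)) * ENNReal.ofReal (Real.exp (-1 * |(b : ℝ)|)))]
    simp_rw [ENNReal.tsum_mul_left, ENNReal.tsum_mul_right]
    rfl
  have h := PEI (w2 p β R1 R2) {F | F ∈ BAD (m ^ 2) ∧ (∀ x ∉ R1, (F x).1 = 0) ∧ (∀ x ∉ R2, (F x).2 = 0)}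
    Set.univ v (EB (R1 ∪ R2)) m ((mul_le_mul_right hv _).trans hV) ?_
  · refine h.trans ?_
    have := card_EB (R1 ∪ R2)
    have h3 : ∑' F, Set.univ.indicator (w2 p β R1 R2) F = W p β R1 Set.univ * W p β R2 Set.univ := by
      simp only [Set.indicator_univ, W]
      have := tsum_w2 (fun η η' => wt p β R1 η * wt p β R2 η')
      simp_rw [ENNReal.tsum_mul_left, ENNReal.tsum_mul_right] at this
      exact this
    rw [h3]
    gcongr
  · rintro F ⟨⟨y, hy, C, hC, hCC⟩, h01, h02⟩
    set A : Set Site := {z | F z ≠ 0} with hA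
    have hsub : A ⊆ ((R1 ∪ R2 : Finset Site) : Set Site) := by
      intro z hz
      by_contra hzR
      simp only [Finset.coe_union, Set.mem_union, Finset.mem_coe, not_or] at hzR
      exact hz (Prod.ext (h01 z hzR.1) (h02 z hzR.2))
    obtain ⟨e0, Γ', -, he0, hΓ', -, -, -, -, hcard⟩ := TOP ((R1 ∪ R2).finite_toSet.subset hsub) (x := y) hy
    have hFS : FS F := by
      rw [FS_iff]; exact (R1 ∪ R2).finite_toSet.subset hsub
    have hXX : Function.support (dd (ind A)) ⊆ Function.support (dd F) := by
      intro e he h0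
      apply he
      simp only [dd, sub_eq_zero] at h0
      simp [dd, ind, Set.indicator, hA, h0]
    have he0F : dd F e0 ≠ 0 := hXX he0
    obtain ⟨ψ, hψ, hdψ⟩ := polymer hFS e0 he0F
    have hfin : (comp (Function.support (dd F)) e0).Finite :=
      (dd_support_finite hFS).subset (comp_subset he0F)
    have hmem : ∀ e, e ∈ hfin.toFinset ↔ e ∈ comp (Function.support (dd F)) e0 := by simp
    set Γ := hfin.toFinset with hΓ
    have hdψ2 : ∀ e, dd ψ e = if e ∈ Γ then dd F e else 0 := by
      intro e; rw [hdψ]; simp only [hmem]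
    have hd1 : ∀ e, dd (fun z => (F z).1) e = (dd F e).1 := fun e => by simp [dd]
    have hd2 : ∀ e, dd (fun z => (F z).2) e = (dd F e).2 := fun e => by simp [dd]
    have hd3 : ∀ e, dd (fun z => (ψ z).1) e = (dd ψ e).1 := fun e => by simp [dd]
    have hd4 : ∀ e, dd (fun z => (ψ z).2) e = (dd ψ e).2 := fun e => by simp [dd]
    have hψ1 : FS (fun z => (ψ z).1) := by
      obtain ⟨N, hN⟩ := hψ; exact ⟨N, fun z hz => hN z (fun h => hz (by simp [h]))⟩
    have hψ2 : FS (fun z => (ψ z).2) := by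
      obtain ⟨N, hN⟩ := hψ; exact ⟨N, fun z hz => hN z (fun h => hz (by simp [h]))⟩
    have hz1 : ∀ z ∉ R1, (ψ z).1 = 0 := by
      apply supp_rect hψ1
      intro e h1 h2
      rw [hd3, hdψ2]; split_ifs
      · rw [← hd1]; simp only [dd]; rw [h01 _ h1, h01 _ h2]; rfl
      · rfl
    have hz2 : ∀ z ∉ R2, (ψ z).2 = 0 := by
      apply supp_rect hψ2
      intro e h1 h2
      rw [hd4, hdψ2]; split_ifs
      · rw [← hd2]; simp only [dd]; rw [h02 _ h1, h02 _ h2]; rfl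
      · rfl
    have hy1 : ∀ z ∉ R1, ((F - ψ) z).1 = 0 := by
      intro z hz; simp [h01 z hz, hz1 z hz]
    have hy2 : ∀ z ∉ R2, ((F - ψ) z).2 = 0 := by
      intro z hz; simp [h02 z hz, hz2 z hz]
    refine ⟨e0, ?_, Γ, RC_comp Γ (X := Function.support (dd F)) (by simp [hΓ]), ?_, ψ, hψ, ?_, trivial, ?_⟩
    · apply mem_EB
      by_contra! hcon
      apply he0
      simp only [dd, ind]
      rw [Set.indicator_of_notMem (fun h => hcon.1 (hsub h)), Set.indicator_of_notMem (fun h => hcon.2 (hsub h))]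
      rfl
    · have h1 := P1.le_of_sq_le_sq (hC.trans (hcard C hCC))
      refine h1.trans (Finset.card_le_card ?_)
      intro e he
      rw [hmem]
      apply comp_mono hXX
      rw [← hΓ']; exact he
    · intro e he; rw [hdψ2, if_neg he]
    · have hprod : ∏ e ∈ Γ, v (dd ψ e) = ENNReal.ofReal (Real.exp (-β *
          ∑ e ∈ Γ, (|((dd F e).1 : ℝ)| ^ p + |((dd F e).2 : ℝ)| ^ p))) := by
        rw [Finset.mul_sum, Real.exp_sum, ENNReal.ofReal_prod_of_nonneg (fun _ _ => (Real.exp_pos _).le)]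
        apply Finset.prod_congr rfl
        intro e he
        have hne : dd F e ≠ 0 := comp_subset he0F ((hmem e).1 he)
        simp only [v, hdψ2, if_pos he, if_neg hne]
      rw [hprod, w2, w2, wt_pos h01, wt_pos h02, wt_pos hy1, wt_pos hy2]
      rw [← ENNReal.ofReal_mul (Real.exp_pos _).le, ← ENNReal.ofReal_mul (Real.exp_pos _).le,
        ← ENNReal.ofReal_mul (Real.exp_pos _).le, ← Real.exp_add, ← Real.exp_add, ← Real.exp_add]
      apply ENNReal.ofReal_le_ofReal
      apply Real.exp_le_exp.2
      have hda : ∀ e, dd (fun z => ((F - ψ) z).1) e = (dd F e).1 - (dd ψ e).1 := fun e => by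
        simp [dd]; ring
      have hdb : ∀ e, dd (fun z => ((F - ψ) z).2) e = (dd F e).2 - (dd ψ e).2 := fun e => by
        simp [dd]; ring
      have hs1 := HR_split (p := p) hp0 (FS_ic (FS_of_zero h01)) (FS_ic (FS_of_zero hy1)) Γ
        (fun e => |((dd F e).1 : ℝ)| ^ p) (by
          intro e he; rw [dd_ic, dd_ic, hda, hd1, hdψ2, if_neg he]; simp) (by
          intro e he; rw [dd_ic, dd_ic, hda, hd1, hdψ2, if_pos he]; simp [Real.zero_rpow hp0.ne'])
      have hs2 := HR_split (p := p) hp0 (FS_ic (FS_of_zero h02)) (FS_ic (FS_of_zero hy2)) Γ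
        (fun e => |((dd F e).2 : ℝ)| ^ p) (by
          intro e he; rw [dd_ic, dd_ic, hdb, hd2, hdψ2, if_neg he]; simp) (by
          intro e he; rw [dd_ic, dd_ic, hdb, hd2, hdψ2, if_pos he]; simp [Real.zero_rpow hp0.ne'])
      rw [Finset.sum_add_distrib]
      simp only [HH]
      nlinarith
end PS

namespace PS
open scoped ENNReal

lemma Estar_bdd (p : ℝ) : BddBelow {E | ∃ φ : Site → ℝ, (Function.support φ).Finite ∧ φ (0, 0) = 1 ∧ E = pDir p φ} := by
  refine ⟨0, ?_⟩
  rintro E ⟨φ, _, _, rfl⟩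
  unfold pDir
  have : 0 ≤ ∑' pr : Site × Site, if adjP pr.1 pr.2 then |φ pr.1 - φ pr.2| ^ p else 0 :=
    tsum_nonneg (fun _ => by split_ifs; exacts [Real.rpow_nonneg (abs_nonneg _) _, le_rfl])
  linarith

lemma Estar_le {p : ℝ} (hp : 0 < p) {φ : Site → ℝ} (h : FS φ) (h1 : φ (0, 0) = 1) : Estar p ≤ HR p φ := by
  rw [← pDir_eq hp h]
  exact csInf_le (Estar_bdd p) ⟨φ, (FS_iff φ).1 h, h1, rfl⟩

lemma Estar_near {p : ℝ} (hp : 0 < p) {ε : ℝ} (hε : 0 < ε) :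
    ∃ φ : Site → ℝ, FS φ ∧ φ (0, 0) = 1 ∧ HR p φ < Estar p + ε := by
  have hne : {E | ∃ φ : Site → ℝ, (Function.support φ).Finite ∧ φ (0, 0) = 1 ∧ E = pDir p φ}.Nonempty := by
    refine ⟨_, Set.indicator {(0, 0)} (fun _ => 1), ?_, by simp, rfl⟩
    exact (Set.finite_singleton (0, 0)).subset Set.support_indicator_subset
  obtain ⟨E, ⟨φ, h1, h2, rfl⟩, h4⟩ := exists_lt_of_csInf_lt hne (show Estar p < Estar p + ε by linarith)
  have h1' := (FS_iff φ).2 h1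
  exact ⟨φ, h1', h2, by rwa [pDir_eq hp h1'] at h4⟩

lemma Estar_lower {p : ℝ} (hp : 0 < p) {φ : Site → ℝ} (h : FS φ) (x : Site) {t : ℝ} (ht : 0 < t)
    (htx : t ≤ φ x) (h0 : 0 ≤ Estar p) : Estar p * t ^ p ≤ HR p φ := by
  have hx : 0 < φ x := lt_of_lt_of_le ht htx
  let φ' : Site → ℝ := fun z => φ (z + x) / φ x
  have hφ' : FS φ' := by
    rw [FS_iff] at *
    refine Set.Finite.subset (h.preimage (f := fun z : Site => z + x) (add_left_injective x).injOn) ?_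
    intro z hz
    simp only [Set.mem_preimage, Function.mem_support]
    intro h'; exact hz (by simp [φ', h'])
  have h1 := Estar_le hp hφ' (by
    simp only [φ']
    rw [show ((0, 0) : Site) + x = x by ext <;> simp]
    exact div_self hx.ne')
  have h2 : HR p φ' * φ x ^ p = HR p φ := by
    unfold HR
    rw [← tsum_mul_right]
    let eqv : Edge ≃ Edge := (Equiv.addRight x).prodCongr (Equiv.refl Bool)
    rw [← eqv.tsum_eq (fun e => |dd φ e| ^ p)]
    congr 1; funext e
    have : dd φ (eqv e) = dd φ' e * φ x := by
      have ht : tgt (eqv e) = tgt e + x := by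
        rcases e with ⟨⟨a, b⟩, _ | _⟩ <;> simp [eqv] <;> ext <;> simp <;> ring
      have ht2 : (eqv e).1 = e.1 + x := by simp [eqv]
      simp only [dd, φ', ht, ht2]
      field_simp
    rw [this, abs_mul, Real.mul_rpow (abs_nonneg _) (abs_nonneg _), abs_of_pos hx]
  rw [← h2]
  have h3 : t ^ p ≤ φ x ^ p := Real.rpow_le_rpow ht.le htx hp.le
  have h4 : 0 ≤ t ^ p := Real.rpow_nonneg ht.le _
  nlinarith

lemma level_id (φ : Site → ℝ) (n : ℕ) :
    ((n : ℝ) + 2) * ∑ a ∈ Finset.range (n + 1), φ (a, (n : ℤ) - a) -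
      (n + 1) * ∑ a ∈ Finset.range (n + 2), φ (a, (n : ℤ) + 1 - a) =
    ∑ a ∈ Finset.range (n + 1), (-((a : ℝ) + 1) * dd φ ((a, (n : ℤ) - a), false) -
      ((n : ℝ) - a + 1) * dd φ ((a, (n : ℤ) - a), true)) := by
  have h1 : ∑ a ∈ Finset.range (n + 2), (a : ℝ) * φ (a, (n : ℤ) + 1 - a) =
      ∑ a ∈ Finset.range (n + 1), ((a : ℝ) + 1) * φ ((a : ℤ) + 1, (n : ℤ) - a) := by
    rw [Finset.sum_range_succ']
    simp only [Nat.cast_zero, zero_mul, add_zero]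
    apply Finset.sum_congr rfl
    intro a _; push_cast; congr 3; ring
  have h2 : ∑ a ∈ Finset.range (n + 2), ((n : ℝ) + 1 - a) * φ (a, (n : ℤ) + 1 - a) =
      ∑ a ∈ Finset.range (n + 1), ((n : ℝ) + 1 - a) * φ (a, (n : ℤ) + 1 - a) := by
    rw [Finset.sum_range_succ]; push_cast; simp
  have h3 : (n + 1 : ℝ) * ∑ a ∈ Finset.range (n + 2), φ (a, (n : ℤ) + 1 - a) =
      ∑ a ∈ Finset.range (n + 1), (((a : ℝ) + 1) * φ ((a : ℤ) + 1, (n : ℤ) - a) +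
        ((n : ℝ) + 1 - a) * φ (a, (n : ℤ) + 1 - a)) := by
    rw [Finset.sum_add_distrib, ← h1, ← h2, ← Finset.sum_add_distrib, Finset.mul_sum]
    apply Finset.sum_congr rfl; intro a _; ring
  rw [h3, Finset.mul_sum, ← Finset.sum_sub_distrib]
  apply Finset.sum_congr rfl
  intro a _
  simp only [dd, tgt_false, tgt_true]
  rw [show (n : ℤ) - a + 1 = n + 1 - a by ring]
  ring

lemma Estar_pos {p : ℝ} (hp1 : 1 < p) (hp2 : p < 2) : 0 < Estar p := by
  have hp0 : 0 < p := by linarith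
  obtain ⟨q, hpq⟩ : ∃ q, p.HolderConjugate q := ⟨_, Real.HolderConjugate.conjExponent hp1⟩
  have hq2 : 2 < q := by
    have := hpq.inv_add_inv_eq_one
    have h1 : 1 / 2 < p⁻¹ := by rw [inv_eq_one_div]; exact one_div_lt_one_div_of_lt hp0 hp2
    have hq0 := hpq.symm.pos
    have h2 : q⁻¹ < 1 / 2 := by linarith
    rw [inv_eq_one_div] at h2
    exact lt_of_one_div_lt_one_div hq0 h2
  have hq0 : 0 < q := by linarith
  have hsum : Summable (fun n : ℕ => ((n : ℝ) + 1) ^ (1 - q)) := by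
    have := (Real.summable_nat_rpow (p := 1 - q)).2 (by linarith)
    have h2 := (summable_nat_add_iff 1).2 this
    simpa using h2
  set T := ∑' n : ℕ, ((n : ℝ) + 1) ^ (1 - q) with hT
  have hT0 : 0 ≤ T := tsum_nonneg (fun n => Real.rpow_nonneg (by positivity) _)
  -- the inverse scale
  set lam : ℝ := (4 * T + 4) ^ (1 / q) with hlam
  have hlam0 : 0 < lam := by positivity
  have hlamq : lam ^ q = 4 * T + 4 := by
    rw [hlam, ← Real.rpow_mul (by positivity)]; rw [one_div_mul_cancel hq0.ne', Real.rpow_one]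
  suffices h : 1 / (2 * lam ^ p) ≤ Estar p by
    refine lt_of_lt_of_le ?_ h; positivity
  refine le_csInf ?_ ?_
  · refine ⟨_, Set.indicator {(0, 0)} (fun _ => 1), ?_, by simp, rfl⟩
    exact (Set.finite_singleton (0, 0)).subset Set.support_indicator_subset
  rintro E ⟨φ, hφ, hφ0, rfl⟩
  rw [← FS_iff] at hφ
  rw [pDir_eq hp0 hφ]
  let m : ℕ → ℝ := fun n => (∑ a ∈ Finset.range (n + 1), φ (a, (n : ℤ) - a)) / (n + 1)
  have hstep : ∀ n : ℕ, m n - m (n + 1) ≤ ∑ a ∈ Finset.range (n + 1), ∑ s : Bool,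
      (1 / ((n : ℝ) + 1)) * |dd φ ((a, (n : ℤ) - a), s)| := by
    intro n
    have hid := level_id φ n
    have hn : (0 : ℝ) < n + 1 := by positivity
    have hn2 : (0 : ℝ) < n + 2 := by positivity
    have : m n - m (n + 1) = (((n : ℝ) + 2) * ∑ a ∈ Finset.range (n + 1), φ (a, (n : ℤ) - a) -
      (n + 1) * ∑ a ∈ Finset.range (n + 2), φ (a, (n : ℤ) + 1 - a)) / ((n + 1) * (n + 2)) := by
      simp only [m]; push_cast
      rw [show (n : ℝ) + 1 + 1 = n + 2 by ring]
      field_simp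
    rw [this, hid, Finset.sum_div]
    apply Finset.sum_le_sum
    intro a ha
    have ha' : (a : ℝ) ≤ n := by
      have := Finset.mem_range.1 ha; exact_mod_cast Nat.lt_succ_iff.1 this
    have ha0 : (0 : ℝ) ≤ a := by positivity
    rw [Fintype.sum_bool, div_le_iff₀ (by positivity)]
    set u := dd φ ((a, (n : ℤ) - a), false)
    set v := dd φ ((a, (n : ℤ) - a), true)
    have hu := neg_abs_le u
    have hv := neg_abs_le v
    have hu0 := abs_nonneg u
    have hv0 := abs_nonneg v
    have hR : (1 / ((n : ℝ) + 1) * |v| + 1 / (n + 1) * |u|) * ((n + 1) * (n + 2)) = (n + 2) * |v| + (n + 2) * |u| := by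
      field_simp
    rw [hR]
    nlinarith [mul_le_mul_of_nonneg_left hu (show (0 : ℝ) ≤ a + 1 by linarith),
      mul_le_mul_of_nonneg_left hv (show (0 : ℝ) ≤ n - a + 1 by linarith)]
  have hyoung : ∀ (n : ℕ) (d : ℝ), 0 ≤ d → (1 / ((n : ℝ) + 1)) * d ≤
      lam ^ p * d ^ p + (1 / (4 * T + 4)) * ((n : ℝ) + 1) ^ (-q) := by
    intro n d hd
    have hn : (0 : ℝ) < n + 1 := by positivity
    have h := Real.young_inequality_of_nonneg (a := lam * d) (b := 1 / (lam * (n + 1))) (by positivity)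
      (by positivity) hpq
    have e1 : lam * d * (1 / (lam * (n + 1))) = (1 / ((n : ℝ) + 1)) * d := by field_simp
    have e2 : (1 / (lam * (n + 1))) ^ q = (1 / (4 * T + 4)) * ((n : ℝ) + 1) ^ (-q) := by
      rw [one_div, Real.inv_rpow (by positivity), Real.mul_rpow hlam0.le hn.le, hlamq, Real.rpow_neg hn.le,
        mul_inv, one_div]
    rw [e1, e2, Real.mul_rpow hlam0.le hd] at h
    have h3 : lam ^ p * d ^ p / p ≤ lam ^ p * d ^ p := div_le_self (by positivity) hp1.le
    have h4 : (1 / (4 * T + 4)) * ((n : ℝ) + 1) ^ (-q) / q ≤ (1 / (4 * T + 4)) * ((n : ℝ) + 1) ^ (-q) :=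
      div_le_self (by positivity) (by linarith)
    linarith
  obtain ⟨N, hN⟩ := hφ
  have hm0 : m 0 = 1 := by simp [m, hφ0]
  set M : ℕ := (2 * N + 1).toNat with hM
  have hmM : m M = 0 := by
    simp only [m]
    rw [Finset.sum_eq_zero, zero_div]
    intro a ha
    by_contra h0
    have := hN _ h0
    simp only at this
    omega
  have htel : ∑ n ∈ Finset.range M, (m n - m (n + 1)) = 1 := by
    rw [Finset.sum_range_sub', hm0, hmM]; norm_num
  have hE : ∑ n ∈ Finset.range M, ∑ a ∈ Finset.range (n + 1), ∑ s : Bool, |dd φ ((a, (n : ℤ) - a), s)| ^ p ≤ HR p φ := by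
    have hss := HR_summable hp0 ⟨N, hN⟩
    rw [Finset.sum_sigma']
    rw [← Finset.sum_product' (s := (Finset.range M).sigma fun n => Finset.range (n + 1)) (t := Finset.univ)
      (f := fun c (s : Bool) => |dd φ (((c.2 : ℤ), (c.1 : ℤ) - c.2), s)| ^ p)]
    rw [← Finset.sum_image (s := (((Finset.range M).sigma fun n => Finset.range (n + 1)) ×ˢ (Finset.univ : Finset Bool)))
      (g := fun c : (Σ _ : ℕ, ℕ) × Bool => ((((c.1.2 : ℤ), (c.1.1 : ℤ) - c.1.2), c.2) : Edge))
      (f := fun e => |dd φ e| ^ p)]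
    · exact hss.sum_le_tsum _ (fun _ _ => Real.rpow_nonneg (abs_nonneg _) _)
    · rintro ⟨⟨n, a⟩, s⟩ _ ⟨⟨n', a'⟩, s'⟩ _ h
      simp only [Prod.mk.injEq] at h
      obtain ⟨⟨h1, h2⟩, rfl⟩ := h
      obtain rfl : a = a' := by omega
      obtain rfl : n = n' := by omega
      rfl
  have hbig : (1 : ℝ) ≤ lam ^ p * HR p φ + 2 * (1 / (4 * T + 4)) * T := by
    calc (1 : ℝ) = ∑ n ∈ Finset.range M, (m n - m (n + 1)) := htel.symm
      _ ≤ ∑ n ∈ Finset.range M, ∑ a ∈ Finset.range (n + 1), ∑ s : Bool,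
          (lam ^ p * |dd φ ((a, (n : ℤ) - a), s)| ^ p + (1 / (4 * T + 4)) * ((n : ℝ) + 1) ^ (-q)) := by
          apply Finset.sum_le_sum; intro n _
          refine (hstep n).trans ?_
          apply Finset.sum_le_sum; intro a _
          apply Finset.sum_le_sum; intro s _
          exact hyoung n _ (abs_nonneg _)
      _ = lam ^ p * (∑ n ∈ Finset.range M, ∑ a ∈ Finset.range (n + 1), ∑ s : Bool, |dd φ ((a, (n : ℤ) - a), s)| ^ p)
          + 2 * (1 / (4 * T + 4)) * ∑ n ∈ Finset.range M, ((n : ℝ) + 1) ^ (1 - q) := by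
          simp_rw [Finset.sum_add_distrib, ← Finset.mul_sum]
          congr 1
          rw [mul_assoc, mul_comm (2 : ℝ), mul_assoc, Finset.sum_mul, Finset.mul_sum, Finset.mul_sum]
          apply Finset.sum_congr rfl
          intro n _
          simp only [Finset.sum_const, Finset.card_range, Finset.card_univ, Fintype.card_bool, nsmul_eq_mul]
          rw [sub_eq_add_neg, Real.rpow_add (by positivity), Real.rpow_one]
          push_cast; ring
      _ ≤ _ := by
          have h5 : ∑ n ∈ Finset.range M, ((n : ℝ) + 1) ^ (1 - q) ≤ T :=
            hsum.sum_le_tsum _ (fun _ _ => by positivity)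
          gcongr
  have hhalf : 2 * (1 / (4 * T + 4)) * T ≤ 1 / 2 := by
    rw [mul_one_div, div_mul_eq_mul_div, div_le_iff₀ (by positivity)]; linarith
  rw [div_le_iff₀ (by positivity)]
  nlinarith
end PS

namespace PS
open scoped ENNReal

lemma card_small (R : Finset Site) (n : ℕ) :
    (R.powerset.filter (fun C => C.card < n)).card ≤ (R.card + 1) ^ n := by
  have h1 : R.powerset.filter (fun C => C.card < n) ⊆ (Finset.range n).biUnion (fun k => R.powersetCard k) := by
    intro C hC
    rw [Finset.mem_filter, Finset.mem_powerset] at hC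
    rw [Finset.mem_biUnion]
    exact ⟨C.card, Finset.mem_range.2 hC.2, Finset.mem_powersetCard.2 ⟨hC.1, rfl⟩⟩
  refine (Finset.card_le_card h1).trans (Finset.card_biUnion_le.trans ?_)
  rw [add_pow]
  calc ∑ k ∈ Finset.range n, (R.powersetCard k).card
      ≤ ∑ k ∈ Finset.range n, R.card ^ k * 1 ^ (n - k) * (n.choose k) := by
        apply Finset.sum_le_sum; intro k hk
        rw [Finset.card_powersetCard, one_pow, mul_one]
        have h2 : 1 ≤ n.choose k := Nat.choose_pos (Finset.mem_range.1 hk).le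
        exact (Nat.choose_le_pow R.card k).trans (Nat.le_mul_of_pos_right _ h2)
    _ ≤ _ := by
        apply Finset.sum_le_sum_of_subset
        exact Finset.range_mono (by omega)

lemma KK_ge (t : ℝ) : 1 ≤ KK t := by
  refine le_trans ?_ (ENNReal.le_tsum (0 : ℤ)); simp

lemma cut_edge {p : ℝ} (hp : 1 ≤ p) (u v a : ℝ) (hu : a ≤ u) (hv : v ≤ a) :
    |u - a| ^ p + |a - v| ^ p ≤ |u - v| ^ p := by
  rw [abs_of_nonneg (by linarith), abs_of_nonneg (by linarith), abs_of_nonneg (by linarith)]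
  have := Real.add_rpow_le_rpow_add (a := u - a) (b := a - v) (by linarith) (by linarith) hp
  simpa using this

lemma CUT {p β ε : ℝ} (hp : 1 ≤ p) (hβ : 0 < β) (hε0 : 0 ≤ ε) (hε : ε ≤ 1) (hE : 0 ≤ Estar p)
    (R : Finset Site) (x : Site) (a h n : ℕ) (hah : a < h) :
    W p β R {η | (h : ℤ) ≤ η x ∧ η ∉ DD n x (a + 1)} ≤
      (((R.card + 1) ^ n : ℕ) : ℝ≥0∞) *
        (ENNReal.ofReal (Real.exp (-((1 - ε) * β * (Estar p * ((h : ℝ) - a) ^ p)))) * KK (ε * β) ^ n) *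
        W p β R Set.univ := by
  have hp0 : 0 < p := by linarith
  have hεpos : 0 ≤ ε * β := mul_nonneg hε0 hβ.le
  let cl : (Site → ℤ) → Set Site := fun η => CC {z | (a : ℤ) + 1 ≤ η z} x
  rw [W_supp]
  have h1 : ∀ η ∈ {η | η ∈ {η : Site → ℤ | (h : ℤ) ≤ η x ∧ η ∉ DD n x (a + 1)} ∧ ∀ x ∉ R, η x = 0},
      ∃ C ∈ R.powerset.filter (fun C => C.card < n),
        η ∈ {η : Site → ℤ | (h : ℤ) ≤ η x ∧ (C : Set Site) = cl η ∧ ∀ x ∉ R, η x = 0} := by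
    rintro η ⟨⟨hx, hD⟩, h0⟩
    have hxA : (a : ℤ) + 1 ≤ η x := by omega
    have hsub : cl η ⊆ (R : Set Site) := by
      refine (CC_sub hxA).trans ?_
      intro z hz
      by_contra hzR
      have : (a : ℤ) + 1 ≤ η z := hz
      rw [h0 z hzR] at this; omega
    have hfin : (cl η).Finite := R.finite_toSet.subset hsub
    refine ⟨hfin.toFinset, ?_, hx, by simp, h0⟩
    rw [Finset.mem_filter, Finset.mem_powerset]
    refine ⟨by simpa using hsub, ?_⟩
    by_contra hcon
    exact hD ⟨hxA, hfin.toFinset, not_lt.1 hcon, by simp [cl]⟩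
  refine (W_biUnion _ h1).trans ?_
  have key : ∀ C ∈ R.powerset.filter (fun C => C.card < n),
      W p β R {η : Site → ℤ | (h : ℤ) ≤ η x ∧ (C : Set Site) = cl η ∧ ∀ x ∉ R, η x = 0} ≤
      (ENNReal.ofReal (Real.exp (-((1 - ε) * β * (Estar p * ((h : ℝ) - a) ^ p)))) * KK (ε * β) ^ n) *
        W p β R Set.univ := by
    intro C hC
    rw [Finset.mem_filter, Finset.mem_powerset] at hC
    have h2 := tsum_inj {η : Site → ℤ | (h : ℤ) ≤ η x ∧ (C : Set Site) = cl η ∧ ∀ x ∉ R, η x = 0}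
      (wt p β R) (fun c : (Site → ℤ) × (Site → ℤ) =>
        ENNReal.ofReal (Real.exp (-((1 - ε) * β * (Estar p * ((h : ℝ) - a) ^ p)))) *
          (wt p (ε * β) C c.1 * wt p β R c.2))
      (fun η => ((fun z => if z ∈ C then η z - a else 0), (fun z => if z ∈ C then (a : ℤ) else η z))) ?_ ?_
    · refine h2.trans ?_
      rw [ENNReal.tsum_prod (f := fun τ η => ENNReal.ofReal (Real.exp (-((1 - ε) * β * (Estar p * ((h : ℝ) - a) ^ p)))) *
          (wt p (ε * β) C τ * wt p β R η))]
      simp_rw [ENNReal.tsum_mul_left, ENNReal.tsum_mul_right]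
      have h3 := KB hp hεpos C
      have h4 : KK (ε * β) ^ C.card ≤ KK (ε * β) ^ n := pow_le_pow_right₀ (KK_ge _) hC.2.le
      simp only [W, Set.indicator_univ] at h3 ⊢
      refine le_trans (le_of_eq (mul_assoc _ _ _).symm) ?_
      exact mul_le_mul_left (mul_le_mul_right (h3.trans h4) _) _
    · intro η _ η' _ heq
      simp only [Prod.mk.injEq] at heq
      funext z
      have e1 := congrFun heq.1 z
      have e2 := congrFun heq.2 z
      split_ifs at e1 e2 <;> omega
    · rintro η ⟨hx, hCl, h0⟩
      have hxA : (a : ℤ) + 1 ≤ η x := by omega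
      have hCm : ∀ z, z ∈ C ↔ z ∈ cl η := by intro z; rw [← hCl]; simp
      have hCA : ∀ z ∈ C, (a : ℤ) + 1 ≤ η z := fun z hz => CC_sub (A := {z | (a : ℤ) + 1 ≤ η z}) hxA ((hCm z).1 hz)
      have hxC : x ∈ C := (hCm x).2 Relation.ReflTransGen.refl
      have hbd : ∀ u v, u ∈ C → v ∉ C → adjP u v → η v ≤ a := by
        intro u v hu hv huv
        by_contra hcon
        exact hv ((hCm v).2 (Relation.ReflTransGen.tail ((hCm u).1 hu) ⟨huv, by
          show (a : ℤ) + 1 ≤ η v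
          omega⟩))
      set τ : Site → ℤ := fun z => if z ∈ C then η z - a else 0 with hτ
      set η' : Site → ℤ := fun z => if z ∈ C then (a : ℤ) else η z with hη'
      have hτ0 : ∀ z ∉ C, τ z = 0 := fun z hz => by simp [hτ, hz]
      have hη0 : ∀ z ∉ R, η' z = 0 := fun z hz => by
        have : z ∉ C := fun h => hz (hC.1 h)
        simp [hη', this, h0 z hz]
      rw [wt_pos h0, wt_pos hτ0, wt_pos hη0, ← ENNReal.ofReal_mul (Real.exp_pos _).le,
        ← ENNReal.ofReal_mul (Real.exp_pos _).le, ← Real.exp_add, ← Real.exp_add]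
      apply ENNReal.ofReal_le_ofReal
      apply Real.exp_le_exp.2
      have hFτ := FS_ic (FS_of_zero hτ0)
      have hFη := FS_ic (FS_of_zero h0)
      have hFη' := FS_ic (FS_of_zero hη0)
      have hsplit : HH p τ + HH p η' ≤ HH p η := by
        unfold HH HR
        rw [← (HR_summable hp0 hFτ).tsum_add (HR_summable hp0 hFη')]
        refine ((HR_summable hp0 hFτ).add (HR_summable hp0 hFη')).tsum_le_tsum ?_ (HR_summable hp0 hFη)
        intro e
        by_cases h1 : e.1 ∈ C <;> by_cases h2 : tgt e ∈ C
        · simp [dd, ic, hτ, hη', h1, h2, Real.zero_rpow hp0.ne']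
        · have h3 := hbd _ _ h1 h2 (adjP_tgt e)
          have h4 := hCA _ h1
          have h3' : (η (tgt e) : ℝ) ≤ a := by exact_mod_cast h3
          have h4' : (a : ℝ) ≤ η e.1 := by exact_mod_cast (show (a : ℤ) ≤ η e.1 by omega)
          have := cut_edge hp (η e.1) (η (tgt e)) a h4' h3'
          simp [dd, ic, hτ, hη', h1, h2]
          rw [abs_sub_comm (a : ℝ), abs_sub_comm (η e.1 : ℝ) (η (tgt e))] at this
          rwa [abs_sub_comm (a : ℝ)]
        · have h3 := hbd _ _ h2 h1 (adjP_symm (adjP_tgt e))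
          have h4 := hCA _ h2
          have h3' : (η e.1 : ℝ) ≤ a := by exact_mod_cast h3
          have h4' : (a : ℝ) ≤ η (tgt e) := by exact_mod_cast (show (a : ℤ) ≤ η (tgt e) by omega)
          have := cut_edge hp (η (tgt e)) (η e.1) a h4' h3'
          simpa [dd, ic, hτ, hη', h1, h2] using this
        · simp [dd, ic, hτ, hη', h1, h2, Real.zero_rpow hp0.ne']
      have hlow : Estar p * ((h : ℝ) - a) ^ p ≤ HH p τ := by
        apply Estar_lower hp0 hFτ x _ _ hE
        · have : (a : ℝ) < h := by exact_mod_cast hah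
          linarith
        · simp only [ic, hτ, hxC, if_true]
          have : (h : ℝ) ≤ η x := by exact_mod_cast hx
          push_cast; linarith
      have h5 : 0 ≤ (1 - ε) * β := mul_nonneg (by linarith) hβ.le
      nlinarith [mul_le_mul_of_nonneg_left hlow h5, mul_le_mul_of_nonneg_left hsplit hβ.le]
  refine (Finset.sum_le_sum key).trans ?_
  rw [Finset.sum_const, nsmul_eq_mul]
  refine le_trans ?_ (le_of_eq (mul_assoc _ _ _).symm)
  refine mul_le_mul_left ?_ _
  exact_mod_cast card_small R n
end PS

namespace PS
open scoped ENNReal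

def Pr (p β : ℝ) (R : Finset Site) (A : Set (Site → ℤ)) : ℝ := (W p β R A).toReal / (W p β R Set.univ).toReal

lemma Z_pos {p β : ℝ} (hp : 1 ≤ p) (hβ : 0 < β) (R : Finset Site) : 0 < (W p β R Set.univ).toReal :=
  ENNReal.toReal_pos (W_pos p β R).ne' (W_lt hp hβ R _).ne

lemma Pr_le_of {p β : ℝ} (hp : 1 ≤ p) (hβ : 0 < β) {R : Finset Site} {A : Set (Site → ℤ)} {K : ℝ≥0∞}
    (hK : K ≠ ∞) (h : W p β R A ≤ K * W p β R Set.univ) : Pr p β R A ≤ K.toReal := by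
  rw [Pr, div_le_iff₀ (Z_pos hp hβ R), ← ENNReal.toReal_mul]
  exact ENNReal.toReal_mono (ENNReal.mul_ne_top hK (W_lt hp hβ R _).ne) h

lemma Pr_nonneg (p β : ℝ) (R : Finset Site) (A : Set (Site → ℤ)) : 0 ≤ Pr p β R A := by
  unfold Pr; positivity

lemma Pr_mono {p β : ℝ} (hp : 1 ≤ p) (hβ : 0 < β) {R : Finset Site} {A B : Set (Site → ℤ)} (h : A ⊆ B) :
    Pr p β R A ≤ Pr p β R B :=
  div_le_div_of_nonneg_right (ENNReal.toReal_mono (W_lt hp hβ R _).ne (W_mono h)) ENNReal.toReal_nonneg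

lemma ev_log {t c : ℝ} (ht : 0 < t) (hc : 0 < c) : ∀ᶠ x : ℝ in atTop, Real.log x ≤ c * x ^ t := by
  filter_upwards [(isLittleO_log_rpow_atTop ht).bound hc, eventually_ge_atTop 1] with x hx hx1
  rw [Real.norm_of_nonneg (Real.log_nonneg hx1), Real.norm_of_nonneg (Real.rpow_nonneg (by linarith) _)] at hx
  exact hx

lemma ev_const {t c : ℝ} (ht : 0 < t) (hc : 0 < c) (C : ℝ) : ∀ᶠ x : ℝ in atTop, C ≤ c * x ^ t :=
  ((tendsto_rpow_atTop ht).const_mul_atTop hc).eventually_ge_atTop C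

lemma asym {p r B δ c C : ℝ} (hr1 : p - 1 < r) (hr2 : 2 * r < p) (hr0 : 0 < r) (hp : 0 < p)
    (hδ : 0 < δ) (hc : 0 < c) : ∀ᶠ x : ℝ in atTop, 1 ≤ x ∧
      Real.log 8 + 20 * Real.log x ≤ x ^ r / 4 ∧ B * x ^ p + Real.log 2 ≤ δ * x * x ^ r / 4 ∧
      4 * x ^ (2 * r) * (C + 20 * Real.log x) ≤ c * x ^ p - Real.log 2 := by
  filter_upwards [ev_const hr0 (show (0 : ℝ) < 1 / 8 by norm_num) (Real.log 8),
    ev_log hr0 (show (0 : ℝ) < 1 / 160 by norm_num),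
    ev_const (show 0 < r + 1 - p by linarith) (show 0 < δ / 4 by positivity) (B + 1),
    ev_const (show 0 < p - 2 * r by linarith) (show 0 < c / 16 by positivity) C,
    ev_log (show 0 < p - 2 * r by linarith) (show 0 < c / 320 by positivity),
    ev_const hp (show 0 < c / 2 by positivity) (Real.log 2), eventually_ge_atTop 1]
    with x h1 h2 h3 h4 h5 h6 h7
  have hx : 0 < x := by linarith
  have hxp : 1 ≤ x ^ p := Real.one_le_rpow h7 hp.le
  have hl2 : Real.log 2 ≤ 1 := by have := Real.log_two_lt_d9; linarith
  refine ⟨h7, by linarith, ?_, ?_⟩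
  · have e : x * x ^ r = x ^ p * x ^ (r + 1 - p) := by
      rw [← Real.rpow_add hx]; nth_rewrite 1 [← Real.rpow_one x]; rw [← Real.rpow_add hx]; congr 1; ring
    have : δ * x * x ^ r / 4 = x ^ p * (δ / 4 * x ^ (r + 1 - p)) := by
      rw [mul_assoc δ, e]; ring
    rw [this]
    nlinarith
  · have e : x ^ (2 * r) * x ^ (p - 2 * r) = x ^ p := by rw [← Real.rpow_add hx]; congr 1; ring
    have h0 : 0 ≤ x ^ (2 * r) := Real.rpow_nonneg hx.le _
    have : C + 20 * Real.log x ≤ c / 8 * x ^ (p - 2 * r) := by linarith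
    have := mul_le_mul_of_nonneg_left this (show 0 ≤ 4 * x ^ (2 * r) by linarith)
    have e2 : 4 * x ^ (2 * r) * (c / 8 * x ^ (p - 2 * r)) = c / 2 * x ^ p := by rw [← e]; ring
    linarith

def okβ (β : ℝ) : Prop := 1 ≤ β ∧ 64 * (ENNReal.ofReal (Real.exp (-β)) * 2) ≤ 1 / 2 ∧
  64 * (ENNReal.ofReal (Real.exp (-(β - 1))) * (KK 1 * KK 1)) ≤ 1 / 2

lemma exp_help (n : ℕ) (u v w : ℝ) :
    Real.exp u ^ n * (Real.exp v * Real.exp w ^ n) = Real.exp ((n : ℝ) * (u + w) + v) := by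
  rw [← Real.exp_nat_mul, ← Real.exp_nat_mul, ← Real.exp_add, ← Real.exp_add]
  congr 1; ring

lemma ld_real {m : ℕ} {A B Q Y δ ε l : ℝ} (hm : (m : ℝ) ≤ 2 * Y) (hA : 0 ≤ A) (hQ : 0 ≤ Q) (hε : ε = 8 * δ) (hδ : 0 ≤ δ)
    (hδ1 : δ ≤ 1) (hB : 4 * Y ^ 2 * A ≤ ε / 4 * Q - l) (hBB : B = (1 - δ) ^ 3 * Q) :
    ((m ^ 2 : ℕ) : ℝ) * A + -B ≤ -((1 - ε) * Q) - l := by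
  have h1 : ((m ^ 2 : ℕ) : ℝ) ≤ 4 * Y ^ 2 := by
    rw [Nat.cast_pow]
    have := pow_le_pow_left₀ (Nat.cast_nonneg m) hm 2
    calc (m : ℝ) ^ 2 ≤ (2 * Y) ^ 2 := this
      _ = _ := by ring
  have h2 := mul_le_mul_of_nonneg_right h1 hA
  have h14 : 1 - ε / 2 ≤ (1 - δ) ^ 3 := by
    rw [hε]
    have : (1 - δ) ^ 3 = 1 - 3 * δ + δ ^ 2 * (3 - δ) := by ring
    have h3 : 0 ≤ δ ^ 2 * (3 - δ) := mul_nonneg (sq_nonneg _) (by linarith)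
    linarith
  have h15 := mul_le_mul_of_nonneg_right h14 hQ
  have h16 : 0 ≤ ε * Q := by rw [hε]; positivity
  rw [hBB]
  linarith

set_option maxHeartbeats 1000000 in
lemma LDU {p β ε : ℝ} (hp1 : 1 < p) (hp2 : p < 2) (hok : okβ β) (hε0 : 0 < ε) (hε1 : ε < 1) :
    ∃ h0 : ℕ, ∀ h : ℕ, h0 ≤ h → ∀ a b c d : ℤ, ((rect a b c d).card : ℝ) ≤ (h : ℝ) ^ 20 → ∀ x,
      Pr p β (rect a b c d) {η | (h : ℤ) ≤ η x} ≤ Real.exp (-((1 - ε) * β * (Estar p * (h : ℝ) ^ p))) := by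
  have hβ : 0 < β := by linarith [hok.1]
  have hE := Estar_pos hp1 hp2
  have hp : 1 ≤ p := hp1.le
  set δ := ε / 8 with hδ
  have hδ0 : 0 < δ := by positivity
  set r := (3 * p - 2) / 4 with hr
  set κ := (KK (δ * β)).toReal with hκ
  have hKlt := KK_lt (show 0 < δ * β by positivity)
  have hκ1 : 1 ≤ κ := by
    rw [hκ, ← ENNReal.toReal_one]; exact ENNReal.toReal_mono hKlt.ne (KK_ge _)
  have hev := (tendsto_natCast_atTop_atTop (R := ℝ)).eventually
    (asym (p := p) (r := r) (B := β * Estar p) (δ := δ) (c := ε / 4 * (β * Estar p)) (C := Real.log 2 + Real.log κ)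
      (by rw [hr]; linarith) (by rw [hr]; linarith) (by rw [hr]; linarith) (by linarith)
      hδ0 (by positivity))
  obtain ⟨h0, hh0⟩ := eventually_atTop.1 hev
  refine ⟨h0, fun h hh a b c d hcard x => ?_⟩
  obtain ⟨hx1, F1, F2, F3⟩ := hh0 h hh
  set X : ℝ := (h : ℝ) with hX
  have hX0 : 0 < X := by linarith
  set R := rect a b c d with hR
  set al : ℕ := ⌊δ * X⌋₊ with hal
  set m : ℕ := ⌈X ^ r⌉₊ with hm
  have hal1 : (al : ℝ) ≤ δ * X := Nat.floor_le (by positivity)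
  have hal2 : δ * X ≤ al + 1 := (Nat.lt_floor_add_one _).le
  have hXr1 : 1 ≤ X ^ r := Real.one_le_rpow hx1 (by rw [hr]; linarith)
  have hm1 : X ^ r ≤ m := Nat.le_ceil _
  have hm2 : (m : ℝ) ≤ 2 * X ^ r := by
    have := Nat.ceil_lt_add_one (show 0 ≤ X ^ r by linarith)
    linarith
  have halh : al < h := by
    have : (al : ℝ) < h := by
      have : δ * X < X := by nlinarith
      linarith
    exact_mod_cast this
  have hW : W p β R {η | (h : ℤ) ≤ η x} ≤
      ((((4 * R.card : ℕ) : ℝ≥0∞) * ((1 / 2) ^ m * 2)) ^ (al + 1) + (((R.card + 1) ^ (m ^ 2) : ℕ) : ℝ≥0∞) *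
        (ENNReal.ofReal (Real.exp (-((1 - δ) * β * (Estar p * ((h : ℝ) - al) ^ p)))) * KK (δ * β) ^ (m ^ 2)))
        * W p β R Set.univ := by
    rw [add_mul]
    refine (W_union (B := DD (m ^ 2) x ((al + 1 : ℕ) : ℤ)) (C := {η | (h : ℤ) ≤ η x ∧ η ∉ DD (m ^ 2) x (al + 1)}) ?_).trans
      (add_le_add (P1_iter hp hβ.le hok.2.1 a b c d m x (al + 1))
        (CUT hp hβ hδ0.le (by linarith) hE.le R x al h (m ^ 2) halh))
    intro η hη
    by_cases hD : η ∈ DD (m ^ 2) x (al + 1)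
    · left; exact_mod_cast hD
    · right; exact ⟨hη, hD⟩
  have hfin1 : (((4 * R.card : ℕ) : ℝ≥0∞) * ((1 / 2) ^ m * 2)) ^ (al + 1) ≠ ∞ := by
    apply ENNReal.pow_ne_top
    apply ENNReal.mul_ne_top (ENNReal.natCast_ne_top _)
    exact ENNReal.mul_ne_top (ENNReal.pow_ne_top (by simp)) (by simp)
  have hfin2 : (((R.card + 1) ^ (m ^ 2) : ℕ) : ℝ≥0∞) *
        (ENNReal.ofReal (Real.exp (-((1 - δ) * β * (Estar p * ((h : ℝ) - al) ^ p)))) * KK (δ * β) ^ (m ^ 2)) ≠ ∞ :=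
    ENNReal.mul_ne_top (ENNReal.natCast_ne_top _) (ENNReal.mul_ne_top ENNReal.ofReal_ne_top (ENNReal.pow_ne_top hKlt.ne))
  refine (Pr_le_of hp hβ (ENNReal.add_ne_top.2 ⟨hfin1, hfin2⟩) hW).trans ?_
  rw [ENNReal.toReal_add hfin1 hfin2]
  simp only [ENNReal.toReal_mul, ENNReal.toReal_pow, ENNReal.toReal_natCast, ENNReal.toReal_ofReal (Real.exp_pos _).le,
    ENNReal.toReal_div, ENNReal.toReal_one, ENNReal.toReal_ofNat, Nat.cast_pow, ← hκ]
  push_cast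
  set Q := β * Estar p * X ^ p with hQ
  have hXp : 0 < X ^ p := by positivity
  have hQ0 : 0 < Q := by positivity
  have hl2 : (1:ℝ)/2 ≤ Real.log 2 := by have := Real.log_two_gt_d9; linarith
  have goal2 : Real.exp (-((1 - ε) * β * (Estar p * X ^ p))) =
      Real.exp (-((1 - ε) * Q) - Real.log 2) + Real.exp (-((1 - ε) * Q) - Real.log 2) := by
    rw [Real.exp_sub, Real.exp_log (by norm_num), add_halves]; congr 1; rw [hQ]; ring
  rw [goal2]
  apply add_le_add
  · -- first term
    have h8 : 4 * (R.card : ℝ) * ((1 / 2) ^ m * 2) ≤ Real.exp (-(X ^ r / 4)) := by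
      have e1 : (1 / 2 : ℝ) ^ m = Real.exp (-(m * Real.log 2)) := by
        rw [← mul_neg, Real.exp_nat_mul, Real.exp_neg, Real.exp_log (by norm_num), one_div]
      calc 4 * (R.card : ℝ) * ((1 / 2) ^ m * 2) ≤ 4 * X ^ 20 * ((1 / 2) ^ m * 2) := by gcongr
        _ = Real.exp (Real.log 8 + 20 * Real.log X) * Real.exp (-(m * Real.log 2)) := by
            rw [Real.exp_add, Real.exp_log (by norm_num), ← e1, show (20 : ℝ) * Real.log X = ((20 : ℕ) : ℝ) * Real.log X by norm_num,
              Real.exp_nat_mul, Real.exp_log hX0]; ring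
        _ ≤ _ := by
            rw [← Real.exp_add]; apply Real.exp_le_exp.2
            nlinarith
    calc (4 * (R.card : ℝ) * ((1 / 2) ^ m * 2)) ^ (al + 1) ≤ Real.exp (-(X ^ r / 4)) ^ (al + 1) := by gcongr
      _ = Real.exp (-((al + 1) * (X ^ r / 4))) := by
          rw [← Real.exp_nat_mul]; congr 1; push_cast; ring
      _ ≤ _ := by
          apply Real.exp_le_exp.2
          have : δ * X * (X ^ r / 4) ≤ (al + 1) * (X ^ r / 4) := by gcongr
          have h9 : (1 - ε) * Q ≤ Q := by nlinarith
          have h10 : Q = β * Estar p * X ^ p := hQ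
          linarith
  · have hR1 : (R.card : ℝ) + 1 ≤ Real.exp (Real.log 2 + 20 * Real.log X) := by
      rw [Real.exp_add, Real.exp_log (by norm_num), show (20 : ℝ) * Real.log X = ((20 : ℕ) : ℝ) * Real.log X by norm_num,
        Real.exp_nat_mul, Real.exp_log hX0]
      have : 1 ≤ X ^ 20 := one_le_pow₀ hx1
      linarith
    have hκe : κ = Real.exp (Real.log κ) := (Real.exp_log (by linarith)).symm
    have hsub : (1 - δ) * X ≤ X - al := by linarith
    have hpow : (1 - δ) ^ 2 * X ^ p ≤ (X - al) ^ p := by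
      refine le_trans ?_ (Real.rpow_le_rpow (mul_nonneg (by linarith) hX0.le) hsub (by linarith))
      rw [Real.mul_rpow (by linarith) hX0.le]
      gcongr
      rw [← Real.rpow_natCast]
      exact Real.rpow_le_rpow_of_exponent_ge (by linarith) (by linarith) (by push_cast; linarith)
    calc ((R.card : ℝ) + 1) ^ (m ^ 2) * (Real.exp (-((1 - δ) * β * (Estar p * (X - al) ^ p))) * κ ^ (m ^ 2))
        ≤ Real.exp (Real.log 2 + 20 * Real.log X) ^ (m ^ 2) *
          (Real.exp (-((1 - δ) * β * (Estar p * ((1 - δ) ^ 2 * X ^ p)))) * Real.exp (Real.log κ) ^ (m ^ 2)) := by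
          rw [← hκe]
          have h5 : 0 ≤ (1 - δ) * β := mul_nonneg (by linarith) hβ.le
          have h6 := pow_le_pow_left₀ (add_nonneg (Nat.cast_nonneg _) zero_le_one) hR1 (m ^ 2)
          have h7 := mul_le_mul_of_nonneg_left (mul_le_mul_of_nonneg_left hpow hE.le) h5
          have hκp : 0 ≤ κ ^ (m ^ 2) := pow_nonneg (by linarith) _
          exact mul_le_mul h6 (mul_le_mul_of_nonneg_right (Real.exp_le_exp.2 (neg_le_neg h7)) hκp)
            (mul_nonneg (Real.exp_pos _).le hκp) (pow_nonneg (Real.exp_pos _).le _)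
      _ = Real.exp (((m ^ 2 : ℕ) : ℝ) * (Real.log 2 + 20 * Real.log X + Real.log κ) +
            -((1 - δ) * β * (Estar p * ((1 - δ) ^ 2 * X ^ p)))) := exp_help _ _ _ _
      _ ≤ _ := by
          apply Real.exp_le_exp.2
          have e : X ^ (2 * r) = (X ^ r) ^ 2 := by
            rw [← Real.rpow_natCast, ← Real.rpow_mul hX0.le, mul_comm]; rfl
          refine ld_real (Y := X ^ r) (δ := δ) hm2 ?_ hQ0.le (by rw [hδ]; ring) hδ0.le (by linarith) ?_ (by rw [hQ]; ring)
          · have := Real.log_nonneg hκ1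
            have := Real.log_nonneg hx1
            linarith
          · rw [← e]
            have h16 : ε / 4 * (β * Estar p) * X ^ p = ε / 4 * Q := by rw [hQ]; ring
            have h17 : Real.log 2 + 20 * Real.log X + Real.log κ = Real.log 2 + Real.log κ + 20 * Real.log X := by ring
            rw [h17, ← h16]; exact F3
end PS

namespace PS
open scoped ENNReal

open scoped FinsetFamily in
lemma fourE {α : Type*} [DistribLattice α] (f1 f2 f3 f4 : α → NNReal)
    (h : ∀ a b, f1 a * f2 b ≤ f3 (a ⊓ b) * f4 (a ⊔ b)) :
    (∑' a, (f1 a : ℝ≥0∞)) * (∑' a, (f2 a : ℝ≥0∞)) ≤ (∑' a, (f3 a : ℝ≥0∞)) * (∑' a, (f4 a : ℝ≥0∞)) := by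
  rw [ENNReal.tsum_eq_iSup_sum (f := fun a => (f1 a : ℝ≥0∞)), ENNReal.iSup_mul]
  refine iSup_le (fun s => ?_)
  rw [ENNReal.tsum_eq_iSup_sum (f := fun a => (f2 a : ℝ≥0∞)), ENNReal.mul_iSup]
  refine iSup_le (fun t => ?_)
  have := four_functions_theorem f1 f2 f3 f4 (fun _ => zero_le) (fun _ => zero_le) (fun _ => zero_le)
    (fun _ => zero_le) h s t
  refine le_trans ?_ (mul_le_mul' (ENNReal.sum_le_tsum (HasInfs.infs s t)) (ENNReal.sum_le_tsum (HasSups.sups s t)))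
  exact_mod_cast this

lemma cvx0 {p : ℝ} (hp : 1 ≤ p) {A B t : ℝ} (h0 : 0 ≤ t) (h1 : t ≤ 1) :
    |t * A + (1 - t) * B| ^ p ≤ t * |A| ^ p + (1 - t) * |B| ^ p := by
  have h2 := (convexOn_rpow hp).2 (abs_nonneg A : |A| ∈ Set.Ici 0) (abs_nonneg B : |B| ∈ Set.Ici 0) h0
    (show 0 ≤ 1 - t by linarith) (by ring)
  simp only [smul_eq_mul] at h2
  refine le_trans (Real.rpow_le_rpow (abs_nonneg _) ?_ (by linarith)) h2
  refine (abs_add_le _ _).trans ?_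
  rw [abs_mul, abs_mul, abs_of_nonneg h0, abs_of_nonneg (show 0 ≤ 1 - t by linarith)]

lemma cvx1 {p : ℝ} (hp : 1 ≤ p) {A B C D : ℝ} (hs : C + D = A + B) (hAC : A ≤ C) (hCB : C ≤ B) :
    |C| ^ p + |D| ^ p ≤ |A| ^ p + |B| ^ p := by
  rcases eq_or_lt_of_le (hAC.trans hCB) with h | h
  · have : C = A := by linarith
    have : D = B := by linarith
    subst C D; rfl
  · have hBA : 0 < B - A := by linarith
    set t := (B - C) / (B - A) with ht
    have h0 : 0 ≤ t := div_nonneg (by linarith) hBA.le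
    have h1 : t ≤ 1 := by rw [ht, div_le_one hBA]; linarith
    have hC : C = t * A + (1 - t) * B := by rw [ht]; field_simp; ring
    have hD : D = (1 - t) * A + (1 - (1 - t)) * B := by
      have : D = A + B - C := by linarith
      rw [this, hC]; ring
    have e1 := cvx0 hp (A := A) (B := B) h0 h1
    have e2 := cvx0 hp (A := A) (B := B) (t := 1 - t) (by linarith) (by linarith)
    rw [← hC] at e1; rw [← hD] at e2
    linarith

lemma cvx {p : ℝ} (hp : 1 ≤ p) {A B C D : ℝ} (hs : C + D = A + B)
    (h : (A ≤ C ∧ C ≤ B) ∨ (B ≤ C ∧ C ≤ A)) :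
    |C| ^ p + |D| ^ p ≤ |A| ^ p + |B| ^ p := by
  rcases h with h | h
  · exact cvx1 hp hs h.1 h.2
  · rw [add_comm (|A| ^ p)]; exact cvx1 hp (by linarith) h.1 h.2

lemma HH_pair {p : ℝ} (hp : 1 ≤ p) {a b c d : Site → ℤ} (ha : FS a) (hb : FS b) (hc : FS c) (hd : FS d)
    (h : ∀ e, |((dd c e : ℤ) : ℝ)| ^ p + |((dd d e : ℤ) : ℝ)| ^ p ≤ |((dd a e : ℤ) : ℝ)| ^ p + |((dd b e : ℤ) : ℝ)| ^ p) :
    HH p c + HH p d ≤ HH p a + HH p b := by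
  have hp0 : 0 < p := by linarith
  unfold HH HR
  rw [← Summable.tsum_add (HR_summable hp0 (FS_ic hc)) (HR_summable hp0 (FS_ic hd)),
    ← Summable.tsum_add (HR_summable hp0 (FS_ic ha)) (HR_summable hp0 (FS_ic hb))]
  refine Summable.tsum_le_tsum (fun e => ?_) ((HR_summable hp0 (FS_ic hc)).add (HR_summable hp0 (FS_ic hd)))
    ((HR_summable hp0 (FS_ic ha)).add (HR_summable hp0 (FS_ic hb)))
  simp only [dd_ic]; exact h e

lemma wt_pair {p β : ℝ} (hβ : 0 ≤ β) {R1 R2 R3 R4 : Finset Site} {a b c d : Site → ℤ}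
    (ha : ∀ x ∉ R1, a x = 0) (hb : ∀ x ∉ R2, b x = 0) (hc : ∀ x ∉ R3, c x = 0) (hd : ∀ x ∉ R4, d x = 0)
    (h : HH p c + HH p d ≤ HH p a + HH p b) : wt p β R1 a * wt p β R2 b ≤ wt p β R3 c * wt p β R4 d := by
  rw [wt_pos ha, wt_pos hb, wt_pos hc, wt_pos hd, ← ENNReal.ofReal_mul (Real.exp_pos _).le,
    ← ENNReal.ofReal_mul (Real.exp_pos _).le, ← Real.exp_add, ← Real.exp_add]
  apply ENNReal.ofReal_le_ofReal
  apply Real.exp_le_exp.2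
  nlinarith

lemma wt_ne_top (p β : ℝ) (R : Finset Site) (η : Site → ℤ) : wt p β R η ≠ ∞ := by
  unfold wt; split_ifs <;> simp

def tau (R : Finset Site) : Site → ℤ := fun z => if z ∈ R then 1 else 0

lemma tau_int (τu τv au av bu bv : ℤ) (hu : (τu = 0 ∧ au = 0 ∧ bu = 0) ∨ τu = 1)
    (hv : (τv = 0 ∧ av = 0 ∧ bv = 0) ∨ τv = 1) :
    ((av + τv - (au + τu) ≤ min av bv + τv - (min au bu + τu) ∧ min av bv + τv - (min au bu + τu) ≤ bv - bu) ∨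
     (bv - bu ≤ min av bv + τv - (min au bu + τu) ∧ min av bv + τv - (min au bu + τu) ≤ av + τv - (au + τu))) := by
  rcases min_cases au bu with ⟨h1, _⟩ | ⟨h1, _⟩ <;> rcases min_cases av bv with ⟨h2, _⟩ | ⟨h2, _⟩ <;>
    rw [h1, h2] <;> omega

lemma LC {p β : ℝ} (hp : 1 ≤ p) (hβ : 0 ≤ β) (R : Finset Site) {x : Site} (hx : x ∈ R) (j : ℤ) :
    W p β R {η | j + 1 ≤ η x} * W p β R {η | j - 1 ≤ η x} ≤ W p β R {η | j ≤ η x} * W p β R {η | j ≤ η x} := by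
  set τ := tau R with hτ
  have hτx : τ x = 1 := by simp [hτ, tau, hx]
  have hτ0 : ∀ z ∉ R, τ z = 0 := fun z hz => by simp [hτ, tau, hz]
  let F : Set (Site → ℤ) → (Site → ℤ) → NNReal := fun A η => (A.indicator (wt p β R) η).toNNReal
  have hF : ∀ A η, (F A η : ℝ≥0∞) = A.indicator (wt p β R) η := by
    intro A η
    apply ENNReal.coe_toNNReal
    by_cases h : η ∈ A
    · rw [Set.indicator_of_mem h]; exact wt_ne_top _ _ _ _
    · rw [Set.indicator_of_notMem h]; simp
  have hsh : ∀ A, W p β R A = ∑' η, (F A (η + τ) : ℝ≥0∞) := by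
    intro A
    simp only [hF]
    exact ((Equiv.addRight τ).tsum_eq _).symm
  have hst : ∀ A, W p β R A = ∑' η, (F A η : ℝ≥0∞) := by
    intro A; simp only [hF]; rfl
  rw [hsh {η | j + 1 ≤ η x}, hst {η | j - 1 ≤ η x}]
  nth_rewrite 1 [hsh {η | j ≤ η x}]
  rw [hst {η | j ≤ η x}]
  apply fourE (fun η => F {η | j + 1 ≤ η x} (η + τ)) (F {η | j - 1 ≤ η x}) (fun η => F {η | j ≤ η x} (η + τ))
  intro a b
  rw [← ENNReal.coe_le_coe, ENNReal.coe_mul, ENNReal.coe_mul, hF, hF, hF, hF]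
  by_cases h1 : (a + τ) ∈ {η : Site → ℤ | j + 1 ≤ η x}
  swap
  · rw [Set.indicator_of_notMem h1, zero_mul]; exact zero_le
  by_cases h2 : b ∈ {η : Site → ℤ | j - 1 ≤ η x}
  swap
  · rw [Set.indicator_of_notMem h2, mul_zero]; exact zero_le
  have h1' : j + 1 ≤ a x + τ x := h1
  have h2' : j - 1 ≤ b x := h2
  rw [Set.indicator_of_mem h1, Set.indicator_of_mem h2, Set.indicator_of_mem, Set.indicator_of_mem]
  rotate_left
  · change j ≤ max (a x) (b x); rw [le_max_iff]; left; omega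
  · change j ≤ min (a x) (b x) + τ x
    have : j - 1 ≤ min (a x) (b x) := le_min (by omega) h2'
    omega
  by_cases ha : ∀ z ∉ R, (a + τ) z = 0
  swap
  · rw [wt_zero ha, zero_mul]; exact zero_le
  by_cases hb : ∀ z ∉ R, b z = 0
  swap
  · rw [wt_zero hb, mul_zero]; exact zero_le
  have ha' : ∀ z ∉ R, a z = 0 := by
    intro z hz
    have h3 : a z + τ z = 0 := ha z hz
    rw [hτ0 z hz] at h3; omega
  have hc : ∀ z ∉ R, (a ⊓ b + τ) z = 0 := by
    intro z hz
    change min (a z) (b z) + τ z = 0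
    rw [ha' z hz, hb z hz, hτ0 z hz]; simp
  have hd : ∀ z ∉ R, (a ⊔ b) z = 0 := by
    intro z hz
    change max (a z) (b z) = 0
    rw [ha' z hz, hb z hz]; simp
  refine wt_pair hβ ha hb hc hd (HH_pair hp (FS_of_zero ha) (FS_of_zero hb) (FS_of_zero hc) (FS_of_zero hd) ?_)
  intro e
  have key : ∀ z, (τ z = 0 ∧ a z = 0 ∧ b z = 0) ∨ τ z = 1 := by
    intro z
    by_cases hz : z ∈ R
    · right; simp [hτ, tau, hz]
    · left; exact ⟨hτ0 z hz, ha' z hz, hb z hz⟩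
  have hi := tau_int _ _ _ _ _ _ (key e.1) (key (tgt e))
  apply cvx hp
  · have : dd (a ⊓ b + τ) e + dd (a ⊔ b) e = dd (a + τ) e + dd b e := by
      change (min (a (tgt e)) (b (tgt e)) + τ (tgt e) - (min (a e.1) (b e.1) + τ e.1)) +
        (max (a (tgt e)) (b (tgt e)) - max (a e.1) (b e.1)) = (a (tgt e) + τ (tgt e) - (a e.1 + τ e.1)) + (b (tgt e) - b e.1)
      have := min_add_max (a (tgt e)) (b (tgt e))
      have := min_add_max (a e.1) (b e.1)
      omega
    exact_mod_cast this
  · exact_mod_cast hi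

end PS

namespace PS
open scoped ENNReal

lemma CC_cover {A : Set Site} {y z : Site} (π : Site → ℤ) (hπ : ∀ u v, adjP u v → |π u - π v| ≤ 1)
    (h : z ∈ CC A y) : ∀ k, (π y ≤ k ∧ k ≤ π z) ∨ (π z ≤ k ∧ k ≤ π y) → ∃ u ∈ CC A y, π u = k := by
  induction h with
  | refl => intro k hk; exact ⟨y, Relation.ReflTransGen.refl, by omega⟩
  | @tail b c h1 h2 ih =>
    intro k hk
    have h3 := abs_le.1 (hπ b c h2.1)
    by_cases hc : π c = k
    · exact ⟨c, Relation.ReflTransGen.tail h1 h2, hc⟩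
    · exact ih k (by omega)

lemma CC_card {A : Set Site} {y z : Site} (π : Site → ℤ) (hπ : ∀ u v, adjP u v → |π u - π v| ≤ 1)
    (h : z ∈ CC A y) {n : ℕ} (hn : (n : ℤ) ≤ |π z - π y|) :
    ∃ C : Finset Site, n ≤ C.card ∧ (C : Set Site) ⊆ CC A y := by
  have hc := CC_cover π hπ h
  choose! g hg using hc
  have hinj : Set.InjOn g (Finset.uIcc (π y) (π z) : Finset ℤ) := by
    intro a ha b hb hab
    rw [Finset.mem_coe, Finset.mem_uIcc'] at ha hb
    rw [← (hg a ha).2, ← (hg b hb).2, hab]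
  refine ⟨(Finset.uIcc (π y) (π z)).image g, ?_, ?_⟩
  · rw [Finset.card_image_of_injOn hinj, Int.card_uIcc]
    rw [Int.abs_eq_natAbs] at hn
    omega
  · intro u hu
    rw [Finset.mem_coe, Finset.mem_image] at hu
    obtain ⟨k, hk, rfl⟩ := hu
    rw [Finset.mem_uIcc'] at hk
    exact (hg k hk).1

lemma adj1 (u v : Site) (h : adjP u v) : |u.1 - v.1| ≤ 1 := by
  unfold adjP at h; have := abs_nonneg (u.2 - v.2); omega
lemma adj2 (u v : Site) (h : adjP u v) : |u.2 - v.2| ≤ 1 := by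
  unfold adjP at h; have := abs_nonneg (u.1 - v.1); omega

def DS (F : Site → ℤ × ℤ) : Set Site := {z | (F z).1 ≠ (F z).2}
def CF (y : Site) (F : Site → ℤ × ℤ) : Set Site := {z | y ∈ DS F ∧ z ∈ CC (DS F) y}
def sw (y : Site) (F : Site → ℤ × ℤ) : Site → ℤ × ℤ := fun z => if z ∈ CF y F then (F z).swap else F z

lemma DS_sw (y : Site) (F : Site → ℤ × ℤ) : DS (sw y F) = DS F := by
  ext z
  change ((sw y F z).1 ≠ (sw y F z).2) ↔ ((F z).1 ≠ (F z).2)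
  unfold sw
  split_ifs
  · exact ne_comm
  · rfl

lemma CF_sw (y : Site) (F : Site → ℤ × ℤ) : CF y (sw y F) = CF y F := by
  unfold CF; rw [DS_sw]

lemma sw_sw (y : Site) (F : Site → ℤ × ℤ) : sw y (sw y F) = F := by
  funext z
  change (if z ∈ CF y (sw y F) then (sw y F z).swap else sw y F z) = F z
  rw [CF_sw]
  unfold sw
  split_ifs <;> simp

lemma CF_bd {y : Site} {F : Site → ℤ × ℤ} {u v : Site} (huv : adjP u v) (hu : u ∈ CF y F) (hv : v ∉ CF y F) :
    (F v).1 = (F v).2 := by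
  by_contra h
  exact hv ⟨hu.1, Relation.ReflTransGen.tail hu.2 ⟨huv, h⟩⟩

lemma tsum_w2_ind (p β : ℝ) (R1 R2 : Finset Site) (A B : Set (Site → ℤ)) :
    ∑' F, {F : Site → ℤ × ℤ | (fun z => (F z).1) ∈ A ∧ (fun z => (F z).2) ∈ B}.indicator (w2 p β R1 R2) F
      = W p β R1 A * W p β R2 B := by
  have := tsum_w2 (fun η η' => A.indicator (wt p β R1) η * B.indicator (wt p β R2) η')
  simp_rw [ENNReal.tsum_mul_left, ENNReal.tsum_mul_right] at this
  rw [W, W, ← this]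
  congr 1; funext F
  by_cases hA : (fun z => (F z).1) ∈ A
  · by_cases hB : (fun z => (F z).2) ∈ B
    · rw [Set.indicator_of_mem (by exact ⟨hA, hB⟩), Set.indicator_of_mem hA, Set.indicator_of_mem hB, w2]
    · rw [Set.indicator_of_notMem (by exact fun h => hB h.2), Set.indicator_of_notMem hB, mul_zero]
  · rw [Set.indicator_of_notMem (by exact fun h => hA h.1), Set.indicator_of_notMem hA, zero_mul]

lemma w2_sw {p β : ℝ} (hp : 1 ≤ p) (hβ : 0 ≤ β) {R1 R2 U : Finset Site} (hU1 : U ⊆ R1) (hU2 : U ⊆ R2)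
    {y : Site} {F : Site → ℤ × ℤ} (h1 : ∀ x ∉ R1, (F x).1 = 0) (h2 : ∀ x ∉ R2, (F x).2 = 0)
    (hC : CF y F ⊆ (U : Set Site)) : w2 p β R1 R2 F ≤ w2 p β R1 R2 (sw y F) := by
  have h1' : ∀ x ∉ R1, (sw y F x).1 = 0 := by
    intro x hx
    have : x ∉ CF y F := fun h => hx (hU1 (hC h))
    simp only [sw, if_neg this]; exact h1 x hx
  have h2' : ∀ x ∉ R2, (sw y F x).2 = 0 := by
    intro x hx
    have : x ∉ CF y F := fun h => hx (hU2 (hC h))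
    simp only [sw, if_neg this]; exact h2 x hx
  refine wt_pair hβ h1 h2 h1' h2' (HH_pair hp (FS_of_zero h1) (FS_of_zero h2) (FS_of_zero h1') (FS_of_zero h2') ?_)
  intro e
  apply le_of_eq
  have ha := adjP_tgt e
  by_cases hu : e.1 ∈ CF y F <;> by_cases hv : tgt e ∈ CF y F
  · simp only [dd, sw, if_pos hu, if_pos hv, Prod.fst_swap, Prod.snd_swap]; ring
  · have := CF_bd ha hu hv
    simp only [dd, sw, if_pos hu, if_neg hv, Prod.fst_swap, Prod.snd_swap, this]; ring
  · have := CF_bd (adjP_symm ha) hv hu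
    simp only [dd, sw, if_neg hu, if_pos hv, Prod.fst_swap, Prod.snd_swap, this]; ring
  · simp only [dd, sw, if_neg hu, if_neg hv]

lemma SW {p β : ℝ} (hp : 1 ≤ p) (hβ : 0 ≤ β) {R1 R2 U : Finset Site} (hU1 : U ⊆ R1) (hU2 : U ⊆ R2)
    (y : Site) (n : ℕ) (hn : ∀ z ∈ R1 ∪ R2, z ∉ U → (n : ℤ) ≤ |z.1 - y.1| ∨ (n : ℤ) ≤ |z.2 - y.2|)
    (G : Set (Site → ℤ)) (hG : ∀ η ξ : Site → ℤ, (∀ z ∉ U, η z = ξ z) → η ∈ G → ξ ∈ G) (Hs : Set ℤ) :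
    W p β R1 {η | η ∈ G ∧ η y ∈ Hs} * W p β R2 Set.univ ≤
      W p β R1 G * W p β R2 {η | η y ∈ Hs} + ∑' F, (BAD n).indicator (w2 p β R1 R2) F := by
  rw [← tsum_w2_ind, ← tsum_w2_ind]
  let S : Set (Site → ℤ × ℤ) := {F | ((fun z => (F z).1) ∈ G ∧ (F y).1 ∈ Hs) ∧
    (∀ x ∉ R1, (F x).1 = 0) ∧ (∀ x ∉ R2, (F x).2 = 0) ∧ CF y F ⊆ (U : Set Site)}
  have hS := tsum_inj S (w2 p β R1 R2)
    ({F : Site → ℤ × ℤ | (fun z => (F z).1) ∈ G ∧ (fun z => (F z).2) ∈ {η : Site → ℤ | η y ∈ Hs}}.indicator (w2 p β R1 R2))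
    (sw y) (fun a _ b _ hab => by rw [← sw_sw y a, hab, sw_sw]) ?_
  · refine le_trans ?_ (add_le_add_left hS _)
    rw [← ENNReal.tsum_add]
    refine ENNReal.tsum_le_tsum (fun F => ?_)
    by_cases hF : F ∈ {F : Site → ℤ × ℤ | (fun z => (F z).1) ∈ {η | η ∈ G ∧ η y ∈ Hs} ∧ (fun z => (F z).2) ∈ Set.univ}
    swap
    · rw [Set.indicator_of_notMem hF]; exact zero_le
    rw [Set.indicator_of_mem hF]
    by_cases h1 : ∀ x ∉ R1, (F x).1 = 0
    swap
    · rw [w2, wt_zero h1, zero_mul]; exact zero_le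
    by_cases h2 : ∀ x ∉ R2, (F x).2 = 0
    swap
    · rw [w2, wt_zero h2, mul_zero]; exact zero_le
    by_cases hC : CF y F ⊆ (U : Set Site)
    · rw [Set.indicator_of_mem (show F ∈ S from ⟨hF.1, h1, h2, hC⟩)]; exact le_self_add
    · have hB : F ∈ BAD n := by
        rw [Set.not_subset] at hC
        obtain ⟨z, hz, hzU⟩ := hC
        have hsub : DS F ⊆ {z | F z ≠ 0} := by
          intro w hw h0
          apply hw; rw [h0]; rfl
        have hzR : z ∈ R1 ∪ R2 := by
          by_contra hcon
          rw [Finset.mem_union, not_or] at hcon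
          exact (CC_sub hz.1 hz.2) (by rw [h1 z hcon.1, h2 z hcon.2])
        have hz3 := CC_mono hsub y hz.2
        refine ⟨y, hsub hz.1, ?_⟩
        rcases hn z hzR hzU with h | h
        · exact CC_card Prod.fst adj1 hz3 h
        · exact CC_card Prod.snd adj2 hz3 h
      rw [Set.indicator_of_mem hB]; exact le_add_self
  · rintro F ⟨⟨hFG, hFy⟩, h1, h2, hC⟩
    rw [Set.indicator_of_mem]
    · exact w2_sw hp hβ hU1 hU2 h1 h2 hC
    · refine ⟨hG _ _ ?_ hFG, ?_⟩
      · intro z hz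
        have : z ∉ CF y F := fun h => hz (hC h)
        simp only [sw, if_neg this]
      · change (sw y F y).2 ∈ Hs
        by_cases hy : y ∈ CF y F
        · simp only [sw, if_pos hy]; exact hFy
        · have : (F y).1 = (F y).2 := by
            by_contra h; exact hy ⟨h, Relation.ReflTransGen.refl⟩
          simp only [sw, if_neg hy]; rw [← this]; exact hFy

end PS

namespace PS
open scoped ENNReal

section
variable {p β : ℝ} (hp : 1 ≤ p) (hβ : 0 < β)

lemma pProb_eq (hp : 1 ≤ p) (R : Finset Site) (A : (Site → ℤ) → Prop) :
    pProb p β R A = Pr p β R {η | A η} := by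
  unfold pProb Pr
  rw [pW_eq (by linarith), pW_eq (by linarith), Set.ofPred_true]

lemma Pr_univ (hp : 1 ≤ p) (hβ : 0 < β) (R : Finset Site) : Pr p β R Set.univ = 1 :=
  div_self (Z_pos hp hβ R).ne'

lemma Pr_le_one (hp : 1 ≤ p) (hβ : 0 < β) (R : Finset Site) (A) : Pr p β R A ≤ 1 := by
  rw [← Pr_univ hp hβ R]; exact Pr_mono hp hβ (Set.subset_univ _)

lemma Pr_union (hp : 1 ≤ p) (hβ : 0 < β) {R : Finset Site} {A B C : Set (Site → ℤ)} (h : A ⊆ B ∪ C) :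
    Pr p β R A ≤ Pr p β R B + Pr p β R C := by
  unfold Pr
  rw [← add_div, ← ENNReal.toReal_add (W_lt hp hβ R _).ne (W_lt hp hβ R _).ne]
  exact div_le_div_of_nonneg_right (ENNReal.toReal_mono
    (ENNReal.add_ne_top.2 ⟨(W_lt hp hβ R _).ne, (W_lt hp hβ R _).ne⟩) (W_union h)) ENNReal.toReal_nonneg

lemma Pr_biUnion (hp : 1 ≤ p) (hβ : 0 < β) {R : Finset Site} {ι : Type*} (s : Finset ι) {A : Set (Site → ℤ)}
    {B : ι → Set (Site → ℤ)} (h : ∀ η ∈ A, ∃ i ∈ s, η ∈ B i) :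
    Pr p β R A ≤ ∑ i ∈ s, Pr p β R (B i) := by
  unfold Pr
  rw [← Finset.sum_div, ← ENNReal.toReal_sum (fun i _ => (W_lt hp hβ R _).ne)]
  exact div_le_div_of_nonneg_right (ENNReal.toReal_mono
    (ENNReal.sum_ne_top.2 (fun i _ => (W_lt hp hβ R _).ne)) (W_biUnion s h)) ENNReal.toReal_nonneg

lemma Pr_neg (R : Finset Site) (x : Site) (k : ℤ) :
    Pr p β R {η | η x ≤ -k} = Pr p β R {η | k ≤ η x} := by
  unfold Pr
  rw [← W_neg p β R {η | k ≤ η x}]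
  have : {η : Site → ℤ | η x ≤ -k} = {η : Site → ℤ | -η ∈ {η : Site → ℤ | k ≤ η x}} := by
    ext η
    change η x ≤ -k ↔ k ≤ - η x
    omega
  rw [this]

def qq (p β : ℝ) (R : Finset Site) (η : Site → ℤ) : ℝ := (wt p β R η).toReal / (W p β R Set.univ).toReal

lemma qq_nonneg (R : Finset Site) (η : Site → ℤ) : 0 ≤ qq p β R η := by unfold qq; positivity

lemma Pr_hasSum (hp : 1 ≤ p) (hβ : 0 < β) (R : Finset Site) (A : Set (Site → ℤ)) :
    HasSum (fun η => qq p β R η * A.indicator (fun _ => (1 : ℝ)) η) (Pr p β R A) := by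
  have h := (ENNReal.hasSum_toReal (W_lt hp hβ R A).ne).div_const (W p β R Set.univ).toReal
  have e : (fun η => qq p β R η * A.indicator (fun _ => (1 : ℝ)) η) =
      fun η => (A.indicator (wt p β R) η).toReal / (W p β R Set.univ).toReal := by
    funext η
    by_cases hA : η ∈ A
    · rw [Set.indicator_of_mem hA, Set.indicator_of_mem hA, mul_one]; rfl
    · rw [Set.indicator_of_notMem hA, Set.indicator_of_notMem hA]; simp
  have e2 : (W p β R A).toReal = ∑' η, (A.indicator (wt p β R) η).toReal :=
    ENNReal.tsum_toReal_eq (ENNReal.ne_top_of_tsum_ne_top (W_lt hp hβ R A).ne)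
  rw [e, Pr, e2]
  exact h

lemma second_moment (hp : 1 ≤ p) (hβ : 0 < β) (R S : Finset Site) (A : Site → Set (Site → ℤ)) (μ err : ℝ)
    (hμ : μ = ∑ x ∈ S, Pr p β R (A x)) (herr : 0 ≤ err)
    (h2 : ∀ x ∈ S, ∀ y ∈ S, x ≠ y → Pr p β R {η | η ∈ A x ∧ η ∈ A y} ≤ Pr p β R (A x) * Pr p β R (A y) + err) :
    Pr p β R {η | ∀ x ∈ S, η ∉ A x} * μ ^ 2 ≤ μ + (S.card : ℝ) ^ 2 * err := by
  have hμ0 : 0 ≤ μ := by rw [hμ]; exact Finset.sum_nonneg (fun _ _ => Pr_nonneg _ _ _ _)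
  set Z : Set (Site → ℤ) := {η | ∀ x ∈ S, η ∉ A x} with hZ
  have H1 := ((Pr_hasSum hp hβ R Z).mul_left (μ ^ 2)).add
    ((hasSum_sum (fun x (_ : x ∈ S) => Pr_hasSum hp hβ R (A x))).mul_left (2 * μ))
  have H2 := (hasSum_sum (fun x (_ : x ∈ S) => hasSum_sum (fun y (_ : y ∈ S) =>
    Pr_hasSum hp hβ R {η | η ∈ A x ∧ η ∈ A y}))).add ((Pr_hasSum hp hβ R Set.univ).mul_left (μ ^ 2))
  have hle := hasSum_le (fun η => ?_) H1 H2
  · rw [← hμ, Pr_univ hp hβ] at hle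
    have hb : ∑ x ∈ S, ∑ y ∈ S, Pr p β R {η | η ∈ A x ∧ η ∈ A y} ≤ μ + μ * μ + (S.card : ℝ) ^ 2 * err := by
      have h3 : ∀ x ∈ S, ∀ y ∈ S, Pr p β R {η | η ∈ A x ∧ η ∈ A y} ≤
          (if x = y then Pr p β R (A x) else 0) + Pr p β R (A x) * Pr p β R (A y) + err := by
        intro x hx y hy
        split_ifs with hxy
        · subst hxy
          have : {η | η ∈ A x ∧ η ∈ A x} = A x := by ext η; exact and_self_iff
          rw [this]
          have := Pr_nonneg p β R (A x)
          nlinarith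
        · rw [zero_add]; exact h2 x hx y hy hxy
      refine (Finset.sum_le_sum fun x hx => Finset.sum_le_sum fun y hy => h3 x hx y hy).trans ?_
      simp only [Finset.sum_add_distrib, Finset.sum_const, ← Finset.mul_sum, ← Finset.sum_mul, ← hμ, nsmul_eq_mul]
      have : ∑ x ∈ S, ∑ y ∈ S, (if x = y then Pr p β R (A x) else 0) = μ := by
        rw [hμ]
        refine Finset.sum_congr rfl (fun x hx => ?_)
        rw [Finset.sum_ite_eq, if_pos hx]
      rw [this]
      apply le_of_eq; ring
    nlinarith
  · have e1 : ∀ x : Site, qq p β R η * (A x).indicator (fun _ => (1 : ℝ)) η =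
      (A x).indicator (fun _ => (1 : ℝ)) η * qq p β R η := fun x => mul_comm _ _
    have e2 : ∀ x y : Site, qq p β R η * {η | η ∈ A x ∧ η ∈ A y}.indicator (fun _ => (1 : ℝ)) η =
      ((A x).indicator (fun _ => (1 : ℝ)) η * (A y).indicator (fun _ => (1 : ℝ)) η) * qq p β R η := by
      intro x y
      rw [mul_comm]; congr 1
      by_cases hx : η ∈ A x
      · by_cases hy : η ∈ A y
        · rw [Set.indicator_of_mem (by exact ⟨hx, hy⟩), Set.indicator_of_mem hx, Set.indicator_of_mem hy, mul_one]
        · rw [Set.indicator_of_notMem (by exact fun h => hy h.2), Set.indicator_of_notMem hy, mul_zero]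
      · rw [Set.indicator_of_notMem (by exact fun h => hx h.1), Set.indicator_of_notMem hx, zero_mul]
    simp only [e1, e2]
    simp only [← Finset.sum_mul, ← Finset.mul_sum]
    set N := ∑ x ∈ S, (A x).indicator (fun _ => (1 : ℝ)) η with hN
    have hq := qq_nonneg (p := p) (β := β) R η
    rw [Set.indicator_of_mem (Set.mem_univ _)]
    by_cases hηZ : η ∈ Z
    · have : N = 0 := by
        rw [hN]
        exact Finset.sum_eq_zero (fun x hx => Set.indicator_of_notMem (hηZ x hx) _)
      rw [Set.indicator_of_mem hηZ, this]
      apply le_of_eq; ring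
    · rw [Set.indicator_of_notMem hηZ]
      nlinarith [mul_nonneg (sq_nonneg (N - μ)) hq]

lemma seq_lc (t : ℕ → ℝ) (hpos : ∀ n, 0 < t n) (h : ∀ n, t (n + 2) * t n ≤ t (n + 1) * t (n + 1)) :
    ∀ n, t (n + 1) ^ n * t 0 ≤ t n ^ (n + 1) := by
  intro n
  induction n with
  | zero => simp
  | succ n ih =>
    have h1 := pow_le_pow_left₀ (mul_nonneg (hpos _).le (hpos _).le) (h n) (n + 1)
    have h2 : 0 < t n ^ (n + 1) := pow_pos (hpos _) _
    refine le_of_mul_le_mul_right ?_ h2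
    calc t (n + 1 + 1) ^ (n + 1) * t 0 * t n ^ (n + 1) = (t (n + 2) * t n) ^ (n + 1) * t 0 := by rw [mul_pow]; ring
      _ ≤ (t (n + 1) * t (n + 1)) ^ (n + 1) * t 0 := mul_le_mul_of_nonneg_right h1 (hpos 0).le
      _ = t (n + 1) ^ (n + 1 + 1) * (t (n + 1) ^ n * t 0) := by ring
      _ ≤ _ := mul_le_mul_of_nonneg_left ih (pow_pos (hpos _) _).le

lemma Pr_ge_pos (hp : 1 ≤ p) (hβ : 0 < β) {R : Finset Site} {x : Site} (hx : x ∈ R) (n : ℕ) :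
    0 < Pr p β R {η | (n : ℤ) ≤ η x} := by
  refine div_pos (ENNReal.toReal_pos ?_ (W_lt hp hβ R _).ne) (Z_pos hp hβ R)
  apply ne_of_gt
  refine lt_of_lt_of_le ?_ (ENNReal.le_tsum (fun z => if z = x then (n : ℤ) else 0))
  rw [Set.indicator_of_mem (by simp), wt_pos]
  · simp [Real.exp_pos]
  · intro z hz
    rw [if_neg]; rintro rfl; exact hz hx

lemma half (hp : 1 ≤ p) (hβ : 0 < β) (R : Finset Site) (x : Site) : 1 / 2 ≤ Pr p β R {η | 0 ≤ η x} := by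
  have h1 : Pr p β R Set.univ ≤ Pr p β R {η | 0 ≤ η x} + Pr p β R {η | η x ≤ -0} := by
    apply Pr_union hp hβ
    intro η _
    rcases le_total 0 (η x) with h | h
    · left; exact h
    · right; change η x ≤ -0; omega
  rw [Pr_neg, Pr_univ hp hβ] at h1
  linarith

lemma LCP (hp : 1 ≤ p) (hβ : 0 < β) {R : Finset Site} {x : Site} (hx : x ∈ R) (n : ℕ) {q : ℝ} (hq : 0 ≤ q)
    (hn : n ≠ 0) (h : 2 * Pr p β R {η | (n : ℤ) ≤ η x} ≤ q ^ n) :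
    Pr p β R {η | ((n + 1 : ℕ) : ℤ) ≤ η x} ≤ q * Pr p β R {η | (n : ℤ) ≤ η x} := by
  set t : ℕ → ℝ := fun n => Pr p β R {η | (n : ℤ) ≤ η x} with ht
  have hpos : ∀ n, 0 < t n := fun n => Pr_ge_pos hp hβ hx n
  have hlc : ∀ n, t (n + 2) * t n ≤ t (n + 1) * t (n + 1) := by
    intro n
    have h1 := LC hp hβ.le R hx ((n + 1 : ℕ) : ℤ)
    have h2 := ENNReal.toReal_mono (ENNReal.mul_ne_top (W_lt hp hβ R _).ne (W_lt hp hβ R _).ne) h1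
    rw [ENNReal.toReal_mul, ENNReal.toReal_mul] at h2
    have e1 : (((n + 1 : ℕ) : ℤ) + 1) = ((n + 2 : ℕ) : ℤ) := by push_cast; ring
    have e2 : (((n + 1 : ℕ) : ℤ) - 1) = ((n : ℕ) : ℤ) := by push_cast; ring
    rw [e1, e2] at h2
    simp only [ht, Pr]
    rw [div_mul_div_comm, div_mul_div_comm]
    exact div_le_div_of_nonneg_right h2 (by positivity)
  have h0 : 1 / 2 ≤ t 0 := by have := half hp hβ R x; simpa [ht] using this
  have h3 := seq_lc t hpos hlc n
  change t (n + 1) ≤ q * t n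
  change 2 * t n ≤ q ^ n at h
  refine le_of_pow_le_pow_left₀ hn (mul_nonneg hq (hpos n).le) ?_
  rw [mul_pow]
  have h4 : t (n + 1) ^ n * (1 / 2) ≤ t (n + 1) ^ n * t 0 :=
    mul_le_mul_of_nonneg_left h0 (pow_pos (hpos _) _).le
  have h5 : t n ^ (n + 1) * 2 ≤ q ^ n * t n ^ n := by
    rw [pow_succ]
    have := mul_le_mul_of_nonneg_left h (pow_pos (hpos n) n).le
    linarith
  linarith

end

end PS

namespace PS
open scoped ENNReal

def er (L m : ℕ) : ℝ := 8 * (L : ℝ) ^ 2 * (1 / 2) ^ m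

lemma er_nonneg (L m : ℕ) : 0 ≤ er L m := by unfold er; positivity

lemma card_box (L : ℕ) : (box L).card = L ^ 2 := by
  unfold box; rw [Finset.card_product]; simp [sq]

lemma mem_box {L : ℕ} {z : Site} : z ∈ box L ↔ (1 ≤ z.1 ∧ z.1 ≤ L) ∧ (1 ≤ z.2 ∧ z.2 ≤ L) := by
  unfold box; rw [Finset.mem_product, Finset.mem_Icc, Finset.mem_Icc]

lemma mem_rect {a b c d : ℤ} {z : Site} : z ∈ rect a b c d ↔ (a ≤ z.1 ∧ z.1 ≤ b) ∧ (c ≤ z.2 ∧ z.2 ≤ d) := by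
  unfold rect; rw [Finset.mem_product, Finset.mem_Icc, Finset.mem_Icc]

def Ub (L s : ℕ) (y : Site) : Finset Site :=
  rect (max 1 (y.1 - s)) (min L (y.1 + s)) (max 1 (y.2 - s)) (min L (y.2 + s))

lemma Ub_sub (L s : ℕ) (y : Site) : Ub L s y ⊆ box L := by
  intro z hz
  rw [Ub, mem_rect, max_le_iff, max_le_iff, le_min_iff, le_min_iff] at hz
  rw [mem_box]; exact ⟨⟨hz.1.1.1, hz.1.2.1⟩, ⟨hz.2.1.1, hz.2.2.1⟩⟩

lemma card_Ub (L s : ℕ) (y : Site) : (Ub L s y).card ≤ (2 * s + 1) ^ 2 := by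
  rw [Ub, rect, Finset.card_product, sq]
  apply Nat.mul_le_mul <;> rw [Int.card_Icc] <;> omega

lemma Ub_far {L s : ℕ} {y z : Site} (hz : z ∈ box L) (h : z ∉ Ub L s y) :
    (s : ℤ) ≤ |z.1 - y.1| ∨ (s : ℤ) ≤ |z.2 - y.2| := by
  rw [mem_box] at hz
  by_contra hcon
  rw [not_or, not_le, not_le, abs_lt, abs_lt] at hcon
  apply h
  rw [Ub, mem_rect, max_le_iff, max_le_iff, le_min_iff, le_min_iff]
  omega

lemma SWP {p β : ℝ} (hp : 1 ≤ p) (hok : okβ β) (L m : ℕ) (a b c d : ℤ) (hR : rect a b c d ⊆ box L) (y : Site)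
    (hU : Ub L (m ^ 2) y ⊆ rect a b c d) (G : Set (Site → ℤ))
    (hG : ∀ η ξ : Site → ℤ, (∀ z ∉ Ub L (m ^ 2) y, η z = ξ z) → η ∈ G → ξ ∈ G) (Hs : Set ℤ) :
    Pr p β (box L) {η | η ∈ G ∧ η y ∈ Hs} ≤
      Pr p β (box L) G * Pr p β (rect a b c d) {η | η y ∈ Hs} + er L m := by
  have hβ : 0 < β := by linarith [hok.1]
  set R := rect a b c d with hRdef
  have hun : box L ∪ R = box L := Finset.union_eq_left.2 hR
  have h1 := SW hp hβ.le (Ub_sub L (m ^ 2) y) hU y (m ^ 2) (by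
    intro z hz hzU
    rw [hun] at hz
    exact Ub_far hz hzU) G hG Hs
  have h2 := P2 hp hok.1 hok.2.2 1 L 1 L a b c d m
  have hbr : rect 1 L 1 L = box L := rfl
  rw [hbr, ← hRdef, hun, card_box] at h2
  have h3 := h1.trans (add_le_add_right h2 _)
  have hf : ∀ R A, W p β R A ≠ ∞ := fun R A => (W_lt hp hβ R A).ne
  have hk : ((4 * L ^ 2 : ℕ) : ℝ≥0∞) * ((1 / 2) ^ m * 2) ≠ ∞ :=
    ENNReal.mul_ne_top (ENNReal.natCast_ne_top _) (ENNReal.mul_ne_top (ENNReal.pow_ne_top (by simp)) (by simp))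
  have h4 := ENNReal.toReal_mono (ENNReal.add_ne_top.2 ⟨ENNReal.mul_ne_top (hf _ _) (hf _ _),
    ENNReal.mul_ne_top hk (ENNReal.mul_ne_top (hf _ _) (hf _ _))⟩) h3
  rw [ENNReal.toReal_add (ENNReal.mul_ne_top (hf _ _) (hf _ _)) (ENNReal.mul_ne_top hk (ENNReal.mul_ne_top (hf _ _) (hf _ _)))] at h4
  simp only [ENNReal.toReal_mul, ENNReal.toReal_pow, ENNReal.toReal_natCast,
    ENNReal.toReal_div, ENNReal.toReal_one, ENNReal.toReal_ofNat] at h4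
  have z1 := Z_pos hp hβ (box L)
  have z2 := Z_pos hp hβ R
  have e : ((4 * L ^ 2 : ℕ) : ℝ) * ((1 / 2) ^ m * 2) = er L m := by unfold er; push_cast; ring
  rw [e] at h4
  unfold Pr
  rw [div_mul_div_comm, div_add' _ _ _ (mul_pos z1 z2).ne', div_le_div_iff₀ z1 (mul_pos z1 z2)]
  nlinarith

lemma SW_U {p β : ℝ} (hp : 1 ≤ p) (hok : okβ β) (L m : ℕ) (y : Site) (k : ℤ) :
    Pr p β (box L) {η | k ≤ η y} ≤ Pr p β (Ub L (m ^ 2) y) {η | k ≤ η y} + er L m := by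
  have hβ : 0 < β := by linarith [hok.1]
  have := SWP hp hok L m _ _ _ _ (Ub_sub L (m ^ 2) y) y (Finset.Subset.refl _) Set.univ
    (fun _ _ _ _ => trivial) {j | k ≤ j}
  rw [Pr_univ hp hβ, one_mul] at this
  have e : {η : Site → ℤ | η ∈ (Set.univ : Set (Site → ℤ)) ∧ η y ∈ {j | k ≤ j}} = {η | k ≤ η y} := by
    ext η; exact ⟨fun h => h.2, fun h => ⟨trivial, h⟩⟩
  rw [e] at this
  exact this

lemma SW_xy {p β : ℝ} (hp : 1 ≤ p) (hok : okβ β) (L m : ℕ) (x y : Site) (hxy : x ∉ Ub L (m ^ 2) y) (k : ℤ) :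
    Pr p β (box L) {η | η ∈ {η : Site → ℤ | k ≤ η x} ∧ η ∈ {η : Site → ℤ | k ≤ η y}} ≤
      Pr p β (box L) {η | k ≤ η x} * Pr p β (box L) {η | k ≤ η y} + er L m := by
  refine SWP hp hok L m 1 L 1 L (Finset.Subset.refl _) y (Ub_sub L (m ^ 2) y) {η | k ≤ η x} ?_ {j | k ≤ j}
  intro η ξ h hη
  change k ≤ ξ x
  rw [← h x hxy]; exact hη

/-- upper bound in the box -/
lemma LDB {p β ε : ℝ} (hp1 : 1 < p) (hp2 : p < 2) (hok : okβ β) (hε0 : 0 < ε) (hε1 : ε < 1) :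
    ∃ h0 : ℕ, ∀ h : ℕ, h0 ≤ h → ∀ L m : ℕ, ((2 * (m : ℝ) ^ 2 + 1) ^ 2 ≤ (h : ℝ) ^ 20) → ∀ x,
      Pr p β (box L) {η | (h : ℤ) ≤ η x} ≤ Real.exp (-((1 - ε) * β * (Estar p * (h : ℝ) ^ p))) + er L m := by
  obtain ⟨h0, hh⟩ := LDU hp1 hp2 hok hε0 hε1
  refine ⟨h0, fun h hh0 L m hm x => ?_⟩
  refine (SW_U hp1.le hok L m x h).trans (add_le_add_left (hh h hh0 _ _ _ _ ?_ x) _)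
  refine le_trans ?_ hm
  have := card_Ub L (m ^ 2) x
  calc ((Ub L (m ^ 2) x).card : ℝ) ≤ (((2 * m ^ 2 + 1) ^ 2 : ℕ) : ℝ) := by exact_mod_cast this
    _ = _ := by push_cast; ring

end PS

namespace PS
open scoped ENNReal

def Kp (K : Finset Site) : Finset Site := (EB K).image (fun e => e.1) ∪ (EB K).image tgt

lemma K_sub_Kp (K : Finset Site) : K ⊆ Kp K := by
  intro z hz
  rw [Kp, Finset.mem_union, Finset.mem_image]
  exact Or.inl ⟨(z, false), mem_EB (Or.inl hz), rfl⟩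

lemma tgt_sub (e : Edge) (x : Site) : tgt (e.1 - x, e.2) = tgt e - x := by
  rcases e with ⟨a, _ | _⟩ <;> ext <;> simp [tgt] <;> ring

def iot (φ : Site → ℝ) (K : Finset Site) (h : ℕ) (x : Site) (η : Site → ℤ) : Site → ℤ :=
  fun z => if z - x ∈ K then ⌊(h : ℝ) * φ (z - x)⌋ else η z

lemma iot_near {φ : Site → ℝ} {K : Finset Site} (hK : ∀ z ∉ K, φ z = 0) {h k : ℕ} {x : Site} {η : Site → ℤ}
    {z : Site} (hη : |η z| ≤ (k : ℤ)) : |((iot φ K h x η z : ℤ) : ℝ) - h * φ (z - x)| ≤ 1 + k := by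
  have hk : (0 : ℝ) ≤ k := Nat.cast_nonneg k
  unfold iot
  split_ifs with hz
  · rw [abs_le]
    have h1 := Int.floor_le ((h : ℝ) * φ (z - x))
    have h2 := (Int.lt_floor_add_one ((h : ℝ) * φ (z - x))).le
    constructor <;> linarith
  · rw [hK _ hz, mul_zero, sub_zero]
    have : |((η z : ℤ) : ℝ)| ≤ k := by exact_mod_cast hη
    linarith

lemma LDL_core {p β : ℝ} (hp : 1 ≤ p) (hβ : 0 ≤ β) {φ : Site → ℝ} {K : Finset Site} (hK : ∀ z ∉ K, φ z = 0)
    (h0K : (0 : Site) ∈ K) (hφ0 : φ 0 = 1) (R : Finset Site) (x : Site) (hR : ∀ z ∈ K, z + x ∈ R) (h k : ℕ) :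
    W p β R {η | ∀ z ∈ Kp K, |η (z + x)| ≤ (k : ℤ)} *
        ENNReal.ofReal (Real.exp (-β * ∑ e ∈ EB K, ((h : ℝ) * |dd φ e| + 2 * (1 + k)) ^ p)) ≤
      (((2 * k + 1) ^ K.card : ℕ) : ℝ≥0∞) * W p β R {η | (h : ℤ) ≤ η x} := by
  set B := ∑ e ∈ EB K, ((h : ℝ) * |dd φ e| + 2 * (1 + k)) ^ p with hB
  set E : Set (Site → ℤ) := {η | ∀ z ∈ Kp K, |η (z + x)| ≤ (k : ℤ)} with hE
  set A : Set (Site → ℤ) := {η | (h : ℤ) ≤ η x} with hA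
  let P : Finset (K → ℤ) := Fintype.piFinset (fun _ => Finset.Icc (-(k : ℤ)) k)
  have hPc : P.card = (2 * k + 1) ^ K.card := by
    rw [Fintype.card_piFinset]
    simp only [Int.card_Icc, Finset.prod_const, Finset.card_univ, Fintype.card_coe]
    congr 1; omega
  have hsum : ∑' c : (Site → ℤ) × (K → ℤ), (A.indicator (wt p β R) c.1 * (if c.2 ∈ P then 1 else 0)) =
      (((2 * k + 1) ^ K.card : ℕ) : ℝ≥0∞) * W p β R A := by
    rw [ENNReal.tsum_prod (f := fun a b => A.indicator (wt p β R) a * (if b ∈ P then 1 else 0))]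
    simp_rw [ENNReal.tsum_mul_left, ENNReal.tsum_mul_right]
    have : ∑' b : K → ℤ, (if b ∈ P then (1 : ℝ≥0∞) else 0) = P.card := by
      rw [tsum_eq_sum (s := P) (fun b hb => if_neg hb), Finset.sum_congr rfl (fun b hb => if_pos hb)]
      simp
    rw [this, hPc, mul_comm]; rfl
  rw [← hsum]
  have hmain := tsum_inj {η : Site → ℤ | η ∈ E ∧ ∀ z ∉ R, η z = 0}
    (fun η => wt p β R η * ENNReal.ofReal (Real.exp (-β * B)))
    (fun c : (Site → ℤ) × (K → ℤ) => A.indicator (wt p β R) c.1 * (if c.2 ∈ P then 1 else 0))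
    (fun η => (iot φ K h x η, fun u => η (u.1 + x))) ?_ ?_
  · refine le_trans (le_of_eq ?_) hmain
    rw [W, ← ENNReal.tsum_mul_right]
    congr 1; funext η
    by_cases hη : ∀ z ∉ R, η z = 0
    · by_cases h2 : η ∈ E
      · rw [Set.indicator_of_mem h2, Set.indicator_of_mem (by exact ⟨h2, hη⟩)]
      · rw [Set.indicator_of_notMem h2, Set.indicator_of_notMem (by exact fun h => h2 h.1), zero_mul]
    · rw [Set.indicator_of_notMem (show η ∉ {η : Site → ℤ | η ∈ E ∧ ∀ z ∉ R, η z = 0} from fun h => hη h.2)]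
      simp only [Set.indicator, wt_zero hη, ite_self, zero_mul]
  · intro η _ η' _ heq
    rw [Prod.mk.injEq] at heq
    funext z
    by_cases hz : z - x ∈ K
    · have := congrFun heq.2 ⟨z - x, hz⟩
      simpa using this
    · have := congrFun heq.1 z
      simpa only [iot, if_neg hz] using this
  · rintro η ⟨hηE, hη0⟩
    have hi0 : ∀ z ∉ R, iot φ K h x η z = 0 := by
      intro z hz
      have : z - x ∉ K := by
        intro h1; apply hz
        have := hR _ h1
        rwa [sub_add_cancel] at this
      simp only [iot, if_neg this]; exact hη0 z hz
    have hmA : iot φ K h x η ∈ A := by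
      change (h : ℤ) ≤ iot φ K h x η x
      simp [iot, h0K, hφ0]
    have hP : (fun u : K => η (u.1 + x)) ∈ P := by
      rw [Fintype.mem_piFinset]
      intro u
      rw [Finset.mem_Icc]
      exact abs_le.1 (hηE u.1 (K_sub_Kp K u.2))
    simp only [Set.indicator_of_mem hmA, if_pos hP, mul_one]
    rw [wt_pos hη0, wt_pos hi0, ← ENNReal.ofReal_mul (Real.exp_pos _).le, ← Real.exp_add]
    apply ENNReal.ofReal_le_ofReal
    apply Real.exp_le_exp.2
    let f : Edge → Edge := fun e => (e.1 + x, e.2)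
    have hf : Function.Injective f := by
      rintro ⟨a, s⟩ ⟨b, t⟩ hab
      simp only [f, Prod.mk.injEq, add_left_inj] at hab
      rw [hab.1, hab.2]
    have hsp := HR_split (p := p) (by linarith) (FS_ic (FS_of_zero hη0)) (FS_ic (FS_of_zero hi0)) ((EB K).image f)
      (fun e => -((h : ℝ) * |dd φ (e.1 - x, e.2)| + 2 * (1 + k)) ^ p) ?_ ?_
    · rw [Finset.sum_image (fun a _ b _ hab => hf hab)] at hsp
      have e1 : ∀ e : Edge, ((f e).1 - x, (f e).2) = e := fun e => by simp [f]
      simp only [e1, Finset.sum_neg_distrib] at hsp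
      rw [← hB] at hsp
      change HH p (iot φ K h x η) + -B ≤ HH p η at hsp
      nlinarith
    · intro e he
      have h1 : (e.1 - x, e.2) ∉ EB K := by
        intro h2; apply he
        rw [Finset.mem_image]; exact ⟨_, h2, by simp [f]⟩
      have h2 : e.1 - x ∉ K := fun h3 => h1 (mem_EB (Or.inl h3))
      have h3 : tgt e - x ∉ K := fun h4 => h1 (mem_EB (Or.inr (by rw [tgt_sub]; exact h4)))
      apply le_of_eq
      simp only [dd, ic, iot, if_neg h2, if_neg h3]
    · intro e he
      rw [Finset.mem_image] at he
      obtain ⟨e', he', rfl⟩ := he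
      have e1 : ((f e').1 - x, (f e').2) = e' := by simp [f]
      have e2 : tgt (f e') = tgt e' + x := by
        have := tgt_sub (f e') x
        rw [e1] at this
        rw [this, sub_add_cancel]
      rw [e1]
      have n1 := hηE e'.1 (by rw [Kp, Finset.mem_union, Finset.mem_image]; exact Or.inl ⟨e', he', rfl⟩)
      have n2 := hηE (tgt e') (by rw [Kp, Finset.mem_union, Finset.mem_image (f := tgt)]; exact Or.inr ⟨e', he', rfl⟩)
      have m1 := iot_near (h := h) (x := x) hK n1
      have m2 := iot_near (h := h) (x := x) hK n2
      rw [add_sub_cancel_right] at m1 m2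
      have h5 : |dd (ic (iot φ K h x η)) (f e')| ≤ (h : ℝ) * |dd φ e'| + 2 * (1 + k) := by
        have e3 : dd (ic (iot φ K h x η)) (f e') = (h : ℝ) * dd φ e' +
            ((((iot φ K h x η (tgt e' + x) : ℤ) : ℝ) - h * φ (tgt e')) - (((iot φ K h x η (e'.1 + x) : ℤ) : ℝ) - h * φ e'.1)) := by
          simp only [dd, ic, e2, f]; ring
        rw [e3]
        refine (abs_add_le _ _).trans ?_
        rw [abs_mul, abs_of_nonneg (Nat.cast_nonneg h : (0 : ℝ) ≤ h)]
        have := abs_sub (((iot φ K h x η (tgt e' + x) : ℤ) : ℝ) - h * φ (tgt e')) (((iot φ K h x η (e'.1 + x) : ℤ) : ℝ) - h * φ e'.1)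
        linarith
      have h6 := Real.rpow_le_rpow (abs_nonneg _) h5 (show 0 ≤ p by linarith)
      have h7 : 0 ≤ |dd (ic η) (f e')| ^ p := Real.rpow_nonneg (abs_nonneg _) _
      linarith

lemma LDL {p β ε : ℝ} (hp1 : 1 < p) (hβ : 0 < β) (hε : 0 < ε) :
    ∃ (K : Finset Site) (u : ℝ) (h1 : ℕ), 0 < u ∧ ∀ h : ℕ, h1 ≤ h → ∀ (R : Finset Site) (x : Site),
      (∀ z ∈ K, z + x ∈ R) →
      Pr p β R {η | ∀ z ∈ Kp K, |η (z + x)| ≤ (⌊u * h⌋₊ : ℤ)} * Real.exp (-(β * ((Estar p + ε) * (h : ℝ) ^ p))) ≤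
        (2 * (⌊u * h⌋₊ : ℝ) + 1) ^ K.card * Pr p β R {η | (h : ℤ) ≤ η x} := by
  have hp : 1 ≤ p := hp1.le
  have hp0 : 0 < p := by linarith
  obtain ⟨φ, hφ, hφ0, hφE⟩ := Estar_near hp0 hε
  have hsup := (FS_iff φ).1 hφ
  set K := hsup.toFinset with hKdef
  have hK : ∀ z ∉ K, φ z = 0 := by
    intro z hz
    by_contra h; exact hz (by rw [hKdef, Set.Finite.mem_toFinset]; exact h)
  have h0K : (0 : Site) ∈ K := by
    rw [hKdef, Set.Finite.mem_toFinset]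
    change φ (0, 0) ≠ 0
    rw [hφ0]; exact one_ne_zero
  have hcont : Continuous (fun u : ℝ => ∑ e ∈ EB K, (|dd φ e| + 4 * u) ^ p) := by
    refine continuous_finsetSum _ (fun e _ => ?_)
    exact (by fun_prop : Continuous fun u : ℝ => |dd φ e| + 4 * u).rpow_const (fun _ => Or.inr hp0.le)
  have h00 : (fun u : ℝ => ∑ e ∈ EB K, (|dd φ e| + 4 * u) ^ p) 0 < Estar p + ε := by
    refine lt_of_le_of_lt ?_ hφE
    simp only [mul_zero, add_zero]
    exact (HR_summable hp0 hφ).sum_le_tsum _ (fun e _ => Real.rpow_nonneg (abs_nonneg _) _)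
  have hev := (hcont.continuousAt (x := 0)).eventually_lt_const h00
  obtain ⟨δ, hδ, hball⟩ := Metric.eventually_nhds_iff.1 hev
  set u := δ / 2 with hu
  have hu0 : 0 < u := by positivity
  have hub := hball (show dist u 0 < δ by rw [Real.dist_eq, sub_zero, abs_of_pos hu0]; linarith)
  refine ⟨K, u, ⌈1 / u⌉₊, hu0, fun h hh R x hR => ?_⟩
  have hhu : 1 ≤ u * h := by
    have h3 : 1 / u ≤ h := (Nat.le_ceil _).trans (by exact_mod_cast hh)
    rw [div_le_iff₀ hu0] at h3; linarith
  set k := ⌊u * h⌋₊ with hk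
  have hku : (k : ℝ) ≤ u * h := Nat.floor_le (by linarith)
  have hh0 : (0 : ℝ) ≤ h := Nat.cast_nonneg h
  have hc := LDL_core hp hβ.le hK h0K hφ0 R x hR h k
  set B := ∑ e ∈ EB K, ((h : ℝ) * |dd φ e| + 2 * (1 + k)) ^ p with hB
  have hBle : B ≤ (Estar p + ε) * (h : ℝ) ^ p := by
    calc B ≤ ∑ e ∈ EB K, (|dd φ e| + 4 * u) ^ p * (h : ℝ) ^ p := by
          refine Finset.sum_le_sum (fun e _ => ?_)
          rw [← Real.mul_rpow (by positivity) hh0]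
          apply Real.rpow_le_rpow (by positivity) _ hp0.le
          linarith
      _ = (∑ e ∈ EB K, (|dd φ e| + 4 * u) ^ p) * (h : ℝ) ^ p := by rw [Finset.sum_mul]
      _ ≤ _ := mul_le_mul_of_nonneg_right hub.le (Real.rpow_nonneg hh0 _)
  have hf : ∀ A, W p β R A ≠ ∞ := fun A => (W_lt hp hβ R A).ne
  have hc2 := ENNReal.toReal_mono (ENNReal.mul_ne_top (ENNReal.natCast_ne_top _) (hf _)) hc
  rw [ENNReal.toReal_mul, ENNReal.toReal_mul, ENNReal.toReal_ofReal (Real.exp_pos _).le, ENNReal.toReal_natCast] at hc2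
  have hexp : Real.exp (-(β * ((Estar p + ε) * (h : ℝ) ^ p))) ≤ Real.exp (-β * B) := by
    apply Real.exp_le_exp.2; nlinarith
  unfold Pr
  rw [div_mul_eq_mul_div, ← mul_div_assoc]
  apply div_le_div_of_nonneg_right _ ENNReal.toReal_nonneg
  refine (mul_le_mul_of_nonneg_left hexp ENNReal.toReal_nonneg).trans (hc2.trans (le_of_eq ?_))
  push_cast; ring

lemma Pr_small {p β : ℝ} (hp : 1 ≤ p) (hβ : 0 < β) (R Q : Finset Site) (x : Site) (k : ℕ) :
    1 - ∑ z ∈ Q, 2 * Pr p β R {η | ((k + 1 : ℕ) : ℤ) ≤ η (z + x)} ≤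
      Pr p β R {η | ∀ z ∈ Q, |η (z + x)| ≤ (k : ℤ)} := by
  have h1 : Pr p β R Set.univ ≤ Pr p β R {η | ∀ z ∈ Q, |η (z + x)| ≤ (k : ℤ)} +
      Pr p β R {η | ¬ ∀ z ∈ Q, |η (z + x)| ≤ (k : ℤ)} := Pr_union hp hβ (fun η _ => Classical.em _)
  have h2 : Pr p β R {η | ¬ ∀ z ∈ Q, |η (z + x)| ≤ (k : ℤ)} ≤
      ∑ z ∈ Q, Pr p β R {η | ((k + 1 : ℕ) : ℤ) ≤ |η (z + x)|} := by
    apply Pr_biUnion hp hβ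
    intro η hη
    by_contra hcon
    apply hη
    intro z hz
    by_contra h3
    exact hcon ⟨z, hz, show ((k + 1 : ℕ) : ℤ) ≤ |η (z + x)| by push_cast; omega⟩
  have h3 : ∀ z ∈ Q, Pr p β R {η | ((k + 1 : ℕ) : ℤ) ≤ |η (z + x)|} ≤ 2 * Pr p β R {η | ((k + 1 : ℕ) : ℤ) ≤ η (z + x)} := by
    intro z _
    have h4 := Pr_union (R := R) hp hβ (A := {η | ((k + 1 : ℕ) : ℤ) ≤ |η (z + x)|})
      (B := {η | ((k + 1 : ℕ) : ℤ) ≤ η (z + x)}) (C := {η | η (z + x) ≤ -((k + 1 : ℕ) : ℤ)}) (by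
        intro η hη
        rcases le_abs.1 (show ((k + 1 : ℕ) : ℤ) ≤ |η (z + x)| from hη) with h | h
        · left; exact h
        · right; change η (z + x) ≤ _; omega)
    rw [Pr_neg] at h4
    linarith
  have h5 := Finset.sum_le_sum h3
  rw [Pr_univ hp hβ] at h1
  linarith

end PS

namespace PS
open scoped ENNReal

def mm (L : ℕ) : ℕ := ⌈Real.log L⌉₊ ^ 2

lemma evL {P : ℝ → Prop} (h : ∀ᶠ x : ℝ in atTop, P x) : ∀ᶠ L : ℕ in atTop, P (Real.log L) :=
  (Real.tendsto_log_atTop.comp tendsto_natCast_atTop_atTop).eventually h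

lemma ev_lin {c : ℝ} (hc : 0 < c) (C : ℝ) : ∀ᶠ x : ℝ in atTop, C ≤ c * x := by
  filter_upwards [ev_const (t := 1) one_pos hc C] with x hx
  rwa [Real.rpow_one] at hx

lemma mm_le {L : ℕ} (h : 1 ≤ Real.log L) : (mm L : ℝ) ≤ 4 * Real.log L ^ 2 := by
  unfold mm; push_cast
  have h1 := (Nat.ceil_lt_add_one (show 0 ≤ Real.log L by linarith)).le
  have h2 : (0:ℝ) ≤ (⌈Real.log L⌉₊ : ℝ) := by positivity
  nlinarith

lemma mm_ge {L : ℕ} (h : 1 ≤ Real.log L) : Real.log L ^ 2 ≤ (mm L : ℝ) := by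
  unfold mm; push_cast
  have h1 := Nat.le_ceil (Real.log L)
  nlinarith

lemma L_exp {L : ℕ} (h : 1 ≤ Real.log L) : (L : ℝ) = Real.exp (Real.log L) := by
  rw [Real.exp_log]
  rcases Nat.eq_zero_or_pos L with h0 | h0
  · subst h0; norm_num at h
  · exact_mod_cast h0

lemma er_small (C : ℝ) : ∀ᶠ L : ℕ in atTop, er L (mm L) ≤ Real.exp (-(C * Real.log L)) := by
  filter_upwards [evL (ev_lin one_pos 1), evL (ev_lin one_pos (2 * (C + 2) + 6))] with L h1 h2
  rw [one_mul] at h1 h2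
  set X := Real.log L with hX
  unfold er
  rw [L_exp h1, ← hX]
  have h3 : ((1:ℝ) / 2) ^ (mm L) ≤ Real.exp (-(X ^ 2 / 2)) := by
    have h4 : ((1:ℝ)/2) ≤ Real.exp (-(1/2)) := by
      have := Real.add_one_le_exp (-(1/2 : ℝ)); linarith
    calc ((1:ℝ) / 2) ^ (mm L) ≤ Real.exp (-(1/2)) ^ (mm L) := pow_le_pow_left₀ (by norm_num) h4 _
      _ = Real.exp (mm L * (-(1/2))) := by rw [Real.exp_nat_mul]
      _ ≤ _ := by
        apply Real.exp_le_exp.2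
        have := mm_ge h1
        linarith
  have h8 : (8:ℝ) ≤ Real.exp 3 := by
    have h5 : (2:ℝ) ≤ Real.exp 1 := by have := Real.add_one_le_exp (1:ℝ); linarith
    have h6 : Real.exp 3 = Real.exp 1 ^ 3 := by rw [← Real.exp_nat_mul]; norm_num
    rw [h6]
    calc (8:ℝ) = 2 ^ 3 := by norm_num
      _ ≤ _ := pow_le_pow_left₀ (by norm_num) h5 _
  calc 8 * Real.exp X ^ 2 * (1 / 2) ^ (mm L) ≤ Real.exp 3 * Real.exp X ^ 2 * Real.exp (-(X ^ 2 / 2)) :=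
        mul_le_mul (mul_le_mul_of_nonneg_right h8 (by positivity)) h3 (by positivity) (by positivity)
    _ = Real.exp (3 + 2 * X + -(X ^ 2 / 2)) := by
        rw [Real.exp_add, Real.exp_add, ← Real.exp_nat_mul]; norm_num
    _ ≤ _ := by
        apply Real.exp_le_exp.2
        nlinarith

lemma UB {p β t c : ℝ} (hp1 : 1 < p) (hp2 : p < 2) (hok : okβ β) (hc : 0 < c) (hct : c < t) :
    ∀ᶠ L : ℕ in atTop, ∀ h : ℕ, t * (2 / (β * Estar p) * Real.log L) ≤ (h : ℝ) ^ p →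
      ∀ y, Pr p β (box L) {η | (h : ℤ) ≤ η y} ≤ Real.exp (-(2 * c * Real.log L)) := by
  have hβ : 0 < β := by linarith [hok.1]
  have hE := Estar_pos hp1 hp2
  have ht : 0 < t := hc.trans hct
  set κ := 2 / (β * Estar p) with hκ
  have hκ0 : 0 < κ := by positivity
  obtain ⟨h0, H⟩ := LDB (ε := (t - c) / (2 * t)) hp1 hp2 hok (by apply div_pos <;> linarith)
    (by rw [div_lt_one (by linarith)]; linarith)
  have htk : 0 < t * κ := mul_pos ht hκ0
  filter_upwards [evL (ev_lin one_pos 1), evL (ev_lin htk 1), evL (ev_lin htk ((h0 : ℝ) ^ p)),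
    evL (ev_const (t := 2) (by norm_num) (pow_pos htk 10) 2601), er_small (c + t),
    evL (ev_lin (show 0 < t - c by linarith) 1)] with L h1 h2 h3 h4 h5 h6 h hh y
  rw [one_mul] at h1
  set X := Real.log L with hX
  have hhp : 1 ≤ (h : ℝ) ^ p := by nlinarith
  have hh1 : 1 ≤ (h : ℝ) := by
    by_contra hcon
    have : (h : ℝ) = 0 := by
      have : h < 1 := by exact_mod_cast not_le.1 hcon
      have : h = 0 := by omega
      exact_mod_cast this
    rw [this, Real.zero_rpow (by linarith)] at hhp
    linarith
  have hh0 : h0 ≤ h := by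
    have : (h0 : ℝ) ^ p ≤ (h : ℝ) ^ p := by nlinarith
    have := (Real.rpow_le_rpow_iff (by positivity) (by positivity) (by linarith : 0 < p)).1 this
    exact_mod_cast this
  have hcard : (2 * ((mm L : ℕ) : ℝ) ^ 2 + 1) ^ 2 ≤ (h : ℝ) ^ 20 := by
    have hm := mm_le h1
    rw [← hX] at hm
    have hm2 : ((mm L : ℕ) : ℝ) ^ 2 ≤ 16 * X ^ 4 := by
      calc ((mm L : ℕ) : ℝ) ^ 2 ≤ (4 * X ^ 2) ^ 2 := pow_le_pow_left₀ (by positivity) hm _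
        _ = _ := by ring
    have hX4 : 1 ≤ X ^ 4 := one_le_pow₀ h1
    have h7 : (2 * ((mm L : ℕ) : ℝ) ^ 2 + 1) ^ 2 ≤ (51 * X ^ 4) ^ 2 :=
      pow_le_pow_left₀ (by positivity) (by linarith) _
    have h8 : ((h : ℝ) ^ p) ^ 10 ≤ (h : ℝ) ^ 20 := by
      have : (h : ℝ) ^ p ≤ (h : ℝ) ^ (2 : ℝ) := Real.rpow_le_rpow_of_exponent_le hh1 hp2.le
      rw [Real.rpow_two] at this
      calc ((h : ℝ) ^ p) ^ 10 ≤ ((h : ℝ) ^ 2) ^ 10 := pow_le_pow_left₀ (by positivity) this _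
        _ = _ := by ring
    have h9 : (t * κ * X) ^ 10 ≤ ((h : ℝ) ^ p) ^ 10 := pow_le_pow_left₀ (by positivity) (by linarith) _
    rw [Real.rpow_two] at h4
    have h10 : (51 * X ^ 4) ^ 2 ≤ (t * κ * X) ^ 10 := by
      calc (51 * X ^ 4) ^ 2 = 2601 * X ^ 8 := by ring
        _ ≤ ((t * κ) ^ 10 * X ^ 2) * X ^ 8 := mul_le_mul_of_nonneg_right h4 (by positivity)
        _ = _ := by ring
    linarith
  have hmain := H h hh0 L (mm L) hcard y
  have h11 : Real.exp (-((1 - (t - c) / (2 * t)) * β * (Estar p * (h : ℝ) ^ p))) ≤ Real.exp (-((c + t) * X)) := by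
    apply Real.exp_le_exp.2
    have e1 : (c + t) * X = ((c + t) / (2 * t)) * β * (Estar p * (t * (κ * X))) := by
      rw [hκ]; field_simp
    have e2 : 1 - (t - c) / (2 * t) = (c + t) / (2 * t) := by field_simp; ring
    rw [e1, e2]
    apply neg_le_neg
    apply mul_le_mul_of_nonneg_left _ (by positivity)
    exact mul_le_mul_of_nonneg_left hh hE.le
  have h12 : 2 * Real.exp (-((c + t) * X)) ≤ Real.exp (-(2 * c * X)) := by
    have e3 : Real.exp (-(2 * c * X)) = Real.exp ((t - c) * X) * Real.exp (-((c + t) * X)) := by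
      rw [← Real.exp_add]; congr 1; ring
    rw [e3]
    apply mul_le_mul_of_nonneg_right _ (Real.exp_pos _).le
    have := Real.add_one_le_exp ((t - c) * X)
    linarith
  linarith

/-- polynomial versus exponential -/
lemma ev_poly {a : ℝ} (ha : 0 < a) (D : ℝ) (n : ℕ) : ∀ᶠ x : ℝ in atTop, D * x ^ n ≤ Real.exp (a * x) := by
  have h := (Real.tendsto_pow_mul_exp_neg_atTop_nhds_zero n).comp (tendsto_id.const_mul_atTop ha)
  have h2 := h.const_mul (D / a ^ n)
  rw [mul_zero] at h2
  filter_upwards [h2.eventually (gt_mem_nhds (show (0:ℝ) < 1 by norm_num))] with x hx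
  simp only [Function.comp_apply, id] at hx
  have e : D / a ^ n * ((a * x) ^ n * Real.exp (-(a * x))) = D * x ^ n * Real.exp (-(a * x)) := by
    rw [mul_pow]; field_simp
  rw [e, Real.exp_neg] at hx
  have := Real.exp_pos (a * x)
  rw [← div_eq_mul_inv, div_lt_one this] at hx
  exact hx.le

lemma LB {p β δ t c : ℝ} (hp1 : 1 < p) (hp2 : p < 2) (hok : okβ β) (hδ : 0 < δ) (ht : 0 < t) (hct : t < c) :
    ∃ N : ℕ, ∀ᶠ L : ℕ in atTop, ∀ h : ℕ, δ * (2 / (β * Estar p) * Real.log L) ≤ (h : ℝ) ^ p →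
      (h : ℝ) ^ p ≤ t * (2 / (β * Estar p) * Real.log L) →
      ∀ x : Site, ((N : ℤ) < x.1 ∧ x.1 ≤ L - N) → ((N : ℤ) < x.2 ∧ x.2 ≤ L - N) →
        Real.exp (-(2 * c * Real.log L)) ≤ Pr p β (box L) {η | (h : ℤ) ≤ η x} := by
  have hβ : 0 < β := by linarith [hok.1]
  have hE := Estar_pos hp1 hp2
  set κ := 2 / (β * Estar p) with hκ
  have hκ0 : 0 < κ := by positivity
  obtain ⟨K, u, h1, hu, H⟩ := LDL (ε := Estar p * ((c - t) / (2 * t))) hp1 hβ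
    (mul_pos hE (div_pos (by linarith) (by linarith)))
  set N := ∑ z ∈ K, (z.1.natAbs + z.2.natAbs) with hN
  have hKN : ∀ z ∈ K, z.1.natAbs + z.2.natAbs ≤ N := fun z hz =>
    Finset.single_le_sum (f := fun z : Site => z.1.natAbs + z.2.natAbs) (fun _ _ => Nat.zero_le _) hz
  refine ⟨N, ?_⟩
  have hup : 0 < u ^ p * δ := mul_pos (Real.rpow_pos_of_pos hu p) hδ
  have hδk : 0 < δ * κ := mul_pos hδ hκ0
  set D := 2 * u * (t * κ) + 1 with hD
  have hD1 : 1 ≤ D := by have : 0 < 2 * u * (t * κ) := by positivity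
                         linarith
  filter_upwards [evL (ev_lin one_pos 1), evL (ev_lin hδk 1), evL (ev_lin hδk ((h1 : ℝ) ^ p)),
    UB (t := u ^ p * δ) (c := u ^ p * δ / 2) hp1 hp2 hok (by linarith) (by linarith),
    evL (ev_poly hup (4 * (Kp K).card) 0),
    evL (ev_poly (show 0 < c - t by linarith) (2 * D ^ K.card) K.card)] with L g1 g2 g3 g4 g5 g6 h hδh hht x hx1 hx2
  rw [one_mul] at g1
  set X := Real.log L with hX
  have hhp : 1 ≤ (h : ℝ) ^ p := by nlinarith
  have hh1 : 1 ≤ (h : ℝ) := by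
    by_contra hcon
    have : (h : ℝ) = 0 := by
      have : h < 1 := by exact_mod_cast not_le.1 hcon
      have : h = 0 := by omega
      exact_mod_cast this
    rw [this, Real.zero_rpow (by linarith)] at hhp
    linarith
  have hh0 : h1 ≤ h := by
    have : (h1 : ℝ) ^ p ≤ (h : ℝ) ^ p := by nlinarith
    have := (Real.rpow_le_rpow_iff (by positivity) (by positivity) (by linarith : 0 < p)).1 this
    exact_mod_cast this
  have hmain := H h hh0 (box L) x (by
    intro z hz
    have := hKN z hz
    rw [mem_box]
    show (1 ≤ z.1 + x.1 ∧ z.1 + x.1 ≤ L) ∧ (1 ≤ z.2 + x.2 ∧ z.2 + x.2 ≤ L)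
    omega)
  set k := ⌊u * (h : ℝ)⌋₊ with hk
  have hkh : u * (h : ℝ) ≤ ((k + 1 : ℕ) : ℝ) := by
    push_cast; exact (Nat.lt_floor_add_one _).le
  have hsm := Pr_small (p := p) (by linarith) hβ (box L) (Kp K) x k
  have hsm2 : ∀ z ∈ Kp K, 2 * Pr p β (box L) {η | ((k + 1 : ℕ) : ℤ) ≤ η (z + x)} ≤
      2 * Real.exp (-(2 * (u ^ p * δ / 2) * X)) := by
    intro z _
    apply mul_le_mul_of_nonneg_left _ (by norm_num)
    apply g4 (k + 1)
    calc u ^ p * δ * (κ * X) = u ^ p * (δ * (κ * X)) := by ring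
      _ ≤ u ^ p * (h : ℝ) ^ p := mul_le_mul_of_nonneg_left hδh (Real.rpow_pos_of_pos hu p).le
      _ = (u * h) ^ p := (Real.mul_rpow hu.le (by linarith)).symm
      _ ≤ _ := Real.rpow_le_rpow (by positivity) hkh (by linarith)
  have hsm3 := Finset.sum_le_sum hsm2
  rw [Finset.sum_const, nsmul_eq_mul] at hsm3
  have e1 : 2 * (u ^ p * δ / 2) * X = u ^ p * δ * X := by ring
  rw [e1, Real.exp_neg] at hsm3
  have hhalf : (1:ℝ)/2 ≤ Pr p β (box L) {η | ∀ z ∈ Kp K, |η (z + x)| ≤ (k : ℤ)} := by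
    have : ((Kp K).card : ℝ) * (2 * (Real.exp (u ^ p * δ * X))⁻¹) ≤ 1 / 2 := by
      rw [pow_zero, mul_one] at g5
      have hpos := Real.exp_pos (u ^ p * δ * X)
      rw [← mul_assoc, ← div_eq_mul_inv, div_le_iff₀ hpos]
      linarith
    linarith
  have hexp : Real.exp (-((c + t) * X)) ≤ Real.exp (-(β * ((Estar p + Estar p * ((c - t) / (2 * t))) * (h : ℝ) ^ p))) := by
    apply Real.exp_le_exp.2
    apply neg_le_neg
    have e3 : (c + t) * X = β * ((Estar p + Estar p * ((c - t) / (2 * t))) * (t * (κ * X))) := by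
      rw [hκ]; field_simp; ring
    rw [e3]
    have : 0 ≤ Estar p * ((c - t) / (2 * t)) := mul_nonneg hE.le (div_nonneg (by linarith) (by linarith))
    exact mul_le_mul_of_nonneg_left (mul_le_mul_of_nonneg_left hht (by linarith)) hβ.le
  have hkD : 2 * (k : ℝ) + 1 ≤ D * X := by
    have i1 : (k : ℝ) ≤ u * h := Nat.floor_le (by positivity)
    have i2 : (h : ℝ) ≤ (h : ℝ) ^ p := by
      have := Real.rpow_le_rpow_of_exponent_le hh1 hp1.le
      rwa [Real.rpow_one] at this
    have i3 : u * (h : ℝ) ≤ u * (t * (κ * X)) := mul_le_mul_of_nonneg_left (i2.trans hht) hu.le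
    rw [hD]
    linarith
  have hpow : (2 * (k : ℝ) + 1) ^ K.card ≤ (D * X) ^ K.card := pow_le_pow_left₀ (by positivity) hkD _
  set P := Pr p β (box L) {η | (h : ℤ) ≤ η x} with hP
  have hP0 : 0 ≤ P := Pr_nonneg _ _ _ _
  have j1 : 1 / 2 * Real.exp (-((c + t) * X)) ≤ (D * X) ^ K.card * P :=
    (mul_le_mul hhalf hexp (Real.exp_pos _).le (by linarith)).trans (hmain.trans (mul_le_mul_of_nonneg_right hpow hP0))
  have j2 : 2 * (D * X) ^ K.card ≤ Real.exp ((c - t) * X) := by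
    rw [mul_pow]; linarith
  have j3 : Real.exp (-((c + t) * X)) ≤ Real.exp ((c - t) * X) * P := by
    have := mul_le_mul_of_nonneg_right j2 hP0
    linarith
  have e4 : Real.exp (-((c + t) * X)) = Real.exp ((c - t) * X) * Real.exp (-(2 * c * X)) := by
    rw [← Real.exp_add]; congr 1; ring
  rw [e4] at j3
  exact le_of_mul_le_mul_left j3 (Real.exp_pos _)

def aa (p β : ℝ) (L h : ℕ) : ℝ := ∑ x ∈ box L, Pr p β (box L) {η | (h : ℤ) ≤ η x}

lemma aA {p β t : ℝ} (hp1 : 1 < p) (hp2 : p < 2) (hok : okβ β) (ht : 1 < t) :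
    ∀ᶠ L : ℕ in atTop, ∀ h : ℕ, t * (2 / (β * Estar p) * Real.log L) ≤ (h : ℝ) ^ p →
      aa p β L h < Real.log L ^ 20 := by
  filter_upwards [UB (c := (1 + t) / 2) hp1 hp2 hok (by linarith) (by linarith : (1 + t) / 2 < t),
    evL (ev_lin one_pos 1)] with L h1 h2 h hh
  rw [one_mul] at h2
  have h3 := Finset.sum_le_sum (s := box L) (fun x _ => h1 h hh x)
  rw [Finset.sum_const, card_box, nsmul_eq_mul] at h3
  push_cast at h3
  have h4 : (1:ℝ) ≤ Real.log L ^ 20 := one_le_pow₀ h2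
  rw [L_exp h2, Real.log_exp, ← Real.exp_nat_mul, ← Real.exp_add] at h3
  have h5 : Real.exp ((2 : ℕ) * Real.log L + -(2 * ((1 + t) / 2) * Real.log L)) < 1 := by
    rw [Real.exp_lt_one_iff]
    push_cast
    nlinarith
  unfold aa
  linarith

lemma aB {p β δ t : ℝ} (hp1 : 1 < p) (hp2 : p < 2) (hok : okβ β) (hδ : 0 < δ) (ht : 0 < t) (ht1 : t < 1) :
    ∀ᶠ L : ℕ in atTop, ∀ h : ℕ, δ * (2 / (β * Estar p) * Real.log L) ≤ (h : ℝ) ^ p →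
      (h : ℝ) ^ p ≤ t * (2 / (β * Estar p) * Real.log L) → Real.log L ^ 20 ≤ aa p β L h := by
  obtain ⟨N, H⟩ := LB (c := (1 + t) / 2) hp1 hp2 hok hδ ht (by linarith)
  filter_upwards [H, evL (ev_lin one_pos 1), eventually_ge_atTop (4 * N),
    evL (ev_poly (show 0 < 1 - t by linarith) 4 20)] with L h1 h2 h3 h4 h hδh hht
  rw [one_mul] at h2
  set S : Finset Site := (Finset.Icc ((N : ℤ) + 1) (L - N)) ×ˢ (Finset.Icc ((N : ℤ) + 1) (L - N)) with hS
  have hSb : S ⊆ box L := by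
    intro z hz
    rw [hS, Finset.mem_product, Finset.mem_Icc, Finset.mem_Icc] at hz
    rw [mem_box]; omega
  have hcard : S.card = (L - 2 * N) ^ 2 := by
    rw [hS, Finset.card_product, Int.card_Icc, sq]; congr 1 <;> omega
  have k1 : ∑ x ∈ S, Real.exp (-(2 * ((1 + t) / 2) * Real.log L)) ≤ aa p β L h := by
    refine (Finset.sum_le_sum (fun x hx => ?_)).trans
      (Finset.sum_le_sum_of_subset_of_nonneg hSb (fun x _ _ => Pr_nonneg _ _ _ _))
    rw [hS, Finset.mem_product, Finset.mem_Icc, Finset.mem_Icc] at hx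
    exact h1 h hδh hht x ⟨by omega, by omega⟩ ⟨by omega, by omega⟩
  rw [Finset.sum_const, nsmul_eq_mul, hcard] at k1
  have k2 : (L : ℝ) / 2 ≤ ((L - 2 * N : ℕ) : ℝ) := by
    have : L ≤ 2 * (L - 2 * N) := by omega
    have : (L : ℝ) ≤ 2 * ((L - 2 * N : ℕ) : ℝ) := by exact_mod_cast this
    linarith
  have k3 : ((L : ℝ) / 2) ^ 2 ≤ (((L - 2 * N) ^ 2 : ℕ) : ℝ) := by
    rw [Nat.cast_pow]
    exact pow_le_pow_left₀ (by positivity) k2 _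
  have k4 := (mul_le_mul_of_nonneg_right k3 (Real.exp_pos (-(2 * ((1 + t) / 2) * Real.log L))).le).trans k1
  have k5 : ((L : ℝ) / 2) ^ 2 * Real.exp (-(2 * ((1 + t) / 2) * Real.log L)) = Real.exp ((1 - t) * Real.log L) / 4 := by
    have : (L : ℝ) ^ 2 = Real.exp (2 * Real.log L) := by
      conv_lhs => rw [L_exp h2]
      rw [← Real.exp_nat_mul]; norm_num
    have e : Real.exp ((1 - t) * Real.log L) = Real.exp (2 * Real.log L) * Real.exp (-(2 * ((1 + t) / 2) * Real.log L)) := by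
      rw [← Real.exp_add]; congr 1; ring
    rw [div_pow, this, e]; ring
  rw [k5] at k4
  linarith

lemma ex_h {p κ t t' : ℝ} (hp : 0 < p) (hκ : 0 < κ) (ht' : 0 < t') (htt : t' < t) :
    ∀ᶠ X : ℝ in atTop, ∃ h : ℕ, t' * (κ * X) ≤ (h : ℝ) ^ p ∧ (h : ℝ) ^ p ≤ t * (κ * X) := by
  have ht : 0 < t := ht'.trans htt
  set r := (t' / t) ^ (1 / p) with hr
  have hr0 : 0 ≤ r := by positivity
  have hr1 : r < 1 := Real.rpow_lt_one (by positivity) (by rw [div_lt_one ht]; exact htt) (by positivity)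
  filter_upwards [ev_const (t := 1 / p) (by positivity) (show 0 < (t * κ) ^ (1 / p) by positivity) (1 / (1 - r)),
    eventually_gt_atTop 0] with X h1 hX
  rw [← Real.mul_rpow (by positivity) hX.le] at h1
  set y := (t * κ * X) ^ (1 / p) with hy
  have hyp : y ^ p = t * (κ * X) := by
    rw [hy, ← Real.rpow_mul (by positivity), one_div_mul_cancel hp.ne', Real.rpow_one]; ring
  have hrp : r ^ p = t' / t := by
    rw [hr, ← Real.rpow_mul (by positivity), one_div_mul_cancel hp.ne', Real.rpow_one]
  have hy0 : 0 ≤ y := by positivity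
  refine ⟨⌊y⌋₊, ?_, ?_⟩
  · have h2 : r * y ≤ ⌊y⌋₊ := by
      have := Nat.lt_floor_add_one y
      rw [div_le_iff₀ (by linarith)] at h1
      nlinarith
    have h3 := Real.rpow_le_rpow (by positivity) h2 hp.le
    rw [Real.mul_rpow hr0 hy0, hrp, hyp] at h3
    have : t' / t * (t * (κ * X)) = t' * (κ * X) := by field_simp
    linarith
  · rw [← hyp]
    exact Real.rpow_le_rpow (by positivity) (Nat.floor_le hy0) hp.le

lemma h_small {p κ : ℝ} (hp : 1 < p) (hκ : 0 < κ) :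
    ∀ᶠ X : ℝ in atTop, ∀ h : ℕ, (h : ℝ) ^ p ≤ 2 * (κ * X) → ((h : ℝ) + 1) * (84 * Real.log X) ≤ X := by
  set C := (2 * κ) ^ (1 / p) with hC
  have hC0 : 0 < C := by positivity
  have hp0 : 0 < p := by linarith
  filter_upwards [ev_log (t := 1 - 1 / p) (c := 1 / (84 * (C + 1))) (by
      rw [sub_pos, div_lt_one hp0]; exact hp) (by positivity), eventually_ge_atTop 1] with X h1 hX h hh
  have hX0 : 0 < X := by linarith
  have h2 : (h : ℝ) ≤ C * X ^ (1 / p) := by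
    have := Real.rpow_le_rpow (by positivity) hh (show 0 ≤ 1 / p by positivity)
    rw [← Real.rpow_mul (by positivity), mul_one_div_cancel hp0.ne', Real.rpow_one, ← mul_assoc,
      Real.mul_rpow (by positivity) hX0.le] at this
    exact this
  have h3 : 1 ≤ X ^ (1 / p) := Real.one_le_rpow hX (by positivity)
  have h4 : (h : ℝ) + 1 ≤ (C + 1) * X ^ (1 / p) := by linarith
  have hl : 0 ≤ Real.log X := Real.log_nonneg hX
  calc ((h : ℝ) + 1) * (84 * Real.log X) ≤ ((C + 1) * X ^ (1 / p)) * (84 * (1 / (84 * (C + 1)) * X ^ (1 - 1 / p))) :=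
        mul_le_mul h4 (by linarith) (by positivity) (by positivity)
    _ = X ^ (1 / p) * X ^ (1 - 1 / p) := by field_simp
    _ = X := by rw [← Real.rpow_add hX0]; simp

end PS

namespace PS
open scoped ENNReal

lemma lowerP {p β : ℝ} (hp : 1 ≤ p) (hok : okβ β) :
    ∀ᶠ L : ℕ in atTop, ∀ h : ℕ, Real.log L ^ 20 ≤ aa p β L h →
      Pr p β (box L) {η | ∀ x ∈ box L, ¬ (h : ℤ) ≤ η x} ≤ 2 / Real.log L := by
  have hβ : 0 < β := by linarith [hok.1]
  filter_upwards [er_small 4, evL (ev_lin one_pos 2)] with L her hX2 h hT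
  rw [one_mul] at hX2
  have hX1 : 1 ≤ Real.log L := by linarith
  have hL := L_exp hX1
  have hmm := mm_le hX1
  set X := Real.log L with hX
  set s : ℕ := (mm L) ^ 2 with hs
  have hs1 : ((s : ℝ) + 1) ≤ 17 * X ^ 4 := by
    have h1 : (s : ℝ) ≤ (4 * X ^ 2) ^ 2 := by
      rw [hs, Nat.cast_pow]; exact pow_le_pow_left₀ (by positivity) hmm _
    have h2 : 1 ≤ X ^ 4 := one_le_pow₀ hX1
    nlinarith
  have hsq : ((s : ℝ) + 1) ^ 2 * X ≤ X ^ 20 := by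
    have h1 : ((s : ℝ) + 1) ^ 2 ≤ (17 * X ^ 4) ^ 2 := pow_le_pow_left₀ (by positivity) hs1 _
    have h2 : (2:ℝ) ^ 11 ≤ X ^ 11 := pow_le_pow_left₀ (by norm_num) hX2 _
    calc ((s : ℝ) + 1) ^ 2 * X ≤ (17 * X ^ 4) ^ 2 * X := mul_le_mul_of_nonneg_right h1 (by linarith)
      _ = 289 * X ^ 9 := by ring
      _ ≤ X ^ 11 * X ^ 9 := mul_le_mul_of_nonneg_right (by norm_num at h2; linarith) (by positivity)
      _ = _ := by ring
  set J : Finset Site := (Finset.Ico (0:ℤ) (s + 1)) ×ˢ (Finset.Ico (0:ℤ) (s + 1)) with hJ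
  set f : Site → Site := fun z => (z.1 % (s + 1), z.2 % (s + 1)) with hf
  have hs0 : (0 : ℤ) < (s : ℤ) + 1 := by positivity
  have hJc : J.card = (s + 1) ^ 2 := by
    rw [hJ, Finset.card_product, Int.card_Ico, sq]; congr 1 <;> omega
  obtain ⟨c, _, hc⟩ := Finset.exists_le_sum_fiber_of_maps_to_of_nsmul_le_sum (s := box L) (t := J) (f := f)
    (w := fun x => Pr p β (box L) {η | (h : ℤ) ≤ η x}) (b := X) (by
      intro z _
      rw [hJ, Finset.mem_product, Finset.mem_Ico, Finset.mem_Ico]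
      exact ⟨⟨Int.emod_nonneg _ hs0.ne', Int.emod_lt_of_pos _ hs0⟩, ⟨Int.emod_nonneg _ hs0.ne', Int.emod_lt_of_pos _ hs0⟩⟩)
    ⟨(0, 0), by rw [hJ, Finset.mem_product, Finset.mem_Ico]; exact ⟨⟨le_refl _, hs0⟩, ⟨le_refl _, hs0⟩⟩⟩ (by
      rw [hJc, nsmul_eq_mul]
      push_cast
      exact hsq.trans hT)
  set S := (box L).filter (fun x => f x = c) with hS
  set μ := ∑ x ∈ S, Pr p β (box L) {η | (h : ℤ) ≤ η x} with hμ
  have h2 := second_moment hp hβ (box L) S (fun x => {η | (h : ℤ) ≤ η x}) μ (er L (mm L)) hμ (er_nonneg _ _) (by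
    intro x hx y hy hxy
    apply SW_xy hp hok
    intro hU
    rw [Ub, mem_rect, max_le_iff, max_le_iff, le_min_iff, le_min_iff, ← hs] at hU
    rw [hS, Finset.mem_filter] at hx hy
    have hfe : f x = f y := hx.2.trans hy.2.symm
    rw [hf, Prod.mk.injEq] at hfe
    have key : ∀ a b : ℤ, a % (s + 1) = b % (s + 1) → b - s ≤ a → a ≤ b + s → a = b := by
      intro a b hab h1 h2
      have hd : ((s : ℤ) + 1) ∣ (a - b) := Int.ModEq.dvd (Int.ModEq.symm hab)
      have := Int.eq_zero_of_abs_lt_dvd hd (by rw [abs_lt]; constructor <;> omega)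
      omega
    apply hxy
    exact Prod.ext (key _ _ hfe.1 hU.1.1.2 hU.1.2.2) (key _ _ hfe.2 hU.2.1.2 hU.2.2.2))
  have hcard : (S.card : ℝ) ≤ (L : ℝ) ^ 2 := by
    have : S.card ≤ (box L).card := Finset.card_filter_le _ _
    rw [card_box] at this
    exact_mod_cast this
  have herr : (S.card : ℝ) ^ 2 * er L (mm L) ≤ 1 := by
    calc (S.card : ℝ) ^ 2 * er L (mm L) ≤ ((L : ℝ) ^ 2) ^ 2 * Real.exp (-(4 * X)) :=
          mul_le_mul (pow_le_pow_left₀ (Nat.cast_nonneg _) hcard _) her (er_nonneg _ _) (sq_nonneg _)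
      _ = 1 := by
        rw [hL, ← pow_mul, ← Real.exp_nat_mul, ← Real.exp_add]
        norm_num
  have hmono : Pr p β (box L) {η | ∀ x ∈ box L, ¬ (h : ℤ) ≤ η x} ≤
      Pr p β (box L) {η | ∀ x ∈ S, η ∉ (fun x => {η : Site → ℤ | (h : ℤ) ≤ η x}) x} := by
    apply Pr_mono hp hβ
    intro η hη x hx
    exact hη x (Finset.mem_of_mem_filter x hx)
  refine hmono.trans ?_
  set P := Pr p β (box L) {η | ∀ x ∈ S, η ∉ (fun x => {η : Site → ℤ | (h : ℤ) ≤ η x}) x} with hP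
  have hP0 : 0 ≤ P := Pr_nonneg _ _ _ _
  have hc' : X ≤ μ := hc
  have hμ0 : 0 < μ := by linarith
  have h3 : P * μ ≤ 2 := by
    have : P * μ * μ ≤ 2 * μ := by nlinarith
    exact le_of_mul_le_mul_right this hμ0
  rw [le_div_iff₀ (by linarith)]
  nlinarith

lemma upperP {p β : ℝ} (hp1 : 1 < p) (hp2 : p < 2) (hok : okβ β) :
    ∀ᶠ L : ℕ in atTop, ∀ h : ℕ, 1 / 2 * (2 / (β * Estar p) * Real.log L) ≤ (h : ℝ) ^ p →
      (h : ℝ) ^ p ≤ 2 * (2 / (β * Estar p) * Real.log L) → aa p β L (h + 1) ≤ Real.log L ^ 20 →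
      Pr p β (box L) {η | ∃ x ∈ box L, ((h + 2 : ℕ) : ℤ) ≤ η x} ≤ 1 / Real.log L := by
  have hβ : 0 < β := by linarith [hok.1]
  have hE := Estar_pos hp1 hp2
  filter_upwards [UB (t := 1 / 2) (c := 1 / 4) hp1 hp2 hok (by norm_num) (by norm_num),
    evL (h_small hp1 (show 0 < 2 / (β * Estar p) by positivity)),
    evL (ev_lin (show (0:ℝ) < 1/4 by norm_num) 1)] with L h1 h2 h3 h hlo hhi ha
  set X := Real.log L with hX
  have hX4 : 4 ≤ X := by linarith
  set n := h + 1 with hn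
  have hn0 : (0:ℝ) < n := by rw [hn]; positivity
  set q := Real.exp (-(X / (4 * n))) with hq
  have hqn : q ^ n = Real.exp (-(X / 4)) := by
    rw [hq, ← Real.exp_nat_mul]; congr 1; field_simp
  have hPr : ∀ x ∈ box L, Pr p β (box L) {η | ((n + 1 : ℕ) : ℤ) ≤ η x} ≤ q * Pr p β (box L) {η | (n : ℤ) ≤ η x} := by
    intro x hx
    apply LCP hp1.le hβ hx n (Real.exp_pos _).le (by omega)
    rw [hqn]
    have g1 := h1 n (hlo.trans (Real.rpow_le_rpow (by positivity) (by rw [hn]; push_cast; linarith) (by linarith))) x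
    have e : Real.exp (-(2 * (1 / 4) * X)) * Real.exp (X / 4) = Real.exp (-(X / 4)) := by
      rw [← Real.exp_add]; congr 1; ring
    have g2 := Real.add_one_le_exp (X / 4)
    rw [← e]
    have g3 : 2 ≤ Real.exp (X / 4) := by linarith
    have g4 := Real.exp_pos (-(2 * (1 / 4) * X))
    nlinarith
  have hsum := Finset.sum_le_sum hPr
  rw [← Finset.mul_sum] at hsum
  have hb : Pr p β (box L) {η | ∃ x ∈ box L, ((h + 2 : ℕ) : ℤ) ≤ η x} ≤
      ∑ x ∈ box L, Pr p β (box L) {η | ((n + 1 : ℕ) : ℤ) ≤ η x} :=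
    Pr_biUnion hp1.le hβ (box L) (fun η hη => hη)
  have hq0 : 0 ≤ q := (Real.exp_pos _).le
  have hq1 : q ≤ 1 / X ^ 21 := by
    have g := h2 h hhi
    have hnr : (n : ℝ) = (h : ℝ) + 1 := by rw [hn]; push_cast; rfl
    have g2 : 21 * Real.log X ≤ X / (4 * n) := by
      rw [le_div_iff₀ (by positivity), hnr]; linarith
    have g3 : (1 : ℝ) / X ^ 21 = Real.exp (-(21 * Real.log X)) := by
      rw [Real.exp_neg, one_div]
      congr 1
      have : (21:ℝ) * Real.log X = ((21:ℕ) : ℝ) * Real.log X := by norm_num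
      rw [this, Real.exp_nat_mul, Real.exp_log (by linarith)]
    rw [g3]
    exact Real.exp_le_exp.2 (by linarith)
  have ha' : ∑ x ∈ box L, Pr p β (box L) {η | (n : ℤ) ≤ η x} ≤ X ^ 20 := ha
  have hfin : q * ∑ x ∈ box L, Pr p β (box L) {η | (n : ℤ) ≤ η x} ≤ 1 / X ^ 21 * X ^ 20 :=
    mul_le_mul hq1 ha' (Finset.sum_nonneg (fun x _ => Pr_nonneg _ _ _ _)) (by positivity)
  have e : 1 / X ^ 21 * X ^ 20 = 1 / X := by
    have : X ≠ 0 := by linarith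
    field_simp
  rw [e] at hfin
  linarith

def MM (p β : ℝ) (L : ℕ) : ℕ := max 1 (Nat.findGreatest (fun h => Real.log L ^ 20 ≤ aa p β L h) ⌈Real.log L⌉₊)

lemma MM_spec {p β t t' : ℝ} (hp1 : 1 < p) (hp2 : p < 2) (hok : okβ β) (ht' : 0 < t') (ht'1 : t' < 1) (ht : 1 < t) (ht2 : t ≤ 2) :
    ∀ᶠ L : ℕ in atTop, t' * (2 / (β * Estar p) * Real.log L) ≤ (MM p β L : ℝ) ^ p ∧
      (MM p β L : ℝ) ^ p ≤ t * (2 / (β * Estar p) * Real.log L) ∧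
      Real.log L ^ 20 ≤ aa p β L (MM p β L) ∧ aa p β L (MM p β L + 1) ≤ Real.log L ^ 20 := by
  have hβ : 0 < β := by linarith [hok.1]
  have hE := Estar_pos hp1 hp2
  have hκ : 0 < 2 / (β * Estar p) := by positivity
  filter_upwards [aA hp1 hp2 hok ht,
    aB (δ := t') (t := (1 + t') / 2) hp1 hp2 hok ht' (by linarith) (by linarith),
    evL (ex_h (p := p) (t' := t') (t := (1 + t') / 2) (by linarith) hκ ht' (by linarith)),
    evL (h_small hp1 hκ), evL (ev_lin (mul_pos ht' hκ) 1),
    evL (ev_lin one_pos (Real.exp 1))] with L h1 h2 h3 h4 h5 h6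
  rw [one_mul] at h6
  obtain ⟨h, ha, hb⟩ := h3
  have hT := h2 h ha hb
  set X := Real.log L with hX
  have hX0 : 0 < X := (Real.exp_pos 1).trans_le h6
  have hlog : 1 ≤ Real.log X := by rwa [Real.le_log_iff_exp_le hX0]
  have hsm : ∀ k : ℕ, (k : ℝ) ^ p ≤ 2 * (2 / (β * Estar p) * X) → k + 1 ≤ ⌈X⌉₊ := by
    intro k hk
    have g := h4 k hk
    have : ((k + 1 : ℕ) : ℝ) ≤ X := by
      push_cast
      have : (0:ℝ) ≤ k := by positivity
      nlinarith
    exact_mod_cast this.trans (Nat.le_ceil X)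
  have hκX : 0 < 2 / (β * Estar p) * X := mul_pos hκ hX0
  have hh1 : 1 ≤ h := by
    by_contra hcon
    have : h = 0 := by omega
    rw [this, Nat.cast_zero, Real.zero_rpow (by linarith)] at ha
    nlinarith
  have hhX := hsm h (hb.trans (by nlinarith))
  set G := Nat.findGreatest (fun h => X ^ 20 ≤ aa p β L h) ⌈X⌉₊ with hG
  have hle : h ≤ G := Nat.le_findGreatest (by omega) hT
  have hMM : MM p β L = G := by
    show max 1 G = G
    omega
  rw [hMM]
  have hGT : X ^ 20 ≤ aa p β L G := Nat.findGreatest_spec (P := fun h => X ^ 20 ≤ aa p β L h) (m := h) (by omega) hT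
  have hup : (G : ℝ) ^ p ≤ t * (2 / (β * Estar p) * X) := by
    by_contra hcon
    have := h1 G (not_le.1 hcon).le
    linarith
  have hGX := hsm G (hup.trans (by nlinarith))
  refine ⟨ha.trans (Real.rpow_le_rpow (by positivity) (by exact_mod_cast hle) (by linarith)), hup, hGT, ?_⟩
  have := Nat.findGreatest_is_greatest (P := fun h => X ^ 20 ≤ aa p β L h) (n := ⌈X⌉₊) (k := G + 1) (by omega) hGX
  exact (not_le.1 this).le

lemma ok_ev : ∃ β₀ > (0 : ℝ), ∀ β ≥ β₀, okβ β := by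
  have key : ∀ (C : ℝ≥0∞), C ≠ ∞ → ∀ s : ℝ, ∀ᶠ β : ℝ in atTop, 64 * (ENNReal.ofReal (Real.exp (-(β - s))) * C) ≤ 1 / 2 := by
    intro C hC s
    have h1 : Tendsto (fun β : ℝ => Real.exp (-(β - s))) atTop (𝓝 0) :=
      Real.tendsto_exp_neg_atTop_nhds_zero.comp (tendsto_atTop_add_const_right _ (-s) tendsto_id)
    have h2 := ENNReal.tendsto_ofReal h1
    have h3 := ENNReal.Tendsto.mul_const (b := C) h2 (Or.inr hC)
    have h4 := ENNReal.Tendsto.const_mul (a := 64) h3 (Or.inr (by simp))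
    rw [ENNReal.ofReal_zero, zero_mul, mul_zero] at h4
    exact (h4.eventually (gt_mem_nhds (show (0:ℝ≥0∞) < 1 / 2 by simp))).mono (fun _ h => h.le)
  have hK : KK 1 ≠ ∞ := (KK_lt one_pos).ne
  have h := (eventually_ge_atTop (1:ℝ)).and ((key 2 (by simp) 0).and (key (KK 1 * KK 1) (ENNReal.mul_ne_top hK hK) 1))
  obtain ⟨b, hb⟩ := eventually_atTop.1 h
  refine ⟨max b 1, by positivity, fun β hβ => ?_⟩
  have := hb β ((le_max_left _ _).trans hβ)
  rw [sub_zero] at this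
  exact this

end PS

/-- **Theorem 4.1 (maximum for `1 < p < 2`).** There is `M(L) ∼ ((2/(E*(p)β)) log L)^{1/p}`
such that the maximum of the `p`-SOS model on the `L × L` box lies in `{M, M+1}` with
probability tending to 1. -/
theorem pSOS_two_point_concentration_of_maximum (p : ℝ) (hp1 : 1 < p) (hp2 : p < 2) :
    ∃ β₀ > (0 : ℝ), ∀ β ≥ β₀, ∃ M : ℕ → ℕ,
      (∀ L, 0 < M L) ∧
      Tendsto (fun L : ℕ => (M L : ℝ) ^ p * (Estar p * β) / (2 * Real.log L)) atTop (𝓝 1) ∧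
      Tendsto (fun L : ℕ => pProb p β (box L) fun η =>
            (∀ x ∈ box L, η x ≤ (M L : ℤ) + 1) ∧ ∃ x ∈ box L, (M L : ℤ) ≤ η x) atTop (𝓝 1) := by
  obtain ⟨β₀, hβ₀, H⟩ := PS.ok_ev
  refine ⟨β₀, hβ₀, fun β hβ' => ?_⟩
  have hok := H β hβ'
  have hβ : 0 < β := by linarith [hok.1]
  have hE := PS.Estar_pos hp1 hp2
  refine ⟨PS.MM p β, fun L => lt_of_lt_of_le one_pos (le_max_left _ _), ?_, ?_⟩
  · rw [Metric.tendsto_nhds]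
    intro ε hε
    set d := min (ε / 2) (1 / 2) with hd
    have hd0 : 0 < d := lt_min (by linarith) (by norm_num)
    have hd1 : d ≤ 1 / 2 := min_le_right _ _
    have hd2 : d ≤ ε / 2 := min_le_left _ _
    filter_upwards [PS.MM_spec (t' := 1 - d) (t := 1 + d) hp1 hp2 hok (by linarith) (by linarith) (by linarith) (by linarith),
      PS.evL (PS.ev_lin one_pos 1)] with L h1 h2
    rw [one_mul] at h2
    have hX : 0 < Real.log L := by linarith
    have hbe : 0 < β * Estar p := mul_pos hβ hE
    have e1 : ∀ r : ℝ, r * (2 / (β * Estar p) * Real.log L) = r * (2 * Real.log L) / (Estar p * β) := by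
      intro r; field_simp
    rw [e1, e1] at h1
    have hEb : 0 < Estar p * β := mul_pos hE hβ
    have h3 := (div_le_iff₀ hEb).1 h1.1
    have h4 := (le_div_iff₀ hEb).1 h1.2.1
    have h5 : 1 - d ≤ (PS.MM p β L : ℝ) ^ p * (Estar p * β) / (2 * Real.log L) := by
      rw [le_div_iff₀ (by linarith)]; exact h3
    have h6 : (PS.MM p β L : ℝ) ^ p * (Estar p * β) / (2 * Real.log L) ≤ 1 + d := by
      rw [div_le_iff₀ (by linarith)]; exact h4
    rw [Real.dist_eq, abs_lt]
    constructor <;> linarith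
  · have hlim : Tendsto (fun L : ℕ => 1 - 3 / Real.log L) atTop (𝓝 1) := by
      have h1 : Tendsto (fun L : ℕ => Real.log (L : ℝ)) atTop atTop :=
        Real.tendsto_log_atTop.comp tendsto_natCast_atTop_atTop
      have h2 := (tendsto_const_nhds (x := (1:ℝ))).sub (h1.const_div_atTop 3)
      rwa [sub_zero] at h2
    refine tendsto_of_tendsto_of_tendsto_of_le_of_le' hlim tendsto_const_nhds ?_ ?_
    · filter_upwards [PS.MM_spec (t' := 1 / 2) (t := 2) hp1 hp2 hok (by norm_num) (by norm_num) (by norm_num) (by norm_num),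
        PS.lowerP hp1.le hok, PS.upperP hp1 hp2 hok] with L h1 h2 h3
      have h4 := h2 _ h1.2.2.1
      have h5 := h3 _ h1.1 h1.2.1 h1.2.2.2
      rw [PS.pProb_eq hp1.le]
      set M := PS.MM p β L with hM
      have h6 : PS.Pr p β (box L) Set.univ ≤
          PS.Pr p β (box L) {η | (∀ x ∈ box L, η x ≤ (M : ℤ) + 1) ∧ ∃ x ∈ box L, (M : ℤ) ≤ η x} +
          PS.Pr p β (box L) ({η | ∀ x ∈ box L, ¬ (M : ℤ) ≤ η x} ∪ {η | ∃ x ∈ box L, ((M + 2 : ℕ) : ℤ) ≤ η x}) := by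
        apply PS.Pr_union hp1.le hβ
        intro η _
        by_cases ha : ∃ x ∈ box L, ((M + 2 : ℕ) : ℤ) ≤ η x
        · right; right; exact ha
        · by_cases hb : ∃ x ∈ box L, (M : ℤ) ≤ η x
          · left
            refine ⟨fun x hx => ?_, hb⟩
            by_contra hcon
            exact ha ⟨x, hx, by push_cast; omega⟩
          · right; left
            exact fun x hx hxx => hb ⟨x, hx, hxx⟩
      have h7 := PS.Pr_union (R := box L) hp1.le hβ (subset_refl ({η | ∀ x ∈ box L, ¬ (M : ℤ) ≤ η x} ∪ {η | ∃ x ∈ box L, ((M + 2 : ℕ) : ℤ) ≤ η x}))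
      rw [PS.Pr_univ hp1.le hβ] at h6
      have e : 3 / Real.log L = 2 / Real.log L + 1 / Real.log L := by ring
      linarith
    · filter_upwards with L
      rw [PS.pProb_eq hp1.le]
      exact PS.Pr_le_one hp1.le hβ _ _
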